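/- Let Δ be a fundamental discriminant and r ∈ ℤ with Δ ≡ r² (mod 4N). The twisted Siegel theta function Θ_{Δ,r}(τ,z) is a non-holomorphic ℂ[L'/L]-valued modular form for Mp₂(ℤ) of weight 1/2 in τ; it transforms with the Weil representation ρ_L if Δ > 0 and with the conjugate representation ρ̄_L if Δ < 0. -/

import Mathlib

noncomputable section

open Complex
open scoped Classical Manifold

/-- `e(x) = exp(2πix)`. -/
def e (x : ℂ) : ℂ := Complex.exp (2 * (Real.pi : ℂ) * Complex.I * x)

/-- `D` is a fundamental discriminant: either `D ≡ 1 (mod 4)` and squarefree, or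
`D = 4m` with `m ≡ 2, 3 (mod 4)` squarefree. -/
def IsFundamentalDiscriminant (D : ℤ) : Prop :=
  (D % 4 = 1 ∧ Squarefree D) ∨
    (D % 4 = 0 ∧ Squarefree (D / 4) ∧ (D / 4 % 4 = 2 ∨ D / 4 % 4 = 3))

/-- The Kronecker symbol `(a/2)`. -/
def kron2 (a : ℤ) : ℤ :=
  if a % 2 = 0 then 0 else if a % 8 = 1 ∨ a % 8 = 7 then 1 else -1

/-- The Kronecker symbol `(a/n)`, extending the Jacobi symbol to arbitrary integers `n`. -/
def kronecker (a n : ℤ) : ℤ :=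
  if n = 0 then (if a = 1 ∨ a = -1 then 1 else 0)
  else
    (if n < 0 ∧ a < 0 then -1 else 1) * kron2 a ^ n.natAbs.factorization 2 *
      jacobiSym a (n.natAbs / 2 ^ n.natAbs.factorization 2)

/-- The discriminant `b² - 4Nac` of the integral binary quadratic form `[a, b, Nc]`
corresponding to the lattice vector `λ = [[b/2N, -a/N], [c, -b/2N]] ∈ L'`;
note `Q(λ) = (b² - 4Nac)/(4N)`. -/
def QD (N : ℕ) (a b c : ℤ) : ℤ := b ^ 2 - 4 * (N : ℤ) * a * c

/-- The condition under which the generalized genus character `χ_Δ` is non-zero at `[a, b, Nc]`: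
`Δ ∣ b² - 4Nac`, `(b² - 4Nac)/Δ` is a square modulo `4N`, and `gcd(a, b, c, Δ) = 1`. -/
def GenusCharCond (N : ℕ) (Δ a b c : ℤ) : Prop :=
  Δ ∣ QD N a b c ∧ (∃ s : ℤ, QD N a b c / Δ ≡ s ^ 2 [ZMOD (4 * (N : ℤ))]) ∧
    Int.gcd (Int.gcd (Int.gcd a b) c) Δ = 1

/-- `χ` (with `χ a b c` meaning `χ_Δ` applied to the vector of `L'` corresponding to the
binary quadratic form `[a, b, Nc]`) is the generalized genus character `χ_Δ` of
Gross–Kohnen–Zagier: it only depends on the argument modulo `ΔL`, it vanishes unless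
`GenusCharCond` holds, and in that case it equals the Kronecker symbol `(Δ/n)` for any
integer `n` prime to `Δ` represented by one of the forms `[N₁a, b, N₂c]` with
`N₁N₂ = N`, `N₁, N₂ > 0`. -/
def IsGenusChar (N : ℕ) (Δ : ℤ) (χ : ℤ → ℤ → ℤ → ℤ) : Prop :=
  (∀ a b c a' b' c' : ℤ,
      a ≡ a' [ZMOD Δ] → b ≡ b' [ZMOD (2 * (N : ℤ) * Δ)] → c ≡ c' [ZMOD Δ] →
      χ a b c = χ a' b' c') ∧
  (∀ a b c : ℤ, ¬ GenusCharCond N Δ a b c → χ a b c = 0) ∧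
  (∀ a b c n : ℤ, GenusCharCond N Δ a b c → Int.gcd n Δ = 1 →
      (∃ N₁ N₂ x y : ℤ, N₁ * N₂ = (N : ℤ) ∧ 0 < N₁ ∧ 0 < N₂ ∧
        n = N₁ * a * x ^ 2 + b * x * y + N₂ * c * y ^ 2) →
      χ a b c = kronecker Δ n)

/-- `pz N a b c t` is `λ_z²/2`, where `λ ∈ L'` corresponds to the binary quadratic form
`[a, b, Nc]`, and `λ_z` is the projection of `λ` to the positive definite plane
`z = z(t) ∈ Gr(V)` attached to `t ∈ ℍ` (spanned by the real and imaginary parts of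
`[[t, -t²], [1, -t]]`). -/
def pz (N : ℕ) (a b c : ℤ) (t : UpperHalfPlane) : ℝ :=
  (((b : ℝ) * t.re - (a : ℝ) - (N : ℝ) * (c : ℝ) * (t.re ^ 2 - t.im ^ 2)) ^ 2 +
      ((b : ℝ) * t.im - 2 * (N : ℝ) * (c : ℝ) * t.re * t.im) ^ 2) /
    (4 * (N : ℝ) * t.im ^ 2)

/-- `Qval N a b c = Q(λ) = (b² - 4Nac)/(4N)` for `λ ∈ L'` corresponding to `[a, b, Nc]`. -/
def Qval (N : ℕ) (a b c : ℤ) : ℝ := ((QD N a b c : ℤ) : ℝ) / (4 * (N : ℝ))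

/-- The component `θ_{Δ,r,h}(τ, z(t))` of the twisted Siegel theta function:
`θ_{Δ,r,h}(τ,z) = v^{1/2} ∑_{λ ∈ L + rh, Q(λ) ≡ ΔQ(h) (Δ)} χ_Δ(λ)
  e(λ_z²/2 · τ/|Δ| + λ_{z⊥}²/2 · τ̄/|Δ|)`,
where `λ` runs over the triples `(a, b, c) ∈ ℤ³` (i.e. the vectors
`[[b/2N, -a/N], [c, -b/2N]] ∈ L'`) with `b ≡ rh (mod 2N)` and
`b² - 4Nac ≡ Δh² (mod 4NΔ)`, and the Grassmannian `Gr(V)` is identified with `ℍ`. -/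
def thetaComp (N : ℕ) (Δ r : ℤ) (χ : ℤ → ℤ → ℤ → ℤ)
    (h : ZMod (2 * N)) (τ t : UpperHalfPlane) : ℂ :=
  (Real.sqrt τ.im : ℂ) *
    ∑' v : ℤ × ℤ × ℤ,
      if (v.2.1 ≡ r * (h.val : ℤ) [ZMOD (2 * (N : ℤ))]) ∧
          (QD N v.1 v.2.1 v.2.2 ≡ Δ * (h.val : ℤ) ^ 2 [ZMOD (4 * (N : ℤ) * Δ)]) then
        (χ v.1 v.2.1 v.2.2 : ℂ) *
          e ((pz N v.1 v.2.1 v.2.2 t / (Δ.natAbs : ℝ) : ℝ) * (τ : ℂ) +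
             (((Qval N v.1 v.2.1 v.2.2 - pz N v.1 v.2.1 v.2.2 t) / (Δ.natAbs : ℝ) : ℝ)) *
               (starRingEnd ℂ) (τ : ℂ))
      else 0

/-- An element of the metaplectic group `Mp₂(ℤ)`: a pair `(M, φ)` where
`M ∈ SL₂(ℤ)` and `φ : ℍ → ℂ` is holomorphic with `φ(τ)² = cτ + d`. -/
structure Mp2 where
  M : Matrix.SpecialLinearGroup (Fin 2) ℤ
  φ : UpperHalfPlane → ℂ
  hol : MDifferentiable 𝓘(ℂ) 𝓘(ℂ) φ
  sq : ∀ τ : UpperHalfPlane, φ τ ^ 2 = (M.1 1 0 : ℂ) * (τ : ℂ) + (M.1 1 1 : ℂ)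

namespace TwistedTheta

open scoped NumberTheorySymbols

lemma IsFundamentalDiscriminant.ne_zero {Δ : ℤ} (h : IsFundamentalDiscriminant Δ) : Δ ≠ 0 := by
  rintro rfl
  rcases h with ⟨h, -⟩ | ⟨-, -, h⟩ <;> revert h <;> decide

lemma two_dvd_four_dvd {Δ : ℤ} (h : IsFundamentalDiscriminant Δ) (h2 : (2 : ℤ) ∣ Δ) :
    ∃ m : ℤ, Δ = 4 * m ∧ Squarefree m ∧ (m % 4 = 2 ∨ m % 4 = 3) := by
  rcases h with ⟨h, -⟩ | ⟨h0, h1, h⟩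
  · omega
  · refine ⟨Δ / 4, by omega, h1, h⟩

lemma odd_prime_sq_not_dvd {Δ : ℤ} (h : IsFundamentalDiscriminant Δ) {p : ℕ} (hp : p.Prime)
    (hp2 : p ≠ 2) : ¬ ((p : ℤ) * p ∣ Δ) := by
  intro hd
  have hu : ¬ IsUnit (p : ℤ) := (Nat.prime_iff_prime_int.mp hp).not_isUnit
  rcases h with ⟨-, h⟩ | ⟨h0, h1, -⟩
  · exact hu (h _ hd)
  · refine hu (h1 _ ?_)
    have hc : IsCoprime ((p : ℤ) * p) 4 := by
      have : IsCoprime (p : ℤ) 2 := by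
        have := (Nat.coprime_primes hp Nat.prime_two).mpr hp2
        exact_mod_cast Nat.isCoprime_iff_coprime.mpr this
      have h4 : IsCoprime (p : ℤ) (2 * 2) := this.mul_right this
      exact IsCoprime.mul_left h4 h4
    refine hc.dvd_of_dvd_mul_left (?_ : _ ∣ 4 * (Δ / 4))
    rwa [show 4 * (Δ / 4) = Δ by omega]

lemma kronecker_eq_jacobiSym (Δ : ℤ) {k : ℕ} (hk : Odd k) : kronecker Δ k = J(Δ | k) := by
  have h0 : k ≠ 0 := hk.pos.ne'
  have hf : k.factorization 2 = 0 :=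
    Nat.factorization_eq_zero_of_not_dvd (by rwa [← even_iff_two_dvd, Nat.not_even_iff_odd])
  simp [kronecker, h0, hf, not_lt.mpr (Int.natCast_nonneg k)]

/-- Every residue class prime to `Δ` contains an odd natural number. -/
lemma exists_odd_nat {Δ : ℤ} (h0 : Δ ≠ 0) {n : ℤ} (hn : IsCoprime n Δ) :
    ∃ k : ℕ, Odd k ∧ (k : ℤ) ≡ n [ZMOD Δ] := by
  have hm : 0 ≤ n % Δ := Int.emod_nonneg _ h0
  rcases Int.even_or_odd (n % Δ) with he | ho
  · have hΔ : Odd Δ := by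
      by_contra hc
      rw [Int.not_odd_iff_even] at hc
      have h2 : (2 : ℤ) ∣ n := by
        have := Int.emod_add_mul_ediv n Δ
        rw [← this]
        exact dvd_add he.two_dvd (hc.two_dvd.mul_right _)
      have := hn.isUnit_of_dvd' h2 hc.two_dvd
      exact absurd this (by decide)
    refine ⟨(n % Δ + |Δ|).toNat, ?_, ?_⟩
    · have : Odd (n % Δ + |Δ|) := he.add_odd (odd_abs.mpr hΔ)
      rw [← Int.odd_coe_nat, Int.toNat_of_nonneg (by positivity)]; exact this
    · rw [Int.toNat_of_nonneg (by positivity)]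
      have h1 : n % Δ ≡ n [ZMOD Δ] := Int.mod_modEq _ _
      have h2 : |Δ| ≡ 0 [ZMOD Δ] := (Int.modEq_zero_iff_dvd).mpr ((dvd_abs _ _).mpr dvd_rfl)
      simpa using h1.add h2
  · refine ⟨(n % Δ).toNat, ?_, ?_⟩
    · rw [← Int.odd_coe_nat, Int.toNat_of_nonneg hm]; exact ho
    · rw [Int.toNat_of_nonneg hm]; exact Int.mod_modEq _ _

lemma isCoprime_of_modEq {Δ m n : ℤ} (h : m ≡ n [ZMOD Δ]) (hn : IsCoprime n Δ) :
    IsCoprime m Δ := by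
  obtain ⟨k, hk⟩ := h.symm.dvd
  have : m = n + Δ * k := by linarith
  rw [this]
  exact hn.add_mul_left_left k

lemma one_add_mul_natAbs_emod (k : ℕ) (l : ℤ) :
    ((1 + k * l.natAbs : ℕ) : ℤ) % (l.natAbs : ℕ) = 1 % (l.natAbs : ℕ) := by
  rw [Nat.cast_add, Nat.cast_mul, Int.add_mul_emod_self_right, Nat.cast_one]

section Character

variable {N : ℕ} {Δ : ℤ} {χ : ℤ → ℤ → ℤ → ℤ}

lemma genusCharCond_scalar (n : ℤ) (hn : IsCoprime n Δ) : GenusCharCond N Δ n 0 0 := by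
  refine ⟨by simp [QD], ⟨0, by simp [QD]⟩, ?_⟩
  rw [Int.isCoprime_iff_gcd_eq_one] at hn
  simpa [Int.gcd_eq_natAbs_gcd_natAbs, Int.natAbs_abs] using hn

lemma chi_scalar_modEq (hχ : IsGenusChar N Δ χ) {m n : ℤ} (h : m ≡ n [ZMOD Δ]) :
    χ m 0 0 = χ n 0 0 :=
  hχ.1 _ _ _ _ _ _ h rfl rfl

lemma chi_scalar_eq_kronecker (hχ : IsGenusChar N Δ χ) (hN : 0 < N) {n : ℤ}
    (hn : IsCoprime n Δ) : χ n 0 0 = kronecker Δ n :=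
  hχ.2.2 n 0 0 n (genusCharCond_scalar n hn) (Int.isCoprime_iff_gcd_eq_one.mp hn)
    ⟨1, N, 1, 0, by ring, one_pos, by exact_mod_cast hN, by ring⟩

lemma chi_scalar_eq_zero (hχ : IsGenusChar N Δ χ) {n : ℤ} (hn : ¬ IsCoprime n Δ) :
    χ n 0 0 = 0 := by
  refine hχ.2.1 _ _ _ fun h => hn ?_
  rw [Int.isCoprime_iff_gcd_eq_one]
  simpa [Int.gcd_eq_natAbs_gcd_natAbs, Int.natAbs_abs] using h.2.2

lemma chi_scalar_eq_jacobiSym (hχ : IsGenusChar N Δ χ) (hN : 0 < N) {k : ℕ} (hk : Odd k) {n : ℤ}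
    (hn : IsCoprime n Δ) (h : (k : ℤ) ≡ n [ZMOD Δ]) : χ n 0 0 = J(Δ | k) := by
  rw [← chi_scalar_modEq hχ h, chi_scalar_eq_kronecker hχ hN (isCoprime_of_modEq h hn),
    kronecker_eq_jacobiSym Δ hk]

lemma chi_scalar_mul (hχ : IsGenusChar N Δ χ) (hN : 0 < N) (h0 : Δ ≠ 0) (m n : ℤ) :
    χ (m * n) 0 0 = χ m 0 0 * χ n 0 0 := by
  by_cases hm : IsCoprime m Δ
  · by_cases hn : IsCoprime n Δ
    · obtain ⟨k, hk, hkm⟩ := exists_odd_nat h0 hm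
      obtain ⟨l, hl, hln⟩ := exists_odd_nat h0 hn
      rw [chi_scalar_eq_jacobiSym hχ hN hk hm hkm, chi_scalar_eq_jacobiSym hχ hN hl hn hln,
        chi_scalar_eq_jacobiSym hχ hN (hk.mul hl) (hm.mul_left hn)
          (by push_cast; exact hkm.mul hln),
        jacobiSym.mul_right' _ (by rintro rfl; simp at hk) (by rintro rfl; simp at hl)]
    · rw [chi_scalar_eq_zero hχ hn, chi_scalar_eq_zero hχ, mul_zero]
      exact fun h => hn h.of_mul_left_right
  · rw [chi_scalar_eq_zero hχ hm, chi_scalar_eq_zero hχ, zero_mul]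
    exact fun h => hm h.of_mul_left_left

lemma chi_scalar_one (hχ : IsGenusChar N Δ χ) (hN : 0 < N) : χ 1 0 0 = 1 := by
  rw [chi_scalar_eq_jacobiSym hχ hN (k := 1) (by simp) isCoprime_one_left (by simp)]
  simp

lemma chi_scalar_mul_self (hχ : IsGenusChar N Δ χ) (hN : 0 < N) (h0 : Δ ≠ 0) {n : ℤ}
    (hn : IsCoprime n Δ) : χ n 0 0 * χ n 0 0 = 1 := by
  obtain ⟨k, hk, hkn⟩ := exists_odd_nat h0 hn
  rw [chi_scalar_eq_jacobiSym hχ hN hk hn hkn, ← pow_two]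
  exact jacobiSym.sq_one (Int.isCoprime_iff_gcd_eq_one.mp (isCoprime_of_modEq hkn hn).symm)

/-- The genus character is trivial on numbers represented by `[N₁, r, N₂M]`, a form of
discriminant `Δ = r² - 4NM`. -/
lemma chi_scalar_norm (hχ : IsGenusChar N Δ χ) (hN : 0 < N) {r M : ℤ}
    (hΔ : Δ = r ^ 2 - 4 * N * M) (h0 : Δ ≠ 0) {N₁ N₂ : ℤ} (hN12 : N₁ * N₂ = N) (h1 : 0 < N₁)
    (h2 : 0 < N₂) {x y : ℤ} (hn : IsCoprime (N₁ * x ^ 2 + r * x * y + N₂ * M * y ^ 2) Δ) :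
    χ (N₁ * x ^ 2 + r * x * y + N₂ * M * y ^ 2) 0 0 = 1 := by
  have hQ : QD N 1 r M = Δ := by rw [QD, hΔ]; ring
  have hc : GenusCharCond N Δ 1 r M := by
    refine ⟨by rw [hQ], ⟨1, by rw [hQ, Int.ediv_self h0]; rfl⟩, by simp⟩
  rw [chi_scalar_eq_kronecker hχ hN hn,
    ← hχ.2.2 1 r M _ hc (Int.isCoprime_iff_gcd_eq_one.mp hn)
      ⟨N₁, N₂, x, y, hN12, h1, h2, by ring⟩,
    hχ.2.2 1 r M 1 hc (by simp) ⟨1, N, 1, 0, by ring, one_pos, by exact_mod_cast hN, by ring⟩,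
    ← chi_scalar_eq_kronecker hχ hN isCoprime_one_left, chi_scalar_one hχ hN]

/-- Primitivity of the quadratic character at an odd prime. -/
lemma chi_scalar_odd_prime (hχ : IsGenusChar N Δ χ) (hN : 0 < N)
    (hfd : IsFundamentalDiscriminant Δ) {p : ℕ} (hp : p.Prime) (hp2 : p ≠ 2) {Δ' : ℤ}
    (hΔ' : Δ = p * Δ') {t : ℤ} (ht : t ≡ 1 [ZMOD Δ']) (hsq : ¬ IsSquare (t : ZMod p)) :
    IsCoprime t Δ ∧ χ t 0 0 = -1 := by
  have : Fact p.Prime := ⟨hp⟩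
  have h0 := IsFundamentalDiscriminant.ne_zero hfd
  have h0' : Δ' ≠ 0 := by rintro rfl; simp [hΔ'] at h0
  have hpI := Nat.prime_iff_prime_int.mp hp
  have hpodd : Odd p := hp.odd_of_ne_two hp2
  have hpΔ' : ¬ (p : ℤ) ∣ Δ' := fun h => odd_prime_sq_not_dvd hfd hp hp2
    (by rw [hΔ']; exact mul_dvd_mul_left _ h)
  have hpt : ¬ (p : ℤ) ∣ t := fun h => hsq (by
    rw [(ZMod.intCast_zmod_eq_zero_iff_dvd t p).mpr h]; exact IsSquare.zero)
  have hct : IsCoprime t Δ := by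
    rw [hΔ']
    refine IsCoprime.mul_right ?_ (isCoprime_of_modEq ht isCoprime_one_left)
    exact ((Prime.coprime_iff_not_dvd hpI).mpr hpt).symm
  refine ⟨hct, ?_⟩
  have hcop : Nat.Coprime p (4 * Δ'.natAbs) := by
    rw [hp.coprime_iff_not_dvd, hp.dvd_mul]
    rintro (h | h)
    · have : p ∣ 2 ^ 2 := by simpa using h
      exact hp2 ((Nat.prime_dvd_prime_iff_eq hp Nat.prime_two).mp (hp.dvd_of_dvd_pow this))
    · exact hpΔ' (Int.natCast_dvd.mpr h)
  obtain ⟨k, hk1, hk2⟩ := Nat.chineseRemainder hcop (t % p).toNat 1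
  have hkp : (k : ℤ) ≡ t [ZMOD p] := by
    have := (Int.natCast_modEq_iff.mpr hk1)
    rw [Int.toNat_of_nonneg (Int.emod_nonneg _ hpI.ne_zero)] at this
    exact this.trans (Int.mod_modEq _ _)
  have hk4 : k % 4 = 1 := by
    have := hk2.of_mul_right (Δ'.natAbs)
    simpa [Nat.ModEq] using this
  have hkodd : Odd k := by rw [Nat.odd_iff]; omega
  have hkΔ' : (k : ℤ) ≡ 1 [ZMOD Δ'] := by
    have h := Int.natCast_modEq_iff.mpr (hk2.of_mul_left 4)
    have := h.dvd
    rw [Int.natCast_natAbs, abs_dvd] at this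
    exact Int.modEq_iff_dvd.mpr (by simpa using this)
  have hkt : (k : ℤ) ≡ t [ZMOD Δ] := by
    rw [hΔ']
    have hc : IsCoprime (p : ℤ) Δ' := (Prime.coprime_iff_not_dvd hpI).mpr hpΔ'
    exact Int.modEq_iff_dvd.mpr (hc.mul_dvd hkp.dvd (hkΔ'.trans ht.symm).dvd)
  rw [chi_scalar_eq_jacobiSym hχ hN hkodd hct hkt, hΔ', jacobiSym.mul_left,
    jacobiSym.mod_right Δ' hkodd, show k % (4 * Δ'.natAbs) = 1 % (4 * Δ'.natAbs) from hk2,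
    Nat.mod_eq_of_lt (by have := Int.natAbs_pos.mpr h0'; omega), jacobiSym.one_right, mul_one,
    jacobiSym.quadratic_reciprocity_one_mod_four' hpodd hk4, jacobiSym.mod_left' hkp,
    ← jacobiSym.legendreSym.to_jacobiSym, legendreSym.eq_neg_one_iff]
  exact hsq

/-- Primitivity of the quadratic character at two. -/
lemma chi_scalar_two (hχ : IsGenusChar N Δ χ) (hN : 0 < N)
    (hfd : IsFundamentalDiscriminant Δ) (h2 : (2 : ℤ) ∣ Δ) {t : ℤ}
    (ht : t ≡ 1 + Δ / 2 [ZMOD Δ]) : IsCoprime t Δ ∧ χ t 0 0 = -1 := by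
  obtain ⟨m, rfl, -, hm⟩ := two_dvd_four_dvd hfd h2
  have hc0 : IsCoprime (1 + 4 * m / 2) (4 * m) := by
    rw [show 4 * m / 2 = 2 * m by omega]
    exact ⟨1 - 2 * m, m, by ring⟩
  have hct := isCoprime_of_modEq ht hc0
  refine ⟨hct, ?_⟩
  have hkodd : Odd (1 + 2 * m.natAbs) := ⟨m.natAbs, by ring⟩
  have hkt : ((1 + 2 * m.natAbs : ℕ) : ℤ) ≡ t [ZMOD (4 * m)] := by
    refine Int.ModEq.trans ?_ ht.symm
    rw [show 4 * m / 2 = 2 * m by omega]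
    rcases Int.natAbs_eq m with h | h
    · exact Int.modEq_iff_dvd.mpr ⟨0, by rw [Nat.cast_add, Nat.cast_mul]; omega⟩
    · exact Int.modEq_iff_dvd.mpr ⟨1, by rw [Nat.cast_add, Nat.cast_mul]; omega⟩
  rw [chi_scalar_eq_jacobiSym hχ hN hkodd hct hkt, jacobiSym.mul_left, jacobiSym.at_four hkodd,
    one_mul]
  rcases hm with hm | hm
  · obtain ⟨l, rfl⟩ : ∃ l, m = 2 * l := ⟨m / 2, by omega⟩
    have hlodd : Odd l.natAbs := by rw [Int.natAbs_odd, Int.odd_iff]; omega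
    have hk : 1 + 2 * (2 * l).natAbs = 1 + 4 * l.natAbs := by rw [Int.natAbs_mul]; simp; ring
    rw [hk] at hkodd ⊢
    have hk8 : (1 + 4 * l.natAbs) % 8 = 5 := by rw [Nat.odd_iff] at hlodd; omega
    have hJ2 : J(2 | 1 + 4 * l.natAbs) = -1 := by
      rw [jacobiSym.at_two hkodd, ZMod.χ₈_nat_mod_eight, hk8]; decide
    have hJ1 : J(-1 | 1 + 4 * l.natAbs) = 1 := by
      rw [jacobiSym.at_neg_one hkodd, ZMod.χ₄_nat_mod_four,
        show (1 + 4 * l.natAbs) % 4 = 1 by omega]; decide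
    have hJl : J((l.natAbs : ℤ) | 1 + 4 * l.natAbs) = 1 := by
      rw [jacobiSym.quadratic_reciprocity_one_mod_four' hlodd (by omega),
        jacobiSym.mod_left' (a₂ := 1) (one_add_mul_natAbs_emod _ _), jacobiSym.one_left]
    rw [jacobiSym.mul_left, hJ2]
    rcases Int.natAbs_eq l with h | h
    · rw [← h] at hJl; rw [hJl]; rfl
    · have : J(l | 1 + 4 * l.natAbs) = 1 := by
        rw [show l = -1 * (l.natAbs : ℤ) by omega, jacobiSym.mul_left]
        simp only [Int.natAbs_mul, Int.natAbs_natCast, Int.reduceNeg, Int.natAbs_neg,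
          Int.natAbs_one, one_mul]
        rw [hJ1, hJl, one_mul]
      rw [this]; rfl
  · rcases Int.natAbs_eq m with h | h
    · have hJ : J((m.natAbs : ℤ) | 1 + 2 * m.natAbs) = -1 := by
        rw [jacobiSym.quadratic_reciprocity_three_mod_four (by omega) (by omega),
          jacobiSym.mod_left' (a₂ := 1) (one_add_mul_natAbs_emod _ _), jacobiSym.one_left]
      rwa [← h] at hJ
    · have hJ : J((m.natAbs : ℤ) | 1 + 2 * m.natAbs) = 1 := by
        rw [jacobiSym.quadratic_reciprocity_one_mod_four (by omega) hkodd,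
          jacobiSym.mod_left' (a₂ := 1) (one_add_mul_natAbs_emod _ _), jacobiSym.one_left]
      have hJ1 : J(-1 | 1 + 2 * m.natAbs) = -1 := by
        rw [jacobiSym.at_neg_one hkodd, ZMod.χ₄_nat_mod_four,
          show (1 + 2 * m.natAbs) % 4 = 3 by omega]; decide
      have : J(-1 * (m.natAbs : ℤ) | 1 + 2 * m.natAbs) = -1 := by
        rw [jacobiSym.mul_left, hJ, hJ1]; rfl
      rwa [show -1 * (m.natAbs : ℤ) = m by omega] at this

end Character

/-- The binary quadratic form `[A, B, C]`. -/
def bqf {R : Type*} [CommRing R] (A B C x y : R) : R := A * x ^ 2 + B * x * y + C * y ^ 2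

/-- The polarization of the binary quadratic form `[A, B, C]`. -/
def bqfPolar {R : Type*} [CommRing R] (A B C x y u v : R) : R :=
  (2 * A * x + B * y) * u + (B * x + 2 * C * y) * v

/-- The first coordinate of the Eichler transform of `(a, c, (β, h))` along `(u, v)`. -/
def eichler {R : Type*} [CommRing R] (A B C a c β h u v : R) : R :=
  a + bqfPolar A B C β h u v + c * bqf A B C u v

lemma isCoprime_of_forall_prime {Δ n : ℤ}
    (h : ∀ p : ℕ, p.Prime → (p : ℤ) ∣ Δ → ¬ (p : ℤ) ∣ n) : IsCoprime n Δ := by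
  rw [Int.isCoprime_iff_gcd_eq_one]
  by_contra hc
  obtain ⟨p, hp, hd⟩ := Nat.exists_prime_and_dvd hc
  have hd' : (p : ℤ) ∣ (Int.gcd n Δ : ℤ) := by exact_mod_cast hd
  exact h p hp (hd'.trans (Int.gcd_dvd_right ..)) (hd'.trans (Int.gcd_dvd_left ..))

lemma not_dvd_of_isCoprime {Δ n : ℤ} (h : IsCoprime n Δ) {p : ℕ} (hp : p.Prime)
    (hd : (p : ℤ) ∣ Δ) : ¬ (p : ℤ) ∣ n := fun hn =>
  (Nat.prime_iff_prime_int.mp hp).not_isUnit (h.isUnit_of_dvd' hn hd)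

lemma exists_prime_dvd_iff {Δ : ℤ} (h0 : Δ ≠ 0) (Q : ℕ → Prop) :
    ∃ s : ℤ, ∀ p : ℕ, p.Prime → (p : ℤ) ∣ Δ → ((p : ℤ) ∣ s ↔ Q p) := by
  refine ⟨∏ q ∈ Δ.natAbs.primeFactors.filter Q, (q : ℤ), fun p hp hd => ?_⟩
  rw [(Nat.prime_iff_prime_int.mp hp).dvd_finsetProd_iff]
  constructor
  · rintro ⟨q, hq, hpq⟩
    rw [Finset.mem_filter] at hq
    have : p = q := (Nat.prime_dvd_prime_iff_eq hp (Nat.prime_of_mem_primeFactors hq.1)).mp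
      (by exact_mod_cast hpq)
    exact this ▸ hq.2
  · intro hQ
    refine ⟨p, Finset.mem_filter.mpr ⟨?_, hQ⟩, dvd_rfl⟩
    exact Nat.mem_primeFactors.mpr ⟨hp, Int.natCast_dvd.mp hd, Int.natAbs_ne_zero.mpr h0⟩

/-- A binary quadratic form which is primitive at `Δ` represents a number prime to `Δ`. -/
lemma exists_bqf_isCoprime {Δ : ℤ} (h0 : Δ ≠ 0) {A B C : ℤ}
    (h : ∀ p : ℕ, p.Prime → (p : ℤ) ∣ Δ → (p : ℤ) ∣ A → (p : ℤ) ∣ B → ¬ (p : ℤ) ∣ C) :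
    ∃ x y : ℤ, IsCoprime (bqf A B C x y) Δ := by
  obtain ⟨x, hx⟩ := exists_prime_dvd_iff h0 fun p => (p : ℤ) ∣ A ∧ ¬ (p : ℤ) ∣ C
  obtain ⟨y, hy⟩ := exists_prime_dvd_iff h0 fun p => ¬ (p : ℤ) ∣ A
  refine ⟨x, y, isCoprime_of_forall_prime fun p hp hd hn => ?_⟩
  have hpI := Nat.prime_iff_prime_int.mp hp
  specialize hx p hp hd
  specialize hy p hp hd
  rw [bqf] at hn
  by_cases hA : (p : ℤ) ∣ A
  · by_cases hC : (p : ℤ) ∣ C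
    · have hB : (p : ℤ) ∣ B * x * y := by
        have h1 := dvd_sub hn ((hA.mul_right (x ^ 2)).add (hC.mul_right (y ^ 2)))
        rwa [show A * x ^ 2 + B * x * y + C * y ^ 2 - (A * x ^ 2 + C * y ^ 2) = B * x * y by
          ring] at h1
      rcases hpI.dvd_or_dvd hB with hB | hB
      · rcases hpI.dvd_or_dvd hB with hB | hB
        · exact h p hp hd hA hB hC
        · exact (hx.mp hB).2 hC
      · exact hy.mp hB hA
    · have hx' := hx.mpr ⟨hA, hC⟩
      have h1 : (p : ℤ) ∣ C * y ^ 2 := by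
        have h1 := dvd_sub hn ((hA.mul_right (x ^ 2)).add (hx'.mul_right (B * y)))
        rwa [show A * x ^ 2 + B * x * y + C * y ^ 2 - (A * x ^ 2 + x * (B * y)) = C * y ^ 2 by
          ring] at h1
      rcases hpI.dvd_or_dvd h1 with h1 | h1
      · exact hC h1
      · exact hy.mp (hpI.dvd_of_dvd_pow h1) hA
  · have hy' := hy.mpr hA
    have h1 : (p : ℤ) ∣ A * x ^ 2 := by
      have h1 := dvd_sub hn (hy'.mul_right (B * x + C * y))
      rwa [show A * x ^ 2 + B * x * y + C * y ^ 2 - y * (B * x + C * y) = A * x ^ 2 by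
        ring] at h1
    rcases hpI.dvd_or_dvd h1 with h1 | h1
    · exact hA h1
    · exact hA (hx.mp (hpI.dvd_of_dvd_pow h1)).1

lemma prime_sq_not_dvd {Δ r : ℤ} {K : ℤ} (hfd : IsFundamentalDiscriminant Δ)
    (hΔ : Δ = r ^ 2 - 4 * K) {p : ℕ} (hp : p.Prime) (hd : (p : ℤ) ∣ Δ) :
    ¬ ((p : ℤ) * p ∣ K) := by
  intro hK
  have hpI := Nat.prime_iff_prime_int.mp hp
  have hr : (p : ℤ) ∣ r := by
    refine hpI.dvd_of_dvd_pow (n := 2) ?_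
    rw [show r ^ 2 = Δ + 4 * K by rw [hΔ]; ring]
    exact hd.add ((dvd_of_mul_left_dvd hK).mul_left 4)
  by_cases hp2 : p = 2
  · subst hp2
    obtain ⟨m, hm, -, hm4⟩ := two_dvd_four_dvd hfd hd
    obtain ⟨k, rfl⟩ := hr
    obtain ⟨l, rfl⟩ := hK
    have hmk : m = k ^ 2 - 4 * l := by
      push_cast at hΔ; linarith
    rcases Int.even_or_odd' k with ⟨j, rfl | rfl⟩ <;> ring_nf at hmk <;> omega
  · refine odd_prime_sq_not_dvd hfd hp hp2 ?_
    rw [hΔ, pow_two]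
    exact dvd_sub (mul_dvd_mul hr hr) (hK.mul_left 4)

lemma exists_norm_isCoprime {Δ r N M : ℤ} (hfd : IsFundamentalDiscriminant Δ)
    (hΔ : Δ = r ^ 2 - 4 * (N * M)) : ∃ x y : ℤ, IsCoprime (bqf N r M x y) Δ :=
  exists_bqf_isCoprime (IsFundamentalDiscriminant.ne_zero hfd) fun _ hp hd hA _ hC =>
    prime_sq_not_dvd hfd hΔ hp hd (mul_dvd_mul hA hC)

/-- A vector which is isotropic at `p ∣ Δ` lies in the radical at `p`. -/
lemma dvd_bqfPolar {Δ r N M : ℤ} (hΔ : Δ = r ^ 2 - 4 * (N * M)) {p : ℕ} (hp : p.Prime)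
    (hd : (p : ℤ) ∣ Δ) {β h : ℤ} (hP : (p : ℤ) ∣ bqf N r M β h) :
    (p : ℤ) ∣ 2 * N * β + r * h ∧ (p : ℤ) ∣ r * β + 2 * M * h := by
  have hpI := Nat.prime_iff_prime_int.mp hp
  constructor
  · refine hpI.dvd_of_dvd_pow (n := 2) ?_
    rw [show (2 * N * β + r * h) ^ 2 = bqf N r M β h * (4 * N) + Δ * h ^ 2 by
      rw [hΔ, bqf]; ring]
    exact (hP.mul_right _).add (hd.mul_right _)
  · refine hpI.dvd_of_dvd_pow (n := 2) ?_
    rw [show (r * β + 2 * M * h) ^ 2 = bqf N r M β h * (4 * M) + Δ * β ^ 2 by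
      rw [hΔ, bqf]; ring]
    exact (hP.mul_right _).add (hd.mul_right _)

section Weight

variable {N : ℕ} {Δ r M : ℤ} {χ : ℤ → ℤ → ℤ → ℤ}

/-- The genus character supported on vectors which are isotropic modulo `Δ`, in the coordinates
`b = rh + 2Nβ`. -/
def isoChar (N : ℕ) (Δ r M : ℤ) (χ : ℤ → ℤ → ℤ → ℤ) (a c β h : ℤ) : ℤ :=
  if Δ ∣ a * c - bqf (N : ℤ) r M β h then χ a (r * h + 2 * N * β) c else 0

lemma QD_eq (hΔ : Δ = r ^ 2 - 4 * (N * M)) (a c β h : ℤ) :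
    QD N a (r * h + 2 * N * β) c =
      Δ * h ^ 2 - 4 * N * (a * c - bqf (N : ℤ) r M β h) := by
  rw [QD, hΔ, bqf]; ring

lemma genusCharCond_of_isotropic (h0 : Δ ≠ 0)
    (hΔ : Δ = r ^ 2 - 4 * (N * M)) {a c β h : ℤ}
    (hiso : Δ ∣ a * c - bqf (N : ℤ) r M β h)
    (hac : ∀ p : ℕ, p.Prime → (p : ℤ) ∣ Δ → (p : ℤ) ∣ a → ¬ (p : ℤ) ∣ c) :
    GenusCharCond N Δ a (r * h + 2 * N * β) c := by
  obtain ⟨k, hk⟩ := hiso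
  have hQ : QD N a (r * h + 2 * N * β) c = Δ * (h ^ 2 - 4 * N * k) := by
    rw [QD_eq hΔ, hk]; ring
  refine ⟨hQ ▸ dvd_mul_right _ _, ⟨h, ?_⟩, ?_⟩
  · rw [hQ, Int.mul_ediv_cancel_left _ h0]
    exact Int.modEq_iff_dvd.mpr ⟨k, by ring⟩
  · rw [← Int.isCoprime_iff_gcd_eq_one]
    refine isCoprime_of_forall_prime fun p hp hd hg => ?_
    have h1 := hg.trans (Int.gcd_dvd_left ..)
    exact hac p hp hd (h1.trans (Int.gcd_dvd_left ..)) (hg.trans (Int.gcd_dvd_right ..))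

lemma not_dvd_of_genusCharCond (hΔ : Δ = r ^ 2 - 4 * (N * M))
    {a c β h : ℤ} (hiso : Δ ∣ a * c - bqf (N : ℤ) r M β h)
    (hc : GenusCharCond N Δ a (r * h + 2 * N * β) c) {p : ℕ} (hp : p.Prime)
    (hd : (p : ℤ) ∣ Δ) (ha : (p : ℤ) ∣ a) : ¬ (p : ℤ) ∣ c := by
  intro hpc
  have hP : (p : ℤ) ∣ bqf (N : ℤ) r M β h := by
    have := dvd_sub (ha.mul_right c) (hd.trans hiso)
    rwa [sub_sub_cancel] at this
  have hb := (dvd_bqfPolar hΔ hp hd hP).1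
  refine not_dvd_of_isCoprime (Int.isCoprime_iff_gcd_eq_one.mpr hc.2.2) hp hd ?_
  exact Int.dvd_coe_gcd (Int.dvd_coe_gcd ha (by convert hb using 1; ring)) hpc

/-- One of the forms `[N₁a, b, N₂c]` represents a number prime to `Δ`. -/
lemma exists_represented (hN : 0 < N) (hfd : IsFundamentalDiscriminant Δ)
    (hΔ : Δ = r ^ 2 - 4 * (N * M)) {a b c : ℤ}
    (hac : ∀ p : ℕ, p.Prime → (p : ℤ) ∣ Δ → (p : ℤ) ∣ a → ¬ (p : ℤ) ∣ c) :
    ∃ N₁ N₂ x y : ℤ, N₁ * N₂ = (N : ℤ) ∧ 0 < N₁ ∧ 0 < N₂ ∧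
      IsCoprime (bqf (N₁ * a) b (N₂ * c) x y) Δ := by
  set N₁ : ℤ := ((Int.gcd (Int.gcd N a : ℕ) Δ : ℕ) : ℤ) with hN₁
  have hd1 : N₁ ∣ (Int.gcd N a : ℕ) := Int.gcd_dvd_left ..
  have hd2 : N₁ ∣ Δ := Int.gcd_dvd_right ..
  have hd3 : N₁ ∣ N := hd1.trans (Int.gcd_dvd_left ..)
  have hd4 : N₁ ∣ a := hd1.trans (Int.gcd_dvd_right ..)
  obtain ⟨N₂, hN₂⟩ := hd3
  have hNpos : (0 : ℤ) < N := by exact_mod_cast hN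
  have hpos : 0 < N₁ := by
    rcases (Int.natCast_nonneg (Int.gcd (Int.gcd N a : ℕ) Δ)).lt_or_eq with h | h
    · exact h
    · rw [← hN₁] at h; rw [hN₂, ← h, zero_mul] at hNpos; exact absurd hNpos (lt_irrefl _)
  have hpos2 : 0 < N₂ := by
    rw [hN₂] at hNpos; exact (mul_pos_iff_of_pos_left hpos).mp hNpos
  obtain ⟨x, y, hxy⟩ := exists_bqf_isCoprime (IsFundamentalDiscriminant.ne_zero hfd)
    (A := N₁ * a) (B := b) (C := N₂ * c) fun p hp hd hA _ hC => by
      have hpI := Nat.prime_iff_prime_int.mp hp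
      have ha : (p : ℤ) ∣ a := by
        rcases hpI.dvd_or_dvd hA with h | h
        · exact h.trans hd4
        · exact h
      rcases hpI.dvd_or_dvd hC with h | h
      · have h1 : (p : ℤ) ∣ N₁ := Int.dvd_coe_gcd
          (Int.dvd_coe_gcd (hN₂ ▸ h.mul_left N₁) ha) hd
        exact prime_sq_not_dvd hfd hΔ hp hd ((mul_dvd_mul h1 h).trans (hN₂ ▸ dvd_mul_right _ _))
      · exact hac p hp hd ha h
  exact ⟨N₁, N₂, x, y, hN₂.symm, hpos, hpos2, hxy⟩

/-- An isotropic vector which is not divisible by primes dividing `Δ` has an Eichler transform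
whose first coordinate is prime to `Δ`. -/
lemma exists_eichler_isCoprime (hfd : IsFundamentalDiscriminant Δ)
    (hΔ : Δ = r ^ 2 - 4 * (N * M)) {a c β h : ℤ}
    (hiso : Δ ∣ a * c - bqf (N : ℤ) r M β h)
    (hac : ∀ p : ℕ, p.Prime → (p : ℤ) ∣ Δ → (p : ℤ) ∣ a → ¬ (p : ℤ) ∣ c) :
    ∃ u v : ℤ, IsCoprime (eichler (N : ℤ) r M a c β h u v) Δ := by
  have h0 := IsFundamentalDiscriminant.ne_zero hfd
  obtain ⟨x, y, hxy⟩ := exists_norm_isCoprime hfd hΔ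
  obtain ⟨s, hs⟩ := exists_prime_dvd_iff h0 fun p => ¬ (p : ℤ) ∣ a
  refine ⟨s * x, s * y, isCoprime_of_forall_prime fun p hp hd hn => ?_⟩
  have hpI := Nat.prime_iff_prime_int.mp hp
  have he : eichler (N : ℤ) r M a c β h (s * x) (s * y) =
      a + s * bqfPolar (N : ℤ) r M β h x y + s ^ 2 * c * bqf (N : ℤ) r M x y := by
    simp only [eichler, bqfPolar, bqf]; ring
  rw [he] at hn
  specialize hs p hp hd
  by_cases ha : (p : ℤ) ∣ a
  · have hP : (p : ℤ) ∣ bqf (N : ℤ) r M β h := by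
      have := dvd_sub (ha.mul_right c) (hd.trans hiso)
      rwa [sub_sub_cancel] at this
    obtain ⟨h1, h2⟩ := dvd_bqfPolar hΔ hp hd hP
    have h3 : (p : ℤ) ∣ bqfPolar (N : ℤ) r M β h x y := (h1.mul_right _).add (h2.mul_right _)
    rw [Int.dvd_add_right (ha.add (h3.mul_left s))] at hn
    rcases hpI.dvd_or_dvd hn with hn | hn
    · rcases hpI.dvd_or_dvd hn with hn | hn
      · exact hs.mp (hpI.dvd_of_dvd_pow hn) ha
      · exact hac p hp hd ha hn
    · exact not_dvd_of_isCoprime hxy hp hd hn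
  · have h1 := hs.mpr ha
    refine ha ?_
    have h2 := dvd_sub hn (h1.mul_right (bqfPolar (N : ℤ) r M β h x y +
      s * c * bqf (N : ℤ) r M x y))
    rwa [show a + s * bqfPolar (N : ℤ) r M β h x y + s ^ 2 * c * bqf (N : ℤ) r M x y -
      s * (bqfPolar (N : ℤ) r M β h x y + s * c * bqf (N : ℤ) r M x y) = a by ring] at h2

/-- The value of the genus character on an isotropic vector. -/
lemma isoChar_eq (hχ : IsGenusChar N Δ χ) (hN : 0 < N) (hfd : IsFundamentalDiscriminant Δ)
    (hΔ : Δ = r ^ 2 - 4 * (N * M)) {a c β h u v : ℤ}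
    (hiso : Δ ∣ a * c - bqf (N : ℤ) r M β h)
    (hu : IsCoprime (eichler (N : ℤ) r M a c β h u v) Δ) :
    isoChar N Δ r M χ a c β h = χ (eichler (N : ℤ) r M a c β h u v) 0 0 := by
  have h0 := IsFundamentalDiscriminant.ne_zero hfd
  have hac : ∀ p : ℕ, p.Prime → (p : ℤ) ∣ Δ → (p : ℤ) ∣ a → ¬ (p : ℤ) ∣ c := by
    intro p hp hd ha hc
    have hP : (p : ℤ) ∣ bqf (N : ℤ) r M β h := by
      have := dvd_sub (ha.mul_right c) (hd.trans hiso)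
      rwa [sub_sub_cancel] at this
    obtain ⟨h1, h2⟩ := dvd_bqfPolar hΔ hp hd hP
    exact not_dvd_of_isCoprime hu hp hd
      ((ha.add ((h1.mul_right _).add (h2.mul_right _))).add (hc.mul_right _))
  obtain ⟨N₁, N₂, x, y, hN12, h1, h2, hn⟩ := exists_represented hN hfd hΔ
    (b := r * h + 2 * N * β) hac
  rw [isoChar, if_pos hiso, hχ.2.2 _ _ _ _ (genusCharCond_of_isotropic h0 hΔ hiso hac)
    (Int.isCoprime_iff_gcd_eq_one.mp hn) ⟨N₁, N₂, x, y, hN12, h1, h2, rfl⟩,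
    ← chi_scalar_eq_kronecker hχ hN hn]
  set n := bqf (N₁ * a) (r * h + 2 * N * β) (N₂ * c) x y with hndef
  set a' := eichler (N : ℤ) r M a c β h u v with hadef
  set X := a * x + N₂ * β * y + x * (N * β * u + r * h * u + M * h * v) + N₂ * c * u * y with hX
  set Y := h * y + N₁ * x * (β * v - h * u) + c * v * y with hY
  have hid : N₁ * X ^ 2 + r * X * Y + N₂ * M * Y ^ 2 ≡ a' * n [ZMOD Δ] := by
    refine Int.modEq_iff_dvd.mpr ?_
    have : a' * n - (N₁ * X ^ 2 + r * X * Y + N₂ * M * Y ^ 2) =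
        (a * c - bqf (N : ℤ) r M β h) *
          (N₂ * y ^ 2 - x * y * (2 * N * u + r * v) + N₁ * x ^ 2 * bqf (N : ℤ) r M u v) := by
      rw [hndef, hadef, hX, hY]
      simp only [eichler, bqfPolar, bqf, ← hN12]
      ring
    rw [this]
    exact hiso.mul_right _
  have hone : χ (a' * n) 0 0 = 1 := by
    rw [← chi_scalar_modEq hχ hid]
    exact chi_scalar_norm hχ hN (by rw [hΔ]; ring) h0 hN12 h1 h2
      (isCoprime_of_modEq hid (hu.mul_left hn))
  rw [chi_scalar_mul hχ hN h0] at hone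
  have hsq := chi_scalar_mul_self hχ hN h0 hu
  calc χ n 0 0 = (χ a' 0 0 * χ a' 0 0) * χ n 0 0 := by rw [hsq, one_mul]
    _ = χ a' 0 0 * (χ a' 0 0 * χ n 0 0) := by ring
    _ = χ a' 0 0 := by rw [hone, mul_one]

lemma exists_of_isoChar_ne_zero (hχ : IsGenusChar N Δ χ) (hfd : IsFundamentalDiscriminant Δ)
    (hΔ : Δ = r ^ 2 - 4 * (N * M)) {a c β h : ℤ} (hne : isoChar N Δ r M χ a c β h ≠ 0) :
    Δ ∣ a * c - bqf (N : ℤ) r M β h ∧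
      ∃ u v : ℤ, IsCoprime (eichler (N : ℤ) r M a c β h u v) Δ := by
  have hiso : Δ ∣ a * c - bqf (N : ℤ) r M β h := by
    by_contra hc
    exact hne (if_neg hc)
  have hg : GenusCharCond N Δ a (r * h + 2 * N * β) c := by
    by_contra hc
    exact hne (by rw [isoChar, if_pos hiso, hχ.2.1 _ _ _ hc])
  exact ⟨hiso, exists_eichler_isCoprime hfd hΔ hiso fun p hp hd =>
    not_dvd_of_genusCharCond hΔ hiso hg hp hd⟩

/-- Comparison of the genus character on two vectors with proportional Eichler transforms. -/
lemma isoChar_transfer (hχ : IsGenusChar N Δ χ) (hN : 0 < N) (hfd : IsFundamentalDiscriminant Δ)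
    (hΔ : Δ = r ^ 2 - 4 * (N * M)) {a c β h a' c' β' h' t : ℤ} (ht : IsCoprime t Δ)
    (hiso : Δ ∣ a * c - bqf (N : ℤ) r M β h ↔ Δ ∣ a' * c' - bqf (N : ℤ) r M β' h')
    (h1 : ∀ u v, ∃ u' v', eichler (N : ℤ) r M a' c' β' h' u' v' ≡
      t * eichler (N : ℤ) r M a c β h u v [ZMOD Δ])
    (h2 : ∀ u v, ∃ u' v', eichler (N : ℤ) r M a' c' β' h' u v ≡
      t * eichler (N : ℤ) r M a c β h u' v' [ZMOD Δ]) :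
    isoChar N Δ r M χ a' c' β' h' = χ t 0 0 * isoChar N Δ r M χ a c β h := by
  have h0 := IsFundamentalDiscriminant.ne_zero hfd
  have key : ∀ u v u' v', Δ ∣ a * c - bqf (N : ℤ) r M β h →
      eichler (N : ℤ) r M a' c' β' h' u' v' ≡ t * eichler (N : ℤ) r M a c β h u v [ZMOD Δ] →
      IsCoprime (eichler (N : ℤ) r M a c β h u v) Δ →
      isoChar N Δ r M χ a' c' β' h' = χ t 0 0 * isoChar N Δ r M χ a c β h := by
    intro u v u' v' hi he hu
    rw [isoChar_eq hχ hN hfd hΔ hi hu,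
      isoChar_eq hχ hN hfd hΔ (hiso.mp hi) (isCoprime_of_modEq he (ht.mul_left hu)),
      chi_scalar_modEq hχ he, chi_scalar_mul hχ hN h0]
  by_cases hz : isoChar N Δ r M χ a c β h = 0
  · by_cases hz' : isoChar N Δ r M χ a' c' β' h' = 0
    · rw [hz, hz', mul_zero]
    · obtain ⟨hi, u, v, hu⟩ := exists_of_isoChar_ne_zero hχ hfd hΔ hz'
      obtain ⟨u', v', he⟩ := h2 u v
      exact key u' v' u v (hiso.mpr hi) he
        (isCoprime_of_modEq he.symm hu).of_mul_left_right
  · obtain ⟨hi, u, v, hu⟩ := exists_of_isoChar_ne_zero hχ hfd hΔ hz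
    obtain ⟨u', v', he⟩ := h1 u v
    exact key u v u' v' hi he hu

lemma isoChar_congr (hχ : IsGenusChar N Δ χ) (hN : 0 < N) (hfd : IsFundamentalDiscriminant Δ)
    (hΔ : Δ = r ^ 2 - 4 * (N * M)) {a c β h a' c' β' h' : ℤ} (ha : a' ≡ a [ZMOD Δ])
    (hc : c' ≡ c [ZMOD Δ]) (hP : bqf (N : ℤ) r M β' h' ≡ bqf (N : ℤ) r M β h [ZMOD Δ])
    (h1 : 2 * N * β' + r * h' ≡ 2 * N * β + r * h [ZMOD Δ])
    (h2 : r * β' + 2 * M * h' ≡ r * β + 2 * M * h [ZMOD Δ]) :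
    isoChar N Δ r M χ a' c' β' h' = isoChar N Δ r M χ a c β h := by
  have he : ∀ u v, eichler (N : ℤ) r M a' c' β' h' u v ≡
      1 * eichler (N : ℤ) r M a c β h u v [ZMOD Δ] := by
    intro u v
    rw [one_mul]
    exact ((ha.add ((h1.mul_right _).add (h2.mul_right _))).add (hc.mul_right _))
  rw [isoChar_transfer hχ hN hfd hΔ (a := a) (c := c) (β := β) (h := h) isCoprime_one_left ?_
    (fun u v => ⟨u, v, he u v⟩) (fun u v => ⟨u, v, he u v⟩), chi_scalar_one hχ hN, one_mul]
  have := (ha.mul hc).sub hP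
  rw [← Int.modEq_zero_iff_dvd, ← Int.modEq_zero_iff_dvd]
  exact ⟨fun h => this.trans h, fun h => this.symm.trans h⟩

lemma eichler_modEq {Δ : ℤ} (A B C a c β h : ℤ) {u v u' v' : ℤ} (hu : u ≡ u' [ZMOD Δ])
    (hv : v ≡ v' [ZMOD Δ]) :
    eichler A B C a c β h u v ≡ eichler A B C a c β h u' v' [ZMOD Δ] :=
  ((Int.ModEq.refl a).add ((hu.mul_left _).add (hv.mul_left _))).add
    ((((hu.pow 2).mul_left A).add ((hu.mul_left B).mul hv)).add ((hv.pow 2).mul_left C)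
      |>.mul_left c)

lemma isoChar_torus (hχ : IsGenusChar N Δ χ) (hN : 0 < N) (hfd : IsFundamentalDiscriminant Δ)
    (hΔ : Δ = r ^ 2 - 4 * (N * M)) {a c β h s t : ℤ} (hst : s * t ≡ 1 [ZMOD Δ]) :
    isoChar N Δ r M χ (t * a) (s * c) β h = χ t 0 0 * isoChar N Δ r M χ a c β h := by
  have ht : IsCoprime t Δ := (isCoprime_of_modEq hst isCoprime_one_left).of_mul_left_right
  have he : ∀ u v u' v', u ≡ t * u' [ZMOD Δ] → v ≡ t * v' [ZMOD Δ] →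
      eichler (N : ℤ) r M (t * a) (s * c) β h u v ≡
      t * eichler (N : ℤ) r M a c β h u' v' [ZMOD Δ] := by
    intro u v u' v' hu hv
    have h1 : eichler (N : ℤ) r M (t * a) (s * c) β h (t * u') (t * v') =
        t * a + t * bqfPolar (N : ℤ) r M β h u' v' +
          (s * t) * (t * c * bqf (N : ℤ) r M u' v') := by
      simp only [eichler, bqfPolar, bqf]; ring
    have h2 : t * eichler (N : ℤ) r M a c β h u' v' =
        t * a + t * bqfPolar (N : ℤ) r M β h u' v' + 1 * (t * c * bqf (N : ℤ) r M u' v') := by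
      simp only [eichler]; ring
    refine (eichler_modEq _ _ _ _ _ _ _ hu hv).trans ?_
    rw [h1, h2]
    exact (Int.ModEq.refl _).add (hst.mul_right _)
  refine isoChar_transfer hχ hN hfd hΔ ht ?_ (fun u v => ⟨t * u, t * v, he _ _ _ _ rfl rfl⟩)
    (fun u v => ⟨s * u, s * v, he _ _ _ _ ?_ ?_⟩)
  · have : t * a * (s * c) ≡ a * c [ZMOD Δ] := by
      have := hst.mul_right (a * c)
      rw [one_mul] at this
      convert this using 1
      ring
    have := this.sub (Int.ModEq.refl (bqf (N : ℤ) r M β h))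
    rw [← Int.modEq_zero_iff_dvd, ← Int.modEq_zero_iff_dvd]
    exact ⟨fun h => this.trans h, fun h => this.symm.trans h⟩
  · have := (hst.mul_right u).symm
    rwa [one_mul, mul_comm s t, mul_assoc] at this
  · have := (hst.mul_right v).symm
    rwa [one_mul, mul_comm s t, mul_assoc] at this

/-- Invariance under Eichler transformations. -/
lemma isoChar_eichler (hχ : IsGenusChar N Δ χ) (hN : 0 < N) (hfd : IsFundamentalDiscriminant Δ)
    (hΔ : Δ = r ^ 2 - 4 * (N * M)) (a c β h u v : ℤ) :
    isoChar N Δ r M χ (eichler (N : ℤ) r M a c β h u v) c (β + c * u) (h + c * v) =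
      isoChar N Δ r M χ a c β h := by
  have he : ∀ u' v', eichler (N : ℤ) r M (eichler (N : ℤ) r M a c β h u v) c (β + c * u)
      (h + c * v) u' v' = 1 * eichler (N : ℤ) r M a c β h (u + u') (v + v') := by
    intro u' v'
    simp only [eichler, bqfPolar, bqf]
    ring
  rw [isoChar_transfer hχ hN hfd hΔ (a := a) (c := c) (β := β) (h := h) isCoprime_one_left ?_
    (fun u' v' => ⟨u' - u, v' - v, by rw [he]; ring_nf; rfl⟩)
    (fun u' v' => ⟨u + u', v + v', by rw [he]⟩), chi_scalar_one hχ hN, one_mul]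
  have : eichler (N : ℤ) r M a c β h u v * c - bqf (N : ℤ) r M (β + c * u) (h + c * v) =
      a * c - bqf (N : ℤ) r M β h := by
    simp only [eichler, bqfPolar, bqf]; ring
  rw [this]

lemma isoChar_swap (hχ : IsGenusChar N Δ χ) (hN : 0 < N) (hfd : IsFundamentalDiscriminant Δ)
    (hΔ : Δ = r ^ 2 - 4 * (N * M)) (a c β h : ℤ) :
    isoChar N Δ r M χ c a β h = isoChar N Δ r M χ a c β h := by
  have h0 := IsFundamentalDiscriminant.ne_zero hfd
  rw [isoChar, isoChar, mul_comm c a]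
  split_ifs with hiso
  · by_cases hac : ∀ p : ℕ, p.Prime → (p : ℤ) ∣ Δ → (p : ℤ) ∣ a → ¬ (p : ℤ) ∣ c
    · obtain ⟨N₁, N₂, x, y, hN12, h1, h2, hn⟩ := exists_represented hN hfd hΔ
        (b := r * h + 2 * N * β) hac
      have hn' := Int.isCoprime_iff_gcd_eq_one.mp hn
      rw [hχ.2.2 a _ c _ (genusCharCond_of_isotropic h0 hΔ hiso hac) hn'
          ⟨N₁, N₂, x, y, hN12, h1, h2, rfl⟩,
        hχ.2.2 c _ a _ (genusCharCond_of_isotropic h0 hΔ (by rwa [mul_comm c a])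
          fun p hp hd hc ha => hac p hp hd ha hc) hn'
          ⟨N₂, N₁, y, x, by rw [mul_comm, hN12], h2, h1, by rw [bqf]; ring⟩]
    · have hg : ¬ GenusCharCond N Δ a (r * h + 2 * N * β) c := fun hg =>
        hac fun p hp hd => not_dvd_of_genusCharCond hΔ hiso hg hp hd
      have hg' : ¬ GenusCharCond N Δ c (r * h + 2 * N * β) a := fun hg =>
        hac fun p hp hd ha hc => not_dvd_of_genusCharCond hΔ (by rwa [mul_comm c a]) hg hp hd hc ha
      rw [hχ.2.1 _ _ _ hg, hχ.2.1 _ _ _ hg']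
  · rfl

end Weight

lemma exists_forall_prime_modEq {Δ : ℤ} (h0 : Δ ≠ 0) (g : ℕ → ℕ) :
    ∃ s : ℤ, ∀ p : ℕ, p.Prime → (p : ℤ) ∣ Δ → s ≡ g p [ZMOD p] := by
  obtain ⟨s, hs⟩ := Nat.chineseRemainderOfFinset g id Δ.natAbs.primeFactors
    (fun p hp => (Nat.prime_of_mem_primeFactors hp).ne_zero)
    (fun p hp q hq hpq => (Nat.coprime_primes (Nat.prime_of_mem_primeFactors hp)
      (Nat.prime_of_mem_primeFactors hq)).mpr hpq)
  refine ⟨s, fun p hp hd => Int.natCast_modEq_iff.mpr (hs p ?_)⟩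
  exact Nat.mem_primeFactors.mpr ⟨hp, Int.natCast_dvd.mp hd, Int.natAbs_ne_zero.mpr h0⟩

/-- In a prime field of odd characteristic some translate of a square by a given nonzero element
is not a square. -/
lemma exists_not_isSquare_sq_add {p : ℕ} [Fact p.Prime] (hp2 : p ≠ 2) {k : ZMod p} (hk : k ≠ 0) :
    ∃ x : ZMod p, ¬ IsSquare (x ^ 2 + k) := by
  by_contra! hc
  obtain ⟨g, hg⟩ := FiniteField.exists_nonsquare (F := ZMod p) (by rwa [ZMod.ringChar_zmod_n])
  have hsq : ∀ n : ℕ, IsSquare ((n : ZMod p) * k) := by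
    intro n
    induction n with
    | zero => simp
    | succ n ih =>
      obtain ⟨x, hx⟩ := ih
      have := hc x
      rwa [pow_two, ← hx, show (n : ZMod p) * k + k = ((n + 1 : ℕ) : ZMod p) * k by
        push_cast; ring] at this
  have := hsq (g / k).val
  rw [ZMod.natCast_val, ZMod.cast_id, div_mul_cancel₀ _ hk] at this
  exact hg this

section Weight

variable {N : ℕ} {Δ r M : ℤ} {χ : ℤ → ℤ → ℤ → ℤ}

/-- The quadratic character attached to a fundamental discriminant is primitive. -/
lemma exists_chi_scalar_eq_neg_one (hχ : IsGenusChar N Δ χ) (hN : 0 < N)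
    (hfd : IsFundamentalDiscriminant Δ) {p : ℕ} (hp : p.Prime) {Δ' : ℤ} (hΔ' : Δ = p * Δ') :
    ∃ t : ℤ, t ≡ 1 [ZMOD Δ'] ∧ IsCoprime t Δ ∧ χ t 0 0 = -1 := by
  have : Fact p.Prime := ⟨hp⟩
  by_cases hp2 : p = 2
  · subst hp2
    refine ⟨1 + Δ / 2, ?_, chi_scalar_two hχ hN hfd ⟨Δ', by simpa using hΔ'⟩ rfl⟩
    have : Δ / 2 = Δ' := by push_cast at hΔ'; omega
    rw [this]
    exact Int.modEq_iff_dvd.mpr ⟨-1, by ring⟩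
  · obtain ⟨g, hg⟩ := FiniteField.exists_nonsquare (F := ZMod p) (by rwa [ZMod.ringChar_zmod_n])
    have hpΔ' : ¬ (p : ℤ) ∣ Δ' := fun h => odd_prime_sq_not_dvd hfd hp hp2
      (by rw [hΔ']; exact mul_dvd_mul_left _ h)
    obtain ⟨x, y, hxy⟩ := ((Nat.prime_iff_prime_int.mp hp).coprime_iff_not_dvd).mpr hpΔ'
    have ht : 1 + y * Δ' * (g.val - 1) ≡ 1 [ZMOD Δ'] :=
      Int.modEq_iff_dvd.mpr ⟨-(y * (g.val - 1)), by ring⟩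
    refine ⟨_, ht, chi_scalar_odd_prime hχ hN hfd hp hp2 hΔ' ht ?_⟩
    have h1 : (y : ZMod p) * (Δ' : ZMod p) = 1 := by
      have := congrArg (Int.cast : ℤ → ZMod p) hxy
      simpa using this
    push_cast
    rw [h1, ZMod.natCast_val, ZMod.cast_id]
    simpa using hg

lemma exists_eichler_isCoprime_or (hχ : IsGenusChar N Δ χ) (hN : 0 < N)
    (hfd : IsFundamentalDiscriminant Δ) (hΔ : Δ = r ^ 2 - 4 * (N * M)) (a c β h : ℤ) :
    (∃ u v : ℤ, IsCoprime (eichler (N : ℤ) r M a c β h u v) Δ) ∨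
      ∃ s t : ℤ, s * t ≡ 1 [ZMOD Δ] ∧ t * a ≡ a [ZMOD Δ] ∧ s * c ≡ c [ZMOD Δ] ∧
        χ t 0 0 = -1 := by
  have h0 := IsFundamentalDiscriminant.ne_zero hfd
  by_cases hac : ∀ p : ℕ, p.Prime → (p : ℤ) ∣ Δ → (p : ℤ) ∣ a → ¬ (p : ℤ) ∣ c
  · left
    obtain ⟨x, y, hxy⟩ := exists_norm_isCoprime hfd hΔ
    set B := bqfPolar (N : ℤ) r M β h x y with hB
    set P := bqf (N : ℤ) r M x y with hP
    obtain ⟨s, hs⟩ := exists_forall_prime_modEq h0 fun p =>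
      if ¬ (p : ℤ) ∣ a then 0 else if (p : ℤ) ∣ B + c * P then 2 else 1
    refine ⟨s * x, s * y, isCoprime_of_forall_prime fun p hp hd hn => ?_⟩
    have hpI := Nat.prime_iff_prime_int.mp hp
    have he : eichler (N : ℤ) r M a c β h (s * x) (s * y) = a + s * (B + s * (c * P)) := by
      simp only [hB, hP, eichler, bqfPolar, bqf]; ring
    rw [he] at hn
    specialize hs p hp hd
    have hP0 : ¬ (p : ℤ) ∣ P := not_dvd_of_isCoprime hxy hp hd
    by_cases ha : (p : ℤ) ∣ a
    · have hcP : ¬ (p : ℤ) ∣ c * P := fun h =>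
        (hpI.dvd_or_dvd h).elim (hac p hp hd ha) hP0
      rw [Int.dvd_add_right ha] at hn
      by_cases h1 : (p : ℤ) ∣ B + c * P
      · rw [if_neg (not_not.mpr ha), if_pos h1] at hs
        have hp2 : ¬ (p : ℤ) ∣ 2 := by
          intro h2
          have : p = 2 := (Nat.prime_dvd_prime_iff_eq hp Nat.prime_two).mp (by exact_mod_cast h2)
          subst this
          have hr : (2 : ℤ) ∣ r := by
            refine Int.prime_two.dvd_of_dvd_pow (n := 2) ?_
            rw [show r ^ 2 = Δ + 2 * (2 * (N * M)) by rw [hΔ]; ring]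
            exact Dvd.dvd.add (by simpa using hd) (dvd_mul_right _ _)
          have hB2 : (2 : ℤ) ∣ B := by
            obtain ⟨k, rfl⟩ := hr
            exact ⟨(N * β + k * h) * x + (k * β + M * h) * y, by rw [hB, bqfPolar]; ring⟩
          exact hcP ((Int.dvd_add_right (by simpa using hB2)).mp h1)
        have hs2 : (2 : ℤ) * (B + 2 * (c * P)) ≡ s * (B + s * (c * P)) [ZMOD p] :=
          (hs.symm.mul ((Int.ModEq.refl B).add (hs.symm.mul_right _)))
        have h3 : (p : ℤ) ∣ 2 * (B + 2 * (c * P)) :=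
          Int.modEq_zero_iff_dvd.mp (hs2.trans (Int.modEq_zero_iff_dvd.mpr hn))
        rcases hpI.dvd_or_dvd h3 with h3 | h3
        · exact hp2 h3
        · rw [show B + 2 * (c * P) = B + c * P + c * P by ring] at h3
          exact hcP ((Int.dvd_add_right h1).mp h3)
      · rw [if_neg (not_not.mpr ha), if_neg h1] at hs
        have hs2 : (1 : ℤ) * (B + 1 * (c * P)) ≡ s * (B + s * (c * P)) [ZMOD p] :=
          (hs.symm.mul ((Int.ModEq.refl B).add (hs.symm.mul_right _)))
        rw [one_mul, one_mul] at hs2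
        exact h1 (Int.modEq_zero_iff_dvd.mp (hs2.trans (Int.modEq_zero_iff_dvd.mpr hn)))
    · rw [if_pos ha] at hs
      have h1 : (p : ℤ) ∣ s := Int.modEq_zero_iff_dvd.mp hs
      exact ha ((Int.dvd_add_left (h1.mul_right _)).mp hn)
  · right
    push Not at hac
    obtain ⟨p, hp, ⟨Δ', hΔ'⟩, ⟨a', rfl⟩, ⟨c', rfl⟩⟩ := hac
    obtain ⟨t, ht1, htc, htχ⟩ := exists_chi_scalar_eq_neg_one hχ hN hfd hp hΔ'
    obtain ⟨s, q, hsq⟩ := htc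
    have hst : s * t ≡ 1 [ZMOD Δ] := Int.modEq_iff_dvd.mpr ⟨q, by rw [← hsq]; ring⟩
    have hs1 : s ≡ 1 [ZMOD Δ'] := by
      have h1 : s * t ≡ s * 1 [ZMOD Δ'] := ht1.mul_left s
      rw [mul_one] at h1
      exact h1.symm.trans (hst.of_dvd (hΔ' ▸ dvd_mul_left _ _))
    have hmul : ∀ x y : ℤ, x ≡ 1 [ZMOD Δ'] → x * (p * y) ≡ p * y [ZMOD Δ] := by
      intro x y hx
      obtain ⟨k, hk⟩ := hx.dvd
      exact Int.modEq_iff_dvd.mpr ⟨k * y, by rw [hΔ']; linear_combination (p * y) * hk⟩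
    exact ⟨s, t, hst, hmul _ _ ht1, hmul _ _ hs1, htχ⟩

/-- If `Δ` is even, the norm form represents numbers of any small two-adic valuation. -/
lemma exists_norm_two_pow (hfd : IsFundamentalDiscriminant Δ)
    (hΔ : Δ = r ^ 2 - 4 * (N * M)) (h2 : (2 : ℤ) ∣ Δ) {i : ℕ} (hi : i ≤ 2) :
    ∃ x y k : ℤ, bqf (N : ℤ) r M x y = 2 ^ i * (2 * k + 1) := by
  obtain ⟨x, y, hxy⟩ := exists_norm_isCoprime hfd hΔ
  have hodd : ¬ (2 : ℤ) ∣ bqf (N : ℤ) r M x y := by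
    exact_mod_cast not_dvd_of_isCoprime hxy Nat.prime_two (by exact_mod_cast h2)
  obtain ⟨k, hk⟩ : ∃ k, bqf (N : ℤ) r M x y = 2 * k + 1 :=
    ⟨bqf (N : ℤ) r M x y / 2, by omega⟩
  interval_cases i
  · exact ⟨x, y, k, by rw [hk]; ring⟩
  · obtain ⟨m, hm, -, hm4⟩ := two_dvd_four_dvd hfd h2
    obtain ⟨ρ, rfl⟩ : (2 : ℤ) ∣ r := by
      refine Int.prime_two.dvd_of_dvd_pow (n := 2) ?_
      rw [show r ^ 2 = Δ + 2 * (2 * (N * M)) by rw [hΔ]; ring]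
      exact h2.add (dvd_mul_right _ _)
    have hmρ : m = ρ ^ 2 - N * M := by linarith
    have h3 : (N : ℤ) % 4 = 2 ∨ M % 4 = 2 ∨ (N + 2 * ρ + M) % 4 = 2 := by
      generalize (N : ℤ) = n at *
      have hmod : m % 4 = ((ρ % 4) ^ 2 - (n % 4) * (M % 4)) % 4 := by
        rw [hmρ]; simp [Int.sub_emod, Int.mul_emod, pow_two]
      have hn := Int.emod_nonneg n (b := 4) (by norm_num)
      have hn' := Int.emod_lt_of_pos n (b := 4) (by norm_num)
      have hM := Int.emod_nonneg M (b := 4) (by norm_num)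
      have hM' := Int.emod_lt_of_pos M (b := 4) (by norm_num)
      have hρ := Int.emod_nonneg ρ (b := 4) (by norm_num)
      have hρ' := Int.emod_lt_of_pos ρ (b := 4) (by norm_num)
      rw [show (n + 2 * ρ + M) % 4 = (n % 4 + 2 * (ρ % 4) + M % 4) % 4 by omega]
      generalize n % 4 = n' at *
      generalize M % 4 = M' at *
      generalize ρ % 4 = ρ' at *
      interval_cases n' <;> interval_cases M' <;> interval_cases ρ' <;> omega
    rcases h3 with h3 | h3 | h3
    · exact ⟨1, 0, (N : ℤ) / 4, by rw [bqf]; omega⟩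
    · exact ⟨0, 1, M / 4, by rw [bqf]; omega⟩
    · exact ⟨1, 1, (N + 2 * ρ + M) / 4, by rw [bqf]; omega⟩
  · refine ⟨2 * x, 2 * y, k, ?_⟩
    rw [show bqf (N : ℤ) r M (2 * x) (2 * y) = 4 * bqf (N : ℤ) r M x y by
      simp only [bqf]; ring, hk]
    ring

lemma exists_eichler_chi_eq_neg_one (hχ : IsGenusChar N Δ χ) (hN : 0 < N)
    (hfd : IsFundamentalDiscriminant Δ) (hΔ : Δ = r ^ 2 - 4 * (N * M)) {m : ℤ}
    (hm : ¬ Δ ∣ m) :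
    ∃ β h u v : ℤ, IsCoprime (eichler (N : ℤ) r M 1 (m + bqf (N : ℤ) r M β h) β h u v) Δ ∧
      χ (eichler (N : ℤ) r M 1 (m + bqf (N : ℤ) r M β h) β h u v) 0 0 = -1 := by
  have h0 := IsFundamentalDiscriminant.ne_zero hfd
  obtain ⟨l, hl⟩ : ((Int.gcd Δ m : ℕ) : ℤ) ∣ Δ := Int.gcd_dvd_left ..
  obtain ⟨m', hm'⟩ : ((Int.gcd Δ m : ℕ) : ℤ) ∣ m := Int.gcd_dvd_right ..
  set g : ℤ := ((Int.gcd Δ m : ℕ) : ℤ) with hg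
  have hl1 : l.natAbs ≠ 1 := by
    intro h
    refine hm ?_
    rcases Int.natAbs_eq l with h' | h' <;> rw [h] at h' <;> rw [hl, h', hm'] <;> simp
  obtain ⟨p, hp, hpl⟩ := Nat.exists_prime_and_dvd hl1
  have hpl' : (p : ℤ) ∣ l := Int.natCast_dvd.mpr hpl
  have hpI := Nat.prime_iff_prime_int.mp hp
  have : Fact p.Prime := ⟨hp⟩
  have hg0 : g ≠ 0 := by rintro h; rw [h, zero_mul] at hl; exact h0 hl
  obtain ⟨x, y, hxy⟩ := exists_norm_isCoprime hfd hΔ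
  have hpm' : ¬ (p : ℤ) ∣ m' := by
    intro h
    have h1 : g * p ∣ g := by
      conv_rhs => rw [hg]
      refine Int.dvd_coe_gcd ?_ ?_
      · rw [hl]; exact mul_dvd_mul_left _ hpl'
      · rw [hm']; exact mul_dvd_mul_left _ h
    obtain ⟨q, hq⟩ := h1
    have : (p : ℤ) * q = 1 := mul_left_cancel₀ hg0 (by rw [← mul_assoc, ← hq, mul_one])
    exact hpI.not_isUnit (IsUnit.of_mul_eq_one _ this)
  by_cases hp2 : p = 2
  · subst hp2
    obtain ⟨l, rfl⟩ := hpl'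
    push_cast at hl hpm'
    obtain ⟨i, l', hi, hll'⟩ : ∃ i : ℕ, ∃ l' : ℤ, i ≤ 2 ∧ l = 2 ^ i * (2 * l' + 1) := by
      obtain ⟨μ, hμ, -, hμ4⟩ := two_dvd_four_dvd hfd ⟨g * l, by rw [hl]; ring⟩
      have h8 : ¬ (8 : ℤ) ∣ l := by
        rintro ⟨j, rfl⟩
        have : μ = 4 * (g * j) := by
          have : 4 * μ = 4 * (4 * (g * j)) := by rw [← hμ, hl]; ring
          linarith
        omega
      by_cases h1 : l % 2 = 1
      · exact ⟨0, l / 2, by norm_num, by omega⟩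
      by_cases h2 : l % 4 = 2
      · exact ⟨1, l / 4, by norm_num, by omega⟩
      · exact ⟨2, l / 8, by norm_num, by omega⟩
    have h2Δ : (2 : ℤ) ∣ Δ := ⟨g * l, by rw [hl]; ring⟩
    obtain ⟨x, y, k, hk⟩ := exists_norm_two_pow hfd hΔ h2Δ hi
    refine ⟨0, 0, (2 * l' + 1) * x, (2 * l' + 1) * y, chi_scalar_two hχ hN hfd h2Δ ?_⟩
    obtain ⟨n, hn⟩ : ∃ n, m' = 2 * n + 1 := ⟨m' / 2, by omega⟩
    have he : eichler (N : ℤ) r M 1 (m + bqf (N : ℤ) r M 0 0) 0 0 ((2 * l' + 1) * x)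
        ((2 * l' + 1) * y) = 1 + m * (2 * l' + 1) ^ 2 * bqf (N : ℤ) r M x y := by
      simp only [eichler, bqfPolar, bqf]; ring
    rw [he, hk, show Δ / 2 = g * l by
      rw [hl]; exact Int.ediv_eq_of_eq_mul_left two_ne_zero (by ring), hm', hn, hl, hll']
    refine Int.modEq_iff_dvd.mpr ⟨-(n * (2 * l' + 1) * (2 * k + 1) + 2 * l' * k + l' + k), ?_⟩
    ring
  · have hpΔ : (p : ℤ) ∣ Δ := hl ▸ hpl'.mul_left g
    have hpm : ¬ (p : ℤ) ∣ m := by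
      intro h
      refine odd_prime_sq_not_dvd hfd hp hp2 ?_
      rw [hl]
      exact mul_dvd_mul (Int.dvd_coe_gcd hpΔ h) hpl'
    obtain ⟨Δ', hΔ'⟩ := hpΔ
    have hpΔ' : ¬ (p : ℤ) ∣ Δ' := fun h => odd_prime_sq_not_dvd hfd hp hp2
      (by rw [hΔ']; exact mul_dvd_mul_left _ h)
    obtain ⟨q, s, hqs⟩ := (hpI.coprime_iff_not_dvd).mpr hpΔ'
    have he1 : (s : ZMod p) * (Δ' : ZMod p) = 1 := by
      have := congrArg (Int.cast : ℤ → ZMod p) hqs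
      simpa using this
    have hP0 : ((bqf (N : ℤ) r M x y : ℤ) : ZMod p) ≠ 0 := by
      rw [Ne, ZMod.intCast_zmod_eq_zero_iff_dvd]
      exact not_dvd_of_isCoprime hxy hp (hΔ' ▸ dvd_mul_right _ _)
    have hm0 : ((m : ℤ) : ZMod p) ≠ 0 := by
      rwa [Ne, ZMod.intCast_zmod_eq_zero_iff_dvd]
    obtain ⟨X, hX⟩ := exists_not_isSquare_sq_add hp2 (mul_ne_zero hm0 hP0)
    set P : ℤ := bqf (N : ℤ) r M x y with hP
    obtain ⟨z, hz⟩ := ZMod.intCast_surjective ((X - 1) / (P : ZMod p))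
    have he : eichler (N : ℤ) r M 1 (m + bqf (N : ℤ) r M (z * x) (z * y)) (z * x) (z * y)
        (s * Δ' * x) (s * Δ' * y) = (1 + s * Δ' * (z * P)) ^ 2 + m * P * (s * Δ') ^ 2 := by
      rw [hP]; simp only [eichler, bqfPolar, bqf]; ring
    refine ⟨z * x, z * y, s * Δ' * x, s * Δ' * y, ?_⟩
    rw [he]
    refine chi_scalar_odd_prime hχ hN hfd hp hp2 hΔ' ?_ ?_
    · exact Int.modEq_iff_dvd.mpr ⟨-(2 * s * (z * P) + s ^ 2 * Δ' * (z * P) ^ 2 +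
        m * P * s ^ 2 * Δ'), by ring⟩
    · push_cast
      rw [he1, hz, div_mul_cancel₀ _ hP0]
      simpa using hX

end Weight

section Equivariant

variable {R : Type*} [CommRing R]

/-- Functions on `R⁴` which transform like the genus character under Eichler transformations, the
torus, and the exchange of the two hyperbolic coordinates. -/
structure IsEquivariant (A B C : R) (ψ : R → ℂ) (F : R → R → R → R → ℂ) : Prop where
  eichler : ∀ a c β h u v,
    F (TwistedTheta.eichler A B C a c β h u v) c (β + c * u) (h + c * v) = F a c β h
  swap : ∀ a c β h, F c a β h = F a c β h
  torus : ∀ a c β h s t, s * t = 1 → F (t * a) (s * c) β h = ψ t * F a c β h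

variable {A B C : R} {ψ : R → ℂ} {F G : R → R → R → R → ℂ}

lemma IsEquivariant.sub_smul (hF : IsEquivariant A B C ψ F) (hG : IsEquivariant A B C ψ G)
    (k : ℂ) : IsEquivariant A B C ψ fun a c β h => F a c β h - k * G a c β h where
  eichler a c β h u v := by rw [hF.eichler, hG.eichler]
  swap a c β h := by rw [hF.swap, hG.swap]
  torus a c β h s t hst := by rw [hF.torus _ _ _ _ _ _ hst, hG.torus _ _ _ _ _ _ hst]; ring

lemma IsEquivariant.eichler' (hF : IsEquivariant A B C ψ F) (a c β h u v : R) :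
    F a (TwistedTheta.eichler A B C c a β h u v) (β + a * u) (h + a * v) = F a c β h := by
  rw [hF.swap, hF.eichler, hF.swap]

lemma IsEquivariant.of_mul_eq_one (hF : IsEquivariant A B C ψ F) {a s : R} (hs : s * a = 1)
    (c β h : R) : F a c β h = ψ a * F 1 (a * c - bqf A B C β h) 0 0 := by
  rw [← hF.torus _ _ _ _ _ _ hs, ← hF.eichler' a c β h (-(s * β)) (-(s * h))]
  congr 1
  · rw [mul_one]
  · simp only [TwistedTheta.eichler, bqfPolar, bqf]
    linear_combination (s * (A * β ^ 2 + B * β * h + C * h ^ 2) - c) * hs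
  · linear_combination (-β) * hs
  · linear_combination (-h) * hs

/-- An equivariant function which vanishes at a standard hyperbolic vector is zero. -/
lemma IsEquivariant.eq_zero (hF : IsEquivariant A B C ψ F)
    (h1 : ∀ a c β h, (∃ u v s, s * TwistedTheta.eichler A B C a c β h u v = 1) ∨
      ∃ s t, s * t = 1 ∧ t * a = a ∧ s * c = c ∧ ψ t = -1)
    (h2 : ∀ m, m ≠ 0 → ∃ β h u v s,
      s * TwistedTheta.eichler A B C 1 (m + bqf A B C β h) β h u v = 1 ∧
      ψ (TwistedTheta.eichler A B C 1 (m + bqf A B C β h) β h u v) = -1)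
    (h0 : F 1 0 0 0 = 0) (a c β h : R) : F a c β h = 0 := by
  have hm : ∀ m, F 1 m 0 0 = 0 := by
    intro m
    by_cases hm : m = 0
    · rw [hm, h0]
    · obtain ⟨β, h, u, v, s, hs, hψ⟩ := h2 m hm
      have e1 := hF.eichler' 1 m 0 0 β h
      have e2 := hF.eichler 1 (m + bqf A B C β h) β h u v
      rw [hF.of_mul_eq_one hs, hψ] at e2
      have e3 : TwistedTheta.eichler A B C 1 (m + bqf A B C β h) β h u v *
          (m + bqf A B C β h) - bqf A B C (β + (m + bqf A B C β h) * u)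
            (h + (m + bqf A B C β h) * v) = m := by
        simp only [TwistedTheta.eichler, bqfPolar, bqf]; ring
      have e4 : TwistedTheta.eichler A B C m 1 0 0 β h = m + bqf A B C β h := by
        simp only [TwistedTheta.eichler, bqfPolar]; ring
      rw [e4, zero_add, zero_add, one_mul, one_mul] at e1
      rw [e3, e1] at e2
      linear_combination (-1 / 2 : ℂ) * e2
  rcases h1 a c β h with ⟨u, v, s, hs⟩ | ⟨s, t, hst, hta, hsc, hψ⟩
  · rw [← hF.eichler a c β h u v, hF.of_mul_eq_one hs, hm, mul_zero]
  · have := hF.torus a c β h s t hst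
    rw [hta, hsc, hψ] at this
    linear_combination (1 / 2 : ℂ) * this

variable [Fintype R]

/-- The Fourier transform of a function on `R⁴`. -/
def fourierFour (A B C : R) (η : AddChar R ℂ) (F : R → R → R → R → ℂ) (a' c' β' h' : R) : ℂ :=
  ∑ v : R × R × R × R, F v.1 v.2.1 v.2.2.1 v.2.2.2 *
    η (v.1 * c' + v.2.1 * a' - bqfPolar A B C v.2.2.1 v.2.2.2 β' h')

lemma IsEquivariant.fourierFour (hF : IsEquivariant A B C ψ F) (η : AddChar R ℂ) :
    IsEquivariant A B C ψ (fourierFour A B C η F) where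
  eichler a c β h u v := by
    refine (Fintype.sum_bijective (fun w : R × R × R × R =>
      (TwistedTheta.eichler A B C w.1 w.2.1 w.2.2.1 w.2.2.2 u v, w.2.1, w.2.2.1 + w.2.1 * u,
        w.2.2.2 + w.2.1 * v)) ?_ _ _ ?_).symm
    · refine Function.bijective_iff_has_inverse.mpr ⟨fun w =>
        (TwistedTheta.eichler A B C w.1 w.2.1 w.2.2.1 w.2.2.2 (-u) (-v), w.2.1,
          w.2.2.1 - w.2.1 * u, w.2.2.2 - w.2.1 * v), fun w => ?_, fun w => ?_⟩
      all_goals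
        obtain ⟨a, c, β, h⟩ := w
        simp only [TwistedTheta.eichler, bqfPolar, bqf, Prod.mk.injEq, true_and]
        refine ⟨?_, ?_, ?_⟩ <;> ring
    · rintro ⟨a', c', β', h'⟩
      simp only
      rw [hF.eichler]
      congr 2
      simp only [TwistedTheta.eichler, bqfPolar, bqf]
      ring
  swap a c β h := by
    refine (Fintype.sum_bijective (fun w : R × R × R × R =>
      (w.2.1, w.1, w.2.2.1, w.2.2.2)) ?_ _ _ ?_).symm
    · exact Function.bijective_iff_has_inverse.mpr ⟨fun w => (w.2.1, w.1, w.2.2.1, w.2.2.2),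
        fun w => rfl, fun w => rfl⟩
    · rintro ⟨a', c', β', h'⟩
      simp only
      rw [hF.swap]
      congr 2
      ring
  torus a c β h s t hst := by
    rw [TwistedTheta.fourierFour, TwistedTheta.fourierFour, Finset.mul_sum]
    refine (Fintype.sum_bijective (fun w : R × R × R × R =>
      (t * w.1, s * w.2.1, w.2.2.1, w.2.2.2)) ?_ _ _ ?_).symm
    · refine Function.bijective_iff_has_inverse.mpr ⟨fun w =>
        (s * w.1, t * w.2.1, w.2.2.1, w.2.2.2), fun w => ?_, fun w => ?_⟩
      all_goals
        obtain ⟨a, c, β, h⟩ := w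
        simp only [Prod.mk.injEq, and_true]
        constructor
        · linear_combination a * hst
        · linear_combination c * hst
    · rintro ⟨a', c', β', h'⟩
      simp only
      rw [hF.torus _ _ _ _ _ _ hst, mul_assoc]
      congr 3
      linear_combination (-(a' * c + c' * a)) * hst

end Equivariant

section Residues

variable {N : ℕ} {Δ r M : ℤ} {χ : ℤ → ℤ → ℤ → ℤ}

lemma intCast_eq_iff_modEq (Δ a b : ℤ) :
    (a : ZMod Δ.natAbs) = (b : ZMod Δ.natAbs) ↔ a ≡ b [ZMOD Δ] := by
  rw [ZMod.intCast_eq_intCast_iff_dvd_sub, Int.natAbs_dvd, Int.modEq_iff_dvd]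

lemma val_intCast_modEq (h0 : Δ ≠ 0) (a : ℤ) :
    (((a : ZMod Δ.natAbs).val : ℕ) : ℤ) ≡ a [ZMOD Δ] := by
  have : NeZero Δ.natAbs := ⟨Int.natAbs_ne_zero.mpr h0⟩
  rw [← intCast_eq_iff_modEq, Int.cast_natCast, ZMod.natCast_val, ZMod.cast_id]

/-- The isotropic genus character as a function of residue classes modulo `Δ`. -/
def isoCharMod (N : ℕ) (Δ r M : ℤ) (χ : ℤ → ℤ → ℤ → ℤ) (a c β h : ZMod Δ.natAbs) : ℂ :=
  isoChar N Δ r M χ a.val c.val β.val h.val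

lemma isoCharMod_intCast (hχ : IsGenusChar N Δ χ) (hN : 0 < N)
    (hfd : IsFundamentalDiscriminant Δ) (hΔ : Δ = r ^ 2 - 4 * (N * M)) (a c β h : ℤ) :
    isoCharMod N Δ r M χ a c β h = isoChar N Δ r M χ a c β h := by
  have h0 := IsFundamentalDiscriminant.ne_zero hfd
  have hv := val_intCast_modEq h0
  rw [isoCharMod, isoChar_congr hχ hN hfd hΔ (hv a) (hv c)
    ((((hv β).pow 2).mul_left _).add (((hv β).mul_left _).mul (hv h)) |>.add
      (((hv h).pow 2).mul_left _))
    (((hv β).mul_left _).add ((hv h).mul_left _)) (((hv β).mul_left _).add ((hv h).mul_left _))]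

lemma eichler_intCast {R : Type*} [CommRing R] (A B C a c β h u v : ℤ) :
    ((eichler A B C a c β h u v : ℤ) : R) = eichler (A : R) B C a c β h u v := by
  simp [eichler, bqfPolar, bqf]

/-- The character of `ℤ/Δ` attached to `χ`. -/
def scalarChar (Δ : ℤ) (χ : ℤ → ℤ → ℤ → ℤ) (t : ZMod Δ.natAbs) : ℂ := χ t.val 0 0

lemma scalarChar_intCast (hχ : IsGenusChar N Δ χ) (h0 : Δ ≠ 0) (t : ℤ) :
    scalarChar Δ χ t = χ t 0 0 := by
  rw [scalarChar, chi_scalar_modEq hχ (val_intCast_modEq h0 t)]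

lemma isEquivariant_isoCharMod (hχ : IsGenusChar N Δ χ) (hN : 0 < N)
    (hfd : IsFundamentalDiscriminant Δ) (hΔ : Δ = r ^ 2 - 4 * (N * M)) :
    IsEquivariant ((N : ℤ) : ZMod Δ.natAbs) r M (scalarChar Δ χ) (isoCharMod N Δ r M χ) where
  eichler a c β h u v := by
    obtain ⟨a, rfl⟩ := ZMod.intCast_surjective a
    obtain ⟨c, rfl⟩ := ZMod.intCast_surjective c
    obtain ⟨β, rfl⟩ := ZMod.intCast_surjective β
    obtain ⟨h, rfl⟩ := ZMod.intCast_surjective h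
    obtain ⟨u, rfl⟩ := ZMod.intCast_surjective u
    obtain ⟨v, rfl⟩ := ZMod.intCast_surjective v
    rw [← eichler_intCast]
    norm_cast
    rw [isoCharMod_intCast hχ hN hfd hΔ, isoCharMod_intCast hχ hN hfd hΔ,
      isoChar_eichler hχ hN hfd hΔ]
  swap a c β h := by
    rw [isoCharMod, isoChar_swap hχ hN hfd hΔ, isoCharMod]
  torus a c β h s t hst := by
    obtain ⟨a, rfl⟩ := ZMod.intCast_surjective a
    obtain ⟨c, rfl⟩ := ZMod.intCast_surjective c
    obtain ⟨β, rfl⟩ := ZMod.intCast_surjective β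
    obtain ⟨h, rfl⟩ := ZMod.intCast_surjective h
    obtain ⟨s, rfl⟩ := ZMod.intCast_surjective s
    obtain ⟨t, rfl⟩ := ZMod.intCast_surjective t
    have hst' : s * t ≡ 1 [ZMOD Δ] := by
      rw [← intCast_eq_iff_modEq]; push_cast; exact hst
    rw [← Int.cast_mul, ← Int.cast_mul, isoCharMod_intCast hχ hN hfd hΔ,
      isoCharMod_intCast hχ hN hfd hΔ, isoChar_torus hχ hN hfd hΔ hst',
      scalarChar_intCast hχ (IsFundamentalDiscriminant.ne_zero hfd), Int.cast_mul]

/-- The genus character is an eigenfunction of the finite Fourier transform. -/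
lemma exists_fourierFour_isoCharMod (hχ : IsGenusChar N Δ χ) (hN : 0 < N)
    (hfd : IsFundamentalDiscriminant Δ) (hΔ : Δ = r ^ 2 - 4 * (N * M)) [NeZero Δ.natAbs]
    (η : AddChar (ZMod Δ.natAbs) ℂ) :
    ∃ K : ℂ, ∀ a c β h, fourierFour ((N : ℤ) : ZMod Δ.natAbs) r M η (isoCharMod N Δ r M χ)
      a c β h = K * isoCharMod N Δ r M χ a c β h := by
  have h0 := IsFundamentalDiscriminant.ne_zero hfd
  have hf := isEquivariant_isoCharMod hχ hN hfd hΔ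
  set FT := fourierFour ((N : ℤ) : ZMod Δ.natAbs) r M η (isoCharMod N Δ r M χ) with hFT
  have hunit : ∀ n : ℤ, IsCoprime n Δ → ∃ s : ZMod Δ.natAbs, s * n = 1 := by
    rintro n ⟨s, q, hs⟩
    refine ⟨s, ?_⟩
    rw [← Int.cast_mul, ← Int.cast_one, intCast_eq_iff_modEq]
    exact Int.modEq_iff_dvd.mpr ⟨q, by rw [← hs]; ring⟩
  have hone : isoCharMod N Δ r M χ 1 0 0 0 = 1 := by
    have := isoCharMod_intCast hχ hN hfd hΔ 1 0 0 0
    push_cast at this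
    rw [this, isoChar, if_pos (by simp [bqf])]
    simp [chi_scalar_one hχ hN]
  refine ⟨FT 1 0 0 0, fun a c β h => ?_⟩
  rw [← sub_eq_zero]
  refine ((hf.fourierFour η).sub_smul hf (FT 1 0 0 0)).eq_zero ?_ ?_ ?_ a c β h
  · intro a c β h
    obtain ⟨a, rfl⟩ := ZMod.intCast_surjective a
    obtain ⟨c, rfl⟩ := ZMod.intCast_surjective c
    obtain ⟨β, rfl⟩ := ZMod.intCast_surjective β
    obtain ⟨h, rfl⟩ := ZMod.intCast_surjective h
    rcases exists_eichler_isCoprime_or hχ hN hfd hΔ a c β h with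
      ⟨u, v, hu⟩ | ⟨s, t, hst, hta, hsc, hψ⟩
    · obtain ⟨s, hs⟩ := hunit _ hu
      exact Or.inl ⟨u, v, s, by rw [← eichler_intCast, hs]⟩
    · refine Or.inr ⟨s, t, ?_, ?_, ?_, ?_⟩
      · rw [← Int.cast_mul, ← Int.cast_one, intCast_eq_iff_modEq]; exact hst
      · rw [← Int.cast_mul, intCast_eq_iff_modEq]; exact hta
      · rw [← Int.cast_mul, intCast_eq_iff_modEq]; exact hsc
      · rw [scalarChar_intCast hχ h0, hψ]; simp
  · intro m hm
    obtain ⟨m, rfl⟩ := ZMod.intCast_surjective m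
    have hm' : ¬ Δ ∣ m := by
      rwa [← Int.modEq_zero_iff_dvd, ← intCast_eq_iff_modEq, Int.cast_zero]
    obtain ⟨β, h, u, v, hu, hψ⟩ := exists_eichler_chi_eq_neg_one hχ hN hfd hΔ hm'
    obtain ⟨s, hs⟩ := hunit _ hu
    have he : eichler ((N : ℤ) : ZMod Δ.natAbs) r M 1 (m + bqf ((N : ℤ) : ZMod Δ.natAbs) r M β h)
        β h u v = ((eichler (N : ℤ) r M 1 (m + bqf (N : ℤ) r M β h) β h u v : ℤ) :
          ZMod Δ.natAbs) := by
      rw [eichler_intCast]; simp [bqf]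
    refine ⟨β, h, u, v, s, ?_, ?_⟩
    · rw [he, hs]
    · rw [he, scalarChar_intCast hχ h0, hψ]; simp
  · rw [hone, mul_one, sub_self]

end Residues

lemma e_add (x y : ℂ) : e (x + y) = e x * e y := by
  rw [e, e, e, ← Complex.exp_add, mul_add]

lemma e_zero : e 0 = 1 := by simp [e]

lemma e_ne_zero (x : ℂ) : e x ≠ 0 := Complex.exp_ne_zero _

/-- The root of unity `e(n/L)`. -/
def eDiv (L : ℕ) (n : ℤ) : ℂ := e ((n : ℂ) / L)

lemma eDiv_add (L : ℕ) (m n : ℤ) : eDiv L (m + n) = eDiv L m * eDiv L n := by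
  rw [eDiv, eDiv, eDiv, ← e_add]; push_cast; rw [add_div]

lemma eDiv_zero (L : ℕ) : eDiv L 0 = 1 := by simp [eDiv, e_zero]

lemma eDiv_eq_stdAddChar (L : ℕ) [NeZero L] (n : ℤ) :
    eDiv L n = ZMod.stdAddChar (n : ZMod L) := by
  rw [ZMod.stdAddChar_coe, eDiv, e]; ring_nf

lemma eDiv_congr {L : ℕ} [NeZero L] {m n : ℤ} (h : m ≡ n [ZMOD L]) : eDiv L m = eDiv L n := by
  rw [eDiv_eq_stdAddChar, eDiv_eq_stdAddChar, (ZMod.intCast_eq_intCast_iff _ _ _).mpr h]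

lemma eDiv_eq_one_iff {L : ℕ} [NeZero L] {n : ℤ} : eDiv L n = 1 ↔ (L : ℤ) ∣ n := by
  rw [eDiv_eq_stdAddChar, ← AddChar.map_zero_eq_one (ZMod.stdAddChar (N := L)),
    ZMod.injective_stdAddChar.eq_iff, ZMod.intCast_zmod_eq_zero_iff_dvd]

lemma eDiv_mul_mul {k : ℕ} (hk : k ≠ 0) (L : ℕ) (n : ℤ) : eDiv (k * L) (k * n) = eDiv L n := by
  have : (k : ℂ) ≠ 0 := by exact_mod_cast hk
  rw [eDiv, eDiv]; push_cast; rw [mul_div_mul_left _ _ this]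

section Periodic

lemma sum_range_natCast {m : ℕ} [NeZero m] (φ : ZMod m → ℂ) :
    ∑ k ∈ Finset.range m, φ (k : ZMod m) = ∑ x, φ x :=
  Finset.sum_nbij' (fun k => (k : ZMod m)) ZMod.val (fun _ _ => Finset.mem_univ _)
    (fun x _ => Finset.mem_range.mpr x.val_lt)
    (fun k hk => ZMod.val_cast_of_lt (Finset.mem_range.mp hk))
    (fun x _ => by rw [ZMod.natCast_val, ZMod.cast_id]) (fun _ _ => rfl)

lemma periodic_eq_val {α : Type*} {m : ℕ} [NeZero m] {f : ℤ → α}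
    (hf : Function.Periodic f (m : ℤ)) (n : ℤ) : f n = f ((n : ZMod m).val : ℕ) := by
  rw [ZMod.val_intCast, Int.emod_def]
  have := hf.int_mul (-(n / m)) n
  rw [← this]
  congr 1
  push_cast
  ring

lemma sum_range_eq_sum_zmod {m : ℕ} [NeZero m] {f : ℤ → ℂ} (hf : Function.Periodic f (m : ℤ)) :
    ∑ k ∈ Finset.range m, f k = ∑ x : ZMod m, f (x.val : ℕ) := by
  rw [← sum_range_natCast]
  refine Finset.sum_congr rfl fun k _ => ?_
  rw [periodic_eq_val hf, Int.cast_natCast]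

lemma sum_range_add_int {m : ℕ} [NeZero m] {f : ℤ → ℂ} (hf : Function.Periodic f (m : ℤ))
    (r : ℤ) : ∑ k ∈ Finset.range m, f (k + r) = ∑ k ∈ Finset.range m, f k := by
  rw [sum_range_eq_sum_zmod hf, ← Equiv.sum_comp (Equiv.addRight (r : ZMod m)),
    ← sum_range_natCast]
  refine Finset.sum_congr rfl fun k _ => ?_
  rw [periodic_eq_val hf]
  simp

lemma sum_range_mul (f : ℕ → ℂ) (m n : ℕ) :
    ∑ k ∈ Finset.range (m * n), f k =
      ∑ k ∈ Finset.range n, ∑ i ∈ Finset.range m, f (m * k + i) := by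
  induction n with
  | zero => simp
  | succ n ih => rw [mul_add, mul_one, Finset.sum_range_add, ih, Finset.sum_range_succ]

lemma sum_range_mul_of_periodic {m : ℕ} {f : ℤ → ℂ} (hf : Function.Periodic f (m : ℤ)) (n : ℕ) :
    ∑ k ∈ Finset.range (m * n), f k = n * ∑ k ∈ Finset.range m, f k := by
  rw [sum_range_mul (fun k => f k)]
  rw [Finset.sum_congr rfl (g := fun _ => ∑ k ∈ Finset.range m, f k), Finset.sum_const,
    Finset.card_range, nsmul_eq_mul]
  intro k _
  refine Finset.sum_congr rfl fun i _ => ?_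
  have := hf.int_mul k i
  rw [← this]
  congr 1
  push_cast
  ring

lemma sum_range_comm_period {m n : ℕ} {f : ℤ → ℂ} (hm : Function.Periodic f (m : ℤ))
    (hn : Function.Periodic f (n : ℤ)) :
    (n : ℂ) * ∑ k ∈ Finset.range m, f k = m * ∑ k ∈ Finset.range n, f k := by
  rw [← sum_range_mul_of_periodic hm, ← sum_range_mul_of_periodic hn, mul_comm m n]

lemma sum_eDiv {L : ℕ} [NeZero L] (n : ℤ) :
    ∑ j ∈ Finset.range L, eDiv L (j * n) = if (L : ℤ) ∣ n then (L : ℂ) else 0 := by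
  have := AddChar.sum_mulShift (n : ZMod L) (ZMod.isPrimitive_stdAddChar L)
  rw [← sum_range_natCast (fun x => ZMod.stdAddChar (x * (n : ZMod L)))] at this
  simp only [ZMod.intCast_zmod_eq_zero_iff_dvd, ZMod.card] at this
  rw [Finset.sum_congr rfl (g := fun j : ℕ => ZMod.stdAddChar ((j : ZMod L) * (n : ZMod L)))]
  · rw [this]; split_ifs <;> simp
  · intro j _
    rw [eDiv_eq_stdAddChar]; push_cast; rfl

lemma eDiv_periodic {L : ℕ} [NeZero L] {m : ℕ} (n : ℤ) (h : (L : ℤ) ∣ n * m) :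
    Function.Periodic (fun k : ℤ => eDiv L (n * k)) (m : ℤ) := fun k =>
  eDiv_congr (Int.modEq_iff_dvd.mpr (by
    rw [show n * k - n * (k + m) = -(n * m) by ring]; exact (dvd_neg).mpr h))

lemma sum_range_mul_ite_dvd {m : ℕ} [NeZero m] {f : ℤ → ℂ} (hf : Function.Periodic f (m : ℤ))
    (z : ℂ) (h : ℤ) :
    ∑ k ∈ Finset.range m, f k * (if (m : ℤ) ∣ k - h then z else 0) = z * f h := by
  have hp : Function.Periodic
      (fun k : ℤ => f k * if (m : ℤ) ∣ k - h then z else 0) (m : ℤ) := fun k => by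
    simp only [hf k, show k + m - h = (k - h) + m by ring, dvd_add_self_right]
  rw [← sum_range_add_int hp h]
  simp only [add_sub_cancel_right]
  rw [Finset.sum_eq_single 0]
  · simp [mul_comm]
  · intro k hk hk0
    rw [if_neg, mul_zero]
    intro hd
    exact hk0 (Nat.eq_zero_of_dvd_of_lt (Int.natCast_dvd_natCast.mp hd) (Finset.mem_range.mp hk))
  · intro hc
    exact absurd (Finset.mem_range.mpr (Nat.pos_of_ne_zero (NeZero.ne m))) hc

/-- Fourier inversion for a periodic function on which two further translations act by
characters. -/
lemma mul_eq_sum_eDiv {L D : ℕ} [NeZero L] {F : ℤ → ℂ} {r b s : ℤ} (hs : s * s = 1)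
    (hD : (D : ℤ) ≡ s * r ^ 2 [ZMOD L]) (h1 : Function.Periodic F (L : ℤ))
    (h2 : ∀ k, F (k + r) = eDiv L (-(s * b)) * F k)
    (h3 : ∀ k, F (k + D) = eDiv L (-(r * b)) * F k) (h : ℤ) :
    D * F h = ∑ j ∈ Finset.range L, eDiv L (-(s * h * j)) *
      if b ≡ r * j [ZMOD L] then ∑ k ∈ Finset.range D, F k * eDiv L (s * j * k) else 0 := by
  have hL : (L : ℂ) ≠ 0 := NeZero.ne _
  have hper : ∀ j : ℤ, Function.Periodic (fun k => F k * eDiv L (s * j * k)) (L : ℤ) :=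
    fun j => h1.mul (eDiv_periodic _ (dvd_mul_left _ _))
  have hsd : ∀ n : ℤ, (L : ℤ) ∣ s * n ↔ (L : ℤ) ∣ n := fun n =>
    ⟨fun h => by have := h.mul_left s; rwa [← mul_assoc, hs, one_mul] at this,
      fun h => h.mul_left s⟩
  have hinv : ∑ j ∈ Finset.range L, eDiv L (-(s * h * j)) *
      ∑ k ∈ Finset.range L, F k * eDiv L (s * j * k) = L * F h := by
    calc _ = ∑ k ∈ Finset.range L, F k * ∑ j ∈ Finset.range L, eDiv L (j * (s * (k - h))) := by
          simp only [Finset.mul_sum]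
          rw [Finset.sum_comm]
          refine Finset.sum_congr rfl fun k _ => Finset.sum_congr rfl fun j _ => ?_
          rw [mul_left_comm, ← eDiv_add]
          congr 2
          ring
      _ = L * F h := by
          simp only [sum_eDiv, hsd]
          rw [sum_range_mul_ite_dvd h1]
  refine mul_left_cancel₀ hL ?_
  rw [mul_left_comm, ← hinv, Finset.mul_sum, Finset.mul_sum]
  refine Finset.sum_congr rfl fun j _ => ?_
  rw [mul_left_comm, mul_left_comm (L : ℂ)]
  congr 1
  split_ifs with hj
  · refine sum_range_comm_period (hper j) (fun k => ?_)
    simp only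
    have he : eDiv L (-(r * b)) * eDiv L (s * j * (k + D)) = eDiv L (s * j * k) := by
      rw [← eDiv_add]
      refine eDiv_congr ?_
      have e1 : -(r * b) + s * j * (k + D) ≡
          -(r * (r * j)) + s * j * (k + s * r ^ 2) [ZMOD L] :=
        (hj.mul_left r).neg.add ((hD.add_left k).mul_left _)
      have e2 : -(r * (r * j)) + s * j * (k + s * r ^ 2) = s * j * k := by
        linear_combination (j * r ^ 2) * hs
      rwa [e2] at e1
    rw [h3]
    linear_combination F k * he
  · have hz : ∑ k ∈ Finset.range L, F k * eDiv L (s * j * k) = 0 := by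
      have e1 := sum_range_add_int (hper j) r
      have e2 : ∀ k : ℕ, F (k + r) * eDiv L (s * j * (k + r)) =
          eDiv L (s * (r * j - b)) * (F k * eDiv L (s * j * k)) := by
        intro k
        have he : eDiv L (-(s * b)) * eDiv L (s * j * (k + r)) =
            eDiv L (s * (r * j - b)) * eDiv L (s * j * k) := by
          rw [← eDiv_add, ← eDiv_add]
          congr 1
          ring
        rw [h2]
        linear_combination F k * he
      simp only [e2] at e1
      rw [← Finset.mul_sum] at e1
      by_contra hne
      have e3 := (mul_eq_right₀ hne).mp e1
      rw [eDiv_eq_one_iff, hsd] at e3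
      exact hj (Int.modEq_iff_dvd.mpr e3)
    rw [hz, mul_zero, mul_zero]

end Periodic

lemma sign_mul_sign {n : ℤ} (hn : n ≠ 0) : n.sign * n.sign = 1 := by
  rcases lt_or_gt_of_ne hn with h | h
  · rw [Int.sign_eq_neg_one_of_neg h]; rfl
  · rw [Int.sign_eq_one_of_pos h]; rfl

section Reciprocity

variable {N : ℕ} {Δ r M : ℤ} {χ : ℤ → ℤ → ℤ → ℤ}

/-- The coefficient of the vector `[a, b, Nc]` in the component of index `h` of the twisted
theta function. -/
def weight (N : ℕ) (Δ r : ℤ) (χ : ℤ → ℤ → ℤ → ℤ) (h a b c : ℤ) : ℂ :=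
  if b ≡ r * h [ZMOD (2 * (N : ℤ))] ∧ QD N a b c ≡ Δ * h ^ 2 [ZMOD (4 * (N : ℤ) * Δ)] then
    (χ a b c : ℂ) else 0

lemma weight_eq_zero {h a b c : ℤ} (hb : ¬ b ≡ r * h [ZMOD (2 * (N : ℤ))]) :
    weight N Δ r χ h a b c = 0 := if_neg fun hc => hb hc.1

lemma weight_eq (hχ : IsGenusChar N Δ χ) (hN : 0 < N) (hfd : IsFundamentalDiscriminant Δ)
    (hΔ : Δ = r ^ 2 - 4 * (N * M)) (h a β c : ℤ) :
    weight N Δ r χ h a (r * h + 2 * N * β) c = isoCharMod N Δ r M χ a c β h := by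
  rw [isoCharMod_intCast hχ hN hfd hΔ, weight, isoChar]
  have h4 : (4 * (N : ℤ)) ≠ 0 := by positivity
  have : (r * h + 2 * N * β ≡ r * h [ZMOD (2 * (N : ℤ))] ∧ QD N a (r * h + 2 * N * β) c ≡
      Δ * h ^ 2 [ZMOD (4 * (N : ℤ) * Δ)]) ↔ Δ ∣ a * c - bqf (N : ℤ) r M β h := by
    rw [QD_eq hΔ, Int.modEq_iff_dvd, Int.modEq_iff_dvd, sub_sub_cancel,
      mul_dvd_mul_iff_left h4]
    exact and_iff_right ⟨-β, by ring⟩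
  simp only [this]
  split_ifs <;> simp

lemma exists_eq_of_modEq {b h : ℤ} (hb : b ≡ r * h [ZMOD (2 * (N : ℤ))]) :
    ∃ β, b = r * h + 2 * N * β := by
  obtain ⟨β, hβ⟩ := Int.modEq_iff_dvd.mp hb.symm
  exact ⟨β, by rw [← hβ]; ring⟩

lemma weight_congr (hχ : IsGenusChar N Δ χ) (hN : 0 < N) (hfd : IsFundamentalDiscriminant Δ)
    (hΔ : Δ = r ^ 2 - 4 * (N * M)) {h a b c a' b' c' : ℤ} (ha : a ≡ a' [ZMOD Δ])
    (hb : b ≡ b' [ZMOD (2 * N * Δ)]) (hc : c ≡ c' [ZMOD Δ]) :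
    weight N Δ r χ h a b c = weight N Δ r χ h a' b' c' := by
  by_cases hbh : b ≡ r * h [ZMOD (2 * (N : ℤ))]
  · obtain ⟨β, rfl⟩ := exists_eq_of_modEq hbh
    obtain ⟨k, hk⟩ := Int.modEq_iff_dvd.mp hb
    obtain rfl : b' = r * h + 2 * N * (β + Δ * k) := by linear_combination hk
    rw [weight_eq hχ hN hfd hΔ, weight_eq hχ hN hfd hΔ, (intCast_eq_iff_modEq Δ a a').mpr ha,
      (intCast_eq_iff_modEq Δ c c').mpr hc, (intCast_eq_iff_modEq Δ β (β + Δ * k)).mpr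
        (Int.modEq_iff_dvd.mpr ⟨k, by ring⟩)]
  · have hb2 : b ≡ b' [ZMOD (2 * (N : ℤ))] := hb.of_mul_right _
    rw [weight_eq_zero hbh, weight_eq_zero fun hn => hbh (hb2.trans hn)]

/-- The partial Fourier transform of the isotropic genus character at `h`, normalised to have
period `2N` in `h`. -/
def partialFourier (N : ℕ) (Δ r M : ℤ) (χ : ℤ → ℤ → ℤ → ℤ) [NeZero Δ.natAbs]
    (a' b' c' h : ℤ) : ℂ :=
  eDiv (2 * N * Δ.natAbs) (-(r * h * b')) *
    ∑ w : ZMod Δ.natAbs × ZMod Δ.natAbs × ZMod Δ.natAbs, isoCharMod N Δ r M χ w.1 w.2.1 w.2.2 h *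
      ZMod.stdAddChar (N := Δ.natAbs) (w.1 * c' + w.2.1 * a' - w.2.2 * b')

lemma isoCharMod_translate (hχ : IsGenusChar N Δ χ) (hN : 0 < N)
    (hfd : IsFundamentalDiscriminant Δ) (hΔ : Δ = r ^ 2 - 4 * (N * M)) (i j : ℤ)
    (a c β : ZMod Δ.natAbs) (h : ℤ) :
    isoCharMod N Δ r M χ a c (β - (r * i + 2 * M * j : ℤ)) ((h + (2 * N * i + r * j) : ℤ)) =
      isoCharMod N Δ r M χ a c β h := by
  obtain ⟨a, rfl⟩ := ZMod.intCast_surjective a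
  obtain ⟨c, rfl⟩ := ZMod.intCast_surjective c
  obtain ⟨β, rfl⟩ := ZMod.intCast_surjective β
  rw [← Int.cast_sub, isoCharMod_intCast hχ hN hfd hΔ, isoCharMod_intCast hχ hN hfd hΔ,
    isoChar_congr hχ hN hfd hΔ rfl rfl]
  · refine Int.modEq_iff_dvd.mpr ⟨N * i ^ 2 + h * i - j * β + r * i * j + M * j ^ 2, ?_⟩
    rw [hΔ, bqf, bqf]; ring
  · exact Int.modEq_iff_dvd.mpr ⟨-j, by rw [hΔ]; ring⟩
  · exact Int.modEq_iff_dvd.mpr ⟨i, by rw [hΔ]; ring⟩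

lemma partialFourier_translate (hχ : IsGenusChar N Δ χ) (hN : 0 < N)
    (hfd : IsFundamentalDiscriminant Δ) (hΔ : Δ = r ^ 2 - 4 * (N * M)) [NeZero Δ.natAbs]
    (i j a' b' c' h : ℤ) :
    partialFourier N Δ r M χ a' b' c' (h + (2 * N * i + r * j)) =
      eDiv (2 * N) (-(Δ.sign * b') * j) * partialFourier N Δ r M χ a' b' c' h := by
  have hN2 : 2 * N ≠ 0 := by positivity
  have hs : ∑ w : ZMod Δ.natAbs × ZMod Δ.natAbs × ZMod Δ.natAbs,
      isoCharMod N Δ r M χ w.1 w.2.1 w.2.2 (h + (2 * N * i + r * j) : ℤ) *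
        ZMod.stdAddChar (N := Δ.natAbs) (w.1 * c' + w.2.1 * a' - w.2.2 * b') =
      eDiv Δ.natAbs ((r * i + 2 * M * j) * b') *
      ∑ w : ZMod Δ.natAbs × ZMod Δ.natAbs × ZMod Δ.natAbs,
        isoCharMod N Δ r M χ w.1 w.2.1 w.2.2 h *
          ZMod.stdAddChar (N := Δ.natAbs) (w.1 * c' + w.2.1 * a' - w.2.2 * b') := by
    rw [← Equiv.sum_comp ((Equiv.refl _).prodCongr ((Equiv.refl _).prodCongr
      (Equiv.subRight ((r * i + 2 * M * j : ℤ) : ZMod Δ.natAbs)))), Finset.mul_sum]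
    refine Finset.sum_congr rfl fun w _ => ?_
    obtain ⟨a, c, β⟩ := w
    simp only [Equiv.prodCongr_apply, Prod.map_apply, Equiv.refl_apply, Equiv.subRight_apply]
    rw [isoCharMod_translate hχ hN hfd hΔ, mul_left_comm, eDiv_eq_stdAddChar,
      ← AddChar.map_add_eq_mul]
    congr 2
    push_cast
    ring
  have he : eDiv (2 * N * Δ.natAbs) (-(r * (h + (2 * N * i + r * j)) * b')) *
      eDiv Δ.natAbs ((r * i + 2 * M * j) * b') =
      eDiv (2 * N) (-(Δ.sign * b') * j) * eDiv (2 * N * Δ.natAbs) (-(r * h * b')) := by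
    rw [← eDiv_mul_mul hN2 Δ.natAbs, ← eDiv_mul_mul (NeZero.ne Δ.natAbs) (2 * N),
      mul_comm Δ.natAbs, ← eDiv_add, ← eDiv_add]
    congr 1
    have := Int.sign_mul_abs Δ
    push_cast
    linear_combination (b' * j) * hΔ + b' * j * this
  rw [partialFourier, hs, ← mul_assoc, he, mul_assoc, partialFourier]

lemma sum_partialFourier_mul (hN : 0 < N) (hΔ : Δ = r ^ 2 - 4 * (N * M)) [NeZero Δ.natAbs]
    (a' c' m j : ℤ) :
    ∑ k ∈ Finset.range Δ.natAbs, partialFourier N Δ r M χ a' (r * j + 2 * N * m) c' k *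
        eDiv (2 * N) (Δ.sign * j * k) =
      fourierFour ((N : ℤ) : ZMod Δ.natAbs) r M ZMod.stdAddChar (isoCharMod N Δ r M χ)
        a' c' m j := by
  have hN2 : 2 * N ≠ 0 := by positivity
  have hk : ∀ k : ℤ, partialFourier N Δ r M χ a' (r * j + 2 * N * m) c' k *
      eDiv (2 * N) (Δ.sign * j * k) = ∑ w : ZMod Δ.natAbs × ZMod Δ.natAbs × ZMod Δ.natAbs,
        isoCharMod N Δ r M χ w.1 w.2.1 w.2.2 k *
          ZMod.stdAddChar (N := Δ.natAbs) (w.1 * c' + w.2.1 * a' -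
            bqfPolar ((N : ℤ) : ZMod Δ.natAbs) r M w.2.2 k m j) := by
    intro k
    have he : eDiv (2 * N * Δ.natAbs) (-(r * k * (r * j + 2 * N * m))) *
        eDiv (2 * N) (Δ.sign * j * k) = eDiv Δ.natAbs (-(r * k * m + 2 * M * k * j)) := by
      rw [← eDiv_mul_mul hN2 Δ.natAbs, ← eDiv_mul_mul (NeZero.ne Δ.natAbs) (2 * N),
        mul_comm Δ.natAbs, ← eDiv_add]
      congr 1
      have := Int.sign_mul_abs Δ
      push_cast
      linear_combination (j * k) * hΔ + j * k * this
    rw [partialFourier, mul_right_comm, he, Finset.mul_sum]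
    refine Finset.sum_congr rfl fun w _ => ?_
    rw [mul_left_comm, eDiv_eq_stdAddChar, ← AddChar.map_add_eq_mul]
    congr 2
    rw [bqfPolar]
    push_cast
    ring
  simp only [hk, Int.cast_natCast]
  rw [sum_range_natCast fun k : ZMod Δ.natAbs =>
    ∑ w : ZMod Δ.natAbs × ZMod Δ.natAbs × ZMod Δ.natAbs,
      isoCharMod N Δ r M χ w.1 w.2.1 w.2.2 k *
        ZMod.stdAddChar (N := Δ.natAbs) (w.1 * c' + w.2.1 * a' -
          bqfPolar (N : ZMod Δ.natAbs) r M w.2.2 k m j)]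
  simp only [fourierFour, Fintype.sum_prod_type]
  rw [Finset.sum_comm]
  refine Finset.sum_congr rfl fun a _ => ?_
  rw [Finset.sum_comm]
  refine Finset.sum_congr rfl fun c _ => ?_
  rw [Finset.sum_comm]

/-- The partial Fourier transform of the genus character is a finite theta transformation. -/
lemma exists_partialFourier_eq (hχ : IsGenusChar N Δ χ) (hN : 0 < N)
    (hfd : IsFundamentalDiscriminant Δ) (hΔ : Δ = r ^ 2 - 4 * (N * M)) [NeZero Δ.natAbs] :
    ∃ K : ℂ, ∀ a' b' c' h : ℤ, partialFourier N Δ r M χ a' b' c' h =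
      K * ∑ j ∈ Finset.range (2 * N), eDiv (2 * N) (-(Δ.sign * h * j)) *
        weight N Δ r χ j a' b' c' := by
  obtain ⟨K, hK⟩ := exists_fourierFour_isoCharMod hχ hN hfd hΔ ZMod.stdAddChar
  have : NeZero (2 * N) := ⟨by positivity⟩
  have hD : (Δ.natAbs : ℂ) ≠ 0 := NeZero.ne _
  have hsign := sign_mul_sign (IsFundamentalDiscriminant.ne_zero hfd)
  refine ⟨K / Δ.natAbs, fun a' b' c' h => ?_⟩
  have := mul_eq_sum_eDiv (L := 2 * N) (D := Δ.natAbs) (F := partialFourier N Δ r M χ a' b' c')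
    (r := r) (b := b') hsign ?_ ?_ ?_ ?_ h
  · rw [div_mul_eq_mul_div, eq_div_iff hD, mul_comm, this, Finset.mul_sum]
    refine Finset.sum_congr rfl fun j _ => ?_
    rw [mul_left_comm]
    congr 1
    push_cast
    split_ifs with hj
    · obtain ⟨m, rfl⟩ := exists_eq_of_modEq hj
      have h1 := sum_partialFourier_mul (χ := χ) hN hΔ a' c' m j
      rw [hK] at h1
      rw [h1, weight_eq hχ hN hfd hΔ]
    · rw [weight_eq_zero hj, mul_zero]
  · have h1 := Int.sign_mul_abs Δ
    refine Int.modEq_iff_dvd.mpr ⟨2 * M * Δ.sign, ?_⟩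
    push_cast
    linear_combination (Δ.sign) * (-hΔ - h1) + |Δ| * hsign
  · intro k
    have := partialFourier_translate hχ hN hfd hΔ 1 0 a' b' c' k
    simpa [eDiv_zero] using this
  · intro k
    have := partialFourier_translate hχ hN hfd hΔ 0 1 a' b' c' k
    simpa using this
  · intro k
    have : ((Δ.natAbs : ℤ) : ZMod Δ.natAbs) = 0 := by rw [Int.cast_natCast, ZMod.natCast_self]
    rw [partialFourier, partialFourier, Int.cast_add, this, add_zero, ← mul_assoc]
    congr 1
    rw [← eDiv_mul_mul (NeZero.ne Δ.natAbs) (2 * N), mul_comm Δ.natAbs, ← eDiv_add]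
    congr 1
    ring

lemma partialFourier_eq_sum (hχ : IsGenusChar N Δ χ) (hN : 0 < N)
    (hfd : IsFundamentalDiscriminant Δ) (hΔ : Δ = r ^ 2 - 4 * (N * M)) [NeZero Δ.natAbs]
    (a' b' c' h : ℤ) :
    partialFourier N Δ r M χ a' b' c' h =
      ∑ b ∈ Finset.range (2 * N * Δ.natAbs), ∑ a ∈ Finset.range Δ.natAbs,
        ∑ c ∈ Finset.range Δ.natAbs, weight N Δ r χ h a b c *
          (eDiv Δ.natAbs (a * c' + c * a') * eDiv (2 * N * Δ.natAbs) (-(b * b'))) := by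
  have hN2 : 2 * N ≠ 0 := by positivity
  have : NeZero (2 * N) := ⟨hN2⟩
  have hp : Function.Periodic (fun b : ℤ => ∑ a ∈ Finset.range Δ.natAbs,
      ∑ c ∈ Finset.range Δ.natAbs, weight N Δ r χ h a b c *
        (eDiv Δ.natAbs (a * c' + c * a') * eDiv (2 * N * Δ.natAbs) (-(b * b'))))
      ((2 * N * Δ.natAbs : ℕ) : ℤ) := by
    intro b
    refine Finset.sum_congr rfl fun a _ => Finset.sum_congr rfl fun c _ => ?_
    rw [weight_congr hχ hN hfd hΔ rfl (b' := b) ?_ rfl]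
    · congr 2
      exact eDiv_congr (Int.modEq_iff_dvd.mpr ⟨b', by ring⟩)
    · refine Int.modEq_iff_dvd.mpr ?_
      rw [sub_add_cancel_left, dvd_neg, Nat.cast_mul, Nat.cast_mul]
      exact mul_dvd_mul_left _ (Int.dvd_natAbs.mpr dvd_rfl)
  rw [← sum_range_add_int hp (r * h), sum_range_mul (fun k : ℕ => ∑ a ∈ Finset.range Δ.natAbs,
      ∑ c ∈ Finset.range Δ.natAbs, weight N Δ r χ h a (k + r * h) c *
        (eDiv Δ.natAbs (a * c' + c * a') * eDiv (2 * N * Δ.natAbs) (-((k + r * h) * b'))))]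
  have hi : ∀ k : ℕ, ∑ i ∈ Finset.range (2 * N), ∑ a ∈ Finset.range Δ.natAbs,
      ∑ c ∈ Finset.range Δ.natAbs, weight N Δ r χ h a ((2 * N * k + i : ℕ) + r * h) c *
        (eDiv Δ.natAbs (a * c' + c * a') *
          eDiv (2 * N * Δ.natAbs) (-(((2 * N * k + i : ℕ) + r * h) * b'))) =
      ∑ a ∈ Finset.range Δ.natAbs, ∑ c ∈ Finset.range Δ.natAbs,
        eDiv (2 * N * Δ.natAbs) (-(r * h * b')) * (isoCharMod N Δ r M χ a c k h *
          ZMod.stdAddChar (N := Δ.natAbs) (a * c' + c * a' - k * b')) := by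
    intro k
    rw [Finset.sum_eq_single 0]
    · refine Finset.sum_congr rfl fun a _ => Finset.sum_congr rfl fun c _ => ?_
      have h1 := weight_eq hχ hN hfd hΔ h a k c
      push_cast at h1
      push_cast
      rw [add_zero, add_comm (2 * (N : ℤ) * k), h1]
      have h2 : ZMod.stdAddChar (N := Δ.natAbs) (a * c' + c * a' - k * b') =
          eDiv Δ.natAbs (a * c' + c * a' - k * b') := by
        rw [eDiv_eq_stdAddChar]; push_cast; rfl
      have he : eDiv Δ.natAbs (a * c' + c * a') *
          eDiv (2 * N * Δ.natAbs) (-((r * h + 2 * N * k) * b')) =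
          eDiv (2 * N * Δ.natAbs) (-(r * h * b')) * eDiv Δ.natAbs (a * c' + c * a' - k * b') := by
        rw [← eDiv_mul_mul hN2 Δ.natAbs, ← eDiv_mul_mul hN2 Δ.natAbs, ← eDiv_add, ← eDiv_add]
        congr 1
        push_cast
        ring
      rw [h2]
      linear_combination isoCharMod N Δ r M χ a c k h * he
    · intro i hi hi0
      refine Finset.sum_eq_zero fun a _ => Finset.sum_eq_zero fun c _ => ?_
      rw [weight_eq_zero, zero_mul]
      intro hc
      refine hi0 (Nat.eq_zero_of_dvd_of_lt (Int.natCast_dvd_natCast.mp ?_)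
        (Finset.mem_range.mp hi))
      have := (Int.modEq_iff_dvd.mp hc.symm)
      push_cast at this ⊢
      rwa [add_sub_cancel_right, dvd_add_right (dvd_mul_right _ _)] at this
    · intro hc
      exact absurd (Finset.mem_range.mpr (Nat.pos_of_ne_zero hN2)) hc
  rw [Finset.sum_congr rfl fun k _ => hi k]
  simp only [partialFourier, Fintype.sum_prod_type, Finset.mul_sum]
  symm
  rw [Finset.sum_comm, ← sum_range_natCast]
  refine Finset.sum_congr rfl fun a _ => ?_
  rw [Finset.sum_comm, ← sum_range_natCast]
  refine Finset.sum_congr rfl fun c _ => ?_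
  rw [← sum_range_natCast]

/-- The reciprocity law for the partial Fourier transforms of the coefficients of the twisted theta
function. -/
lemma exists_sum_weight_eq (hχ : IsGenusChar N Δ χ) (hN : 0 < N)
    (hfd : IsFundamentalDiscriminant Δ) (hΔ : Δ = r ^ 2 - 4 * (N * M)) [NeZero Δ.natAbs] :
    ∃ K : ℂ, ∀ m b' c h : ℤ,
      ∑ b ∈ Finset.range (2 * N * Δ.natAbs), (∑ a ∈ Finset.range Δ.natAbs,
        weight N Δ r χ h a b c * eDiv Δ.natAbs (-(a * m))) *
          eDiv (2 * N * Δ.natAbs) (-(b * b')) =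
      K * ∑ j ∈ Finset.range (2 * N), eDiv (2 * N) (-(Δ.sign * h * j)) *
        ∑ a ∈ Finset.range Δ.natAbs, weight N Δ r χ j a b' (-m) * eDiv Δ.natAbs (-(a * c)) := by
  obtain ⟨K, hK⟩ := exists_partialFourier_eq hχ hN hfd hΔ
  have hD : (Δ.natAbs : ℂ) ≠ 0 := NeZero.ne _
  refine ⟨K / Δ.natAbs, fun m b' c h => ?_⟩
  rw [div_mul_eq_mul_div, eq_div_iff hD]
  calc _ = ∑ b ∈ Finset.range (2 * N * Δ.natAbs), ∑ a ∈ Finset.range Δ.natAbs,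
        (∑ c₁ ∈ Finset.range Δ.natAbs, weight N Δ r χ h a b c₁ *
          (if (Δ.natAbs : ℤ) ∣ c₁ - c then (Δ.natAbs : ℂ) else 0)) *
        (eDiv Δ.natAbs (-(a * m)) * eDiv (2 * N * Δ.natAbs) (-(b * b'))) := by
        rw [Finset.sum_mul]
        refine Finset.sum_congr rfl fun b _ => ?_
        rw [Finset.sum_mul, Finset.sum_mul]
        refine Finset.sum_congr rfl fun a _ => ?_
        rw [sum_range_mul_ite_dvd (f := fun c => weight N Δ r χ h a b c)]
        · ring
        · intro c₁
          refine weight_congr hχ hN hfd hΔ rfl rfl (Int.modEq_iff_dvd.mpr ?_)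
          rw [sub_add_cancel_left, dvd_neg]
          exact Int.dvd_natAbs.mpr dvd_rfl
    _ = ∑ a' ∈ Finset.range Δ.natAbs, partialFourier N Δ r M χ a' b' (-m) h *
          eDiv Δ.natAbs (-(a' * c)) := by
        simp only [partialFourier_eq_sum hχ hN hfd hΔ, ← sum_eDiv, Finset.mul_sum, Finset.sum_mul]
        symm
        rw [Finset.sum_comm]
        refine Finset.sum_congr rfl fun b _ => ?_
        rw [Finset.sum_comm]
        refine Finset.sum_congr rfl fun a _ => ?_
        rw [Finset.sum_comm]
        refine Finset.sum_congr rfl fun c₁ _ => Finset.sum_congr rfl fun a' _ => ?_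
        have he : eDiv Δ.natAbs (a' * (c₁ - c)) * eDiv Δ.natAbs (-(a * m)) =
            eDiv Δ.natAbs (a * -m + c₁ * a') * eDiv Δ.natAbs (-(a' * c)) := by
          rw [← eDiv_add, ← eDiv_add]
          congr 1
          ring
        linear_combination weight N Δ r χ h a b c₁ * eDiv (2 * N * Δ.natAbs) (-(b * b')) * -he
    _ = _ := by
        simp only [hK, Finset.mul_sum, Finset.sum_mul]
        rw [Finset.sum_comm]
        refine Finset.sum_congr rfl fun j _ => Finset.sum_congr rfl fun a' _ => ?_
        ring

end Reciprocity

section Poisson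

lemma exists_norm_le_of_periodic {m : ℕ} [NeZero m] {f : ℤ → ℂ}
    (hf : Function.Periodic f (m : ℤ)) : ∃ B : ℝ, ∀ n, ‖f n‖ ≤ B := by
  refine ⟨∑ x : ZMod m, ‖f (x.val : ℕ)‖, fun n => ?_⟩
  rw [periodic_eq_val hf n]
  exact Finset.single_le_sum (f := fun x : ZMod m => ‖f (x.val : ℕ)‖)
    (fun _ _ => norm_nonneg _) (Finset.mem_univ _)

lemma summable_jacobiTheta₂_term_I_mul {σ : ℂ} (hσ : 0 < σ.re) (z : ℂ) :
    Summable fun n : ℤ => jacobiTheta₂_term n z (I * σ) :=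
  (summable_jacobiTheta₂_term_iff _ _).mpr (by simpa using hσ)

lemma inv_re_pos {σ : ℂ} (hσ : 0 < σ.re) : 0 < (σ⁻¹).re := by
  rw [inv_re]
  exact div_pos hσ (normSq_pos.mpr fun h => by simp [h] at hσ)

/-- Poisson summation for a Gaussian twisted by a periodic function. -/
lemma tsum_periodic_mul_gaussian {P : ℕ} [NeZero P] {g : ℤ → ℂ}
    (hg : Function.Periodic g (P : ℤ)) {σ : ℂ} (hσ : 0 < σ.re) (z : ℂ) :
    ∑' n : ℤ, g n * jacobiTheta₂_term n z (I * σ) =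
      1 / ((P : ℂ) ^ 2 * σ) ^ (1 / 2 : ℂ) *
        ∑' m : ℤ, (∑ j ∈ Finset.range P, g j * eDiv P (-(j * m))) *
          cexp (-Real.pi * (z + m / P) ^ 2 / σ) := by
  have hP : (P : ℂ) ≠ 0 := NeZero.ne _
  have hσ0 : σ ≠ 0 := fun h => by simp [h] at hσ
  have hP2 : 0 < ((P : ℂ) ^ 2 * σ).re := by
    rw [show (P : ℂ) ^ 2 * σ = ((P ^ 2 : ℝ) : ℂ) * σ by push_cast; rfl, re_ofReal_mul]
    exact mul_pos (by have := NeZero.pos P; positivity) hσ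
  have hclass : ∀ j : ℕ, ∑' q : ℤ, jacobiTheta₂_term (q * P + j) z (I * σ) =
      1 / ((P : ℂ) ^ 2 * σ) ^ (1 / 2 : ℂ) *
        ∑' m : ℤ, eDiv P (-(j * m)) * cexp (-Real.pi * (z + m / P) ^ 2 / σ) := by
    intro j
    have h1 := Complex.tsum_exp_neg_quadratic hP2 (P * (I * z - σ * j))
    have h2 : ∀ q : ℤ, jacobiTheta₂_term (q * P + j) z (I * σ) =
        cexp (-Real.pi * σ * j ^ 2 + 2 * Real.pi * I * j * z) *
        cexp (-Real.pi * ((P : ℂ) ^ 2 * σ) * q ^ 2 +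
          2 * Real.pi * (P * (I * z - σ * j)) * q) := by
      intro q
      rw [jacobiTheta₂_term, ← Complex.exp_add]
      congr 1
      push_cast
      linear_combination (Real.pi * (q * P + j) ^ 2 * σ) * I_sq
    have h3 : ∀ m : ℤ, eDiv P (-(j * m)) * cexp (-Real.pi * (z + m / P) ^ 2 / σ) =
        cexp (-Real.pi * σ * j ^ 2 + 2 * Real.pi * I * j * z) *
        cexp (-Real.pi / ((P : ℂ) ^ 2 * σ) * ((-m : ℤ) + I * (P * (I * z - σ * j))) ^ 2) := by
      intro m
      rw [eDiv, e, ← Complex.exp_add, ← Complex.exp_add]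
      congr 1
      push_cast
      field_simp
      ring_nf
      simp only [I_sq, show I ^ 3 = -I by rw [pow_succ, I_sq]; ring,
        show I ^ 4 = 1 by rw [pow_succ, pow_succ, I_sq]; ring_nf; simp]
      ring
    simp only [h2, h3]
    rw [tsum_mul_left, tsum_mul_left, h1, ← (Equiv.neg ℤ).tsum_eq]
    simp only [Equiv.neg_apply]
    ring
  have hsum : Summable fun n : ℤ => g n * jacobiTheta₂_term n z (I * σ) := by
    obtain ⟨B, hB⟩ := exists_norm_le_of_periodic hg
    refine Summable.of_norm_bounded
      ((summable_jacobiTheta₂_term_I_mul hσ z).norm.mul_left B) fun n => ?_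
    rw [norm_mul]
    gcongr
    exact hB n
  have hdual : ∀ j : ℕ, Summable fun m : ℤ =>
      eDiv P (-(j * m)) * cexp (-Real.pi * (z + m / P) ^ 2 / σ) := by
    intro j
    have h1 := (summable_jacobiTheta₂_term_I_mul (inv_re_pos hP2)
      (I * z / (P * σ) - j / P)).mul_left (cexp (-Real.pi * z ^ 2 / σ))
    refine h1.congr fun m => ?_
    rw [jacobiTheta₂_term, eDiv, e, ← Complex.exp_add, ← Complex.exp_add]
    congr 1
    push_cast
    field_simp
    ring_nf
    simp only [I_sq]
    ring
  have hpair : ∀ p : Fin P × ℤ, g ((Int.divModEquiv P).symm p.swap) *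
      jacobiTheta₂_term ((Int.divModEquiv P).symm p.swap) z (I * σ) =
      g (p.1 : ℕ) * jacobiTheta₂_term (p.2 * P + (p.1 : ℕ)) z (I * σ) := by
    intro p
    have h1 : (Int.divModEquiv P).symm p.swap = p.2 * P + (p.1 : ℕ) := rfl
    have h2 : g ((p.1 : ℕ) + p.2 * P) = g (p.1 : ℕ) := hg.int_mul p.2 (p.1 : ℕ)
    rw [h1, ← h2, add_comm]
  have hsum' : Summable fun p : Fin P × ℤ =>
      g (p.1 : ℕ) * jacobiTheta₂_term (p.2 * P + (p.1 : ℕ)) z (I * σ) :=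
    (((Equiv.prodComm _ _).trans (Int.divModEquiv P).symm).summable_iff.mpr hsum).congr hpair
  calc _ = ∑' p : Fin P × ℤ,
        g (p.1 : ℕ) * jacobiTheta₂_term (p.2 * P + (p.1 : ℕ)) z (I * σ) := by
        rw [← ((Equiv.prodComm _ _).trans (Int.divModEquiv P).symm).tsum_eq]
        exact tsum_congr hpair
    _ = ∑ j ∈ Finset.range P, g j * ∑' q : ℤ, jacobiTheta₂_term (q * P + j) z (I * σ) := by
        rw [hsum'.tsum_prod, tsum_fintype, Finset.sum_range]
        simp only [tsum_mul_left]
    _ = _ := by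
        simp only [hclass, Finset.sum_mul, mul_assoc]
        rw [Summable.tsum_finsetSum fun j _ => (hdual j).mul_left (g j), Finset.mul_sum]
        refine Finset.sum_congr rfl fun j _ => ?_
        rw [tsum_mul_left, mul_left_comm]

end Poisson

section Summability

lemma summable_exp_neg_mul_sq {δ : ℝ} (hδ : 0 < δ) :
    Summable fun n : ℤ => Real.exp (-(δ * (n : ℝ) ^ 2)) := by
  have hre : 0 < ((δ / Real.pi : ℝ) : ℂ).re := by
    rw [ofReal_re]; exact div_pos hδ Real.pi_pos
  refine (summable_jacobiTheta₂_term_I_mul hre 0).norm.congr fun n => ?_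
  rw [norm_jacobiTheta₂_term]
  congr 1
  have := Real.pi_ne_zero
  simp
  field_simp

/-- A Gaussian attached to a positive definite ternary form in triangular form is summable. -/
lemma summable_exp_neg_triangular {α β γ : ℝ} (hα : 0 < α) (hβ : 0 < β) (hγ : 0 < γ)
    (p q k : ℝ) : Summable fun v : ℤ × ℤ × ℤ =>
      Real.exp (-(α * (v.1 + p * v.2.1 + q * v.2.2) ^ 2 + β * (v.2.1 + k * v.2.2) ^ 2 +
        γ * (v.2.2 : ℝ) ^ 2)) := by
  obtain ⟨μ, hμ, hμα, hμβ, hμγ⟩ : ∃ μ : ℝ, 0 < μ ∧ μ ≤ α ∧ μ ≤ β ∧ μ ≤ γ :=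
    ⟨min α (min β γ), lt_min hα (lt_min hβ hγ), min_le_left _ _,
      (min_le_right _ _).trans (min_le_left _ _), (min_le_right _ _).trans (min_le_right _ _)⟩
  set K : ℝ := 2 + (4 * p ^ 2 + 1) * (2 + 2 * k ^ 2) + (4 * q ^ 2 + 1) with hK
  have hK0 : 0 < K := by positivity
  have hδ : 0 < μ / K := div_pos hμ hK0
  have h1 := summable_exp_neg_mul_sq hδ
  have h3 := h1.mul_of_nonneg (h1.mul_of_nonneg h1 (fun _ => (Real.exp_pos _).le)
    (fun _ => (Real.exp_pos _).le)) (fun _ => (Real.exp_pos _).le)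
    (fun _ => mul_nonneg (Real.exp_pos _).le (Real.exp_pos _).le)
  refine h3.of_nonneg_of_le (fun _ => (Real.exp_pos _).le) fun v => ?_
  obtain ⟨a, b, c⟩ := v
  simp only
  rw [← Real.exp_add, ← Real.exp_add, Real.exp_le_exp]
  generalize (a : ℝ) = a
  generalize (b : ℝ) = b
  generalize (c : ℝ) = c
  set A := a + p * b + q * c with hA
  set B := b + k * c with hB
  have hb : b ^ 2 ≤ 2 * B ^ 2 + 2 * k ^ 2 * c ^ 2 := by
    nlinarith [sq_nonneg (B + k * c)]
  have ha : a ^ 2 ≤ 2 * A ^ 2 + 4 * p ^ 2 * b ^ 2 + 4 * q ^ 2 * c ^ 2 := by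
    nlinarith [sq_nonneg (A + (p * b + q * c)), sq_nonneg (p * b - q * c)]
  have hle : a ^ 2 + b ^ 2 + c ^ 2 ≤ K * (A ^ 2 + B ^ 2 + c ^ 2) := by
    have h4 : (4 * p ^ 2 + 1) * b ^ 2 ≤ (4 * p ^ 2 + 1) * (2 * B ^ 2 + 2 * k ^ 2 * c ^ 2) :=
      mul_le_mul_of_nonneg_left hb (by positivity)
    have h5 : 0 ≤ A ^ 2 * ((4 * p ^ 2 + 1) * (2 + 2 * k ^ 2) + (4 * q ^ 2 + 1)) := by positivity
    have h6 : 0 ≤ B ^ 2 * (2 + (4 * p ^ 2 + 1) * (2 * k ^ 2) + (4 * q ^ 2 + 1)) := by positivity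
    have h7 : 0 ≤ c ^ 2 * (2 + (4 * p ^ 2 + 1) * 2) := by positivity
    rw [hK]
    nlinarith
  have hfin : μ / K * (a ^ 2 + b ^ 2 + c ^ 2) ≤ μ * (A ^ 2 + B ^ 2 + c ^ 2) := by
    rw [div_mul_eq_mul_div, div_le_iff₀ hK0, mul_assoc]
    exact mul_le_mul_of_nonneg_left (by linarith) hμ.le
  have e1 := mul_le_mul_of_nonneg_right hμα (sq_nonneg A)
  have e2 := mul_le_mul_of_nonneg_right hμβ (sq_nonneg B)
  have e3 := mul_le_mul_of_nonneg_right hμγ (sq_nonneg c)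
  linarith

end Summability

section Kernel

/-- The Gaussian kernel of the Siegel theta function at `τ = u + iv`, `t = x + iy`, after a partial
Poisson summation in the first variable. -/
def mixedTerm (N D : ℕ) (x y u v : ℝ) (m b c : ℤ) : ℂ :=
  cexp (((-(Real.pi * N * y ^ 2 / (D * v)) * ((m - c * u) ^ 2 + (c * v) ^ 2) : ℝ) : ℂ) +
    2 * Real.pi * I * ((u + v * I) * ((b - 2 * N * c * x) ^ 2 / (4 * N * D)) +
      m * (b * x - N * c * x ^ 2) / D))

/-- The Gaussian kernel of the Siegel theta function at `τ` and `t`. -/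
def siegelTerm (N D : ℕ) (t τ : UpperHalfPlane) (a b c : ℤ) : ℂ :=
  e ((pz N a b c t / (D : ℝ) : ℝ) * (τ : ℂ) +
    ((Qval N a b c - pz N a b c t) / (D : ℝ) : ℝ) * (starRingEnd ℂ) (τ : ℂ))

/-- The factor of the Siegel kernel which does not take part in the Poisson summation. -/
def siegelFactor (N D : ℕ) (x y u v : ℝ) (b c : ℤ) : ℂ :=
  cexp (-Real.pi * (v / (N * D * y ^ 2)) * (b * x - N * c * x ^ 2) ^ 2 +
    2 * Real.pi * I * (u * c * (b * x - N * c * x ^ 2) / D) - Real.pi * v * N * c ^ 2 * y ^ 2 / D +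
    2 * Real.pi * I * ((u + v * I) * ((b - 2 * N * c * x) ^ 2 / (4 * N * D))))

variable {N D : ℕ}

lemma siegelTerm_eq (hN : 0 < N) (hD : 0 < D) (t τ : UpperHalfPlane) (a b c : ℤ) :
    siegelTerm N D t τ a b c = siegelFactor N D t.re t.im τ.re τ.im b c *
      jacobiTheta₂_term a (-I * (τ.im / (N * D * t.im ^ 2)) *
        (b * t.re - N * c * t.re ^ 2) - τ.re * c / D) (I * (τ.im / (N * D * t.im ^ 2))) := by
  have hN0 : (N : ℂ) ≠ 0 := by exact_mod_cast hN.ne'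
  have hD0 : (D : ℂ) ≠ 0 := by exact_mod_cast hD.ne'
  have hy : (t.im : ℂ) ≠ 0 := by exact_mod_cast t.im_pos.ne'
  have hτ : (τ : ℂ) = τ.re + τ.im * I := (Complex.re_add_im (τ : ℂ)).symm
  have hτ' : (starRingEnd ℂ) (τ : ℂ) = τ.re - τ.im * I := by
    rw [hτ]; simp [sub_eq_add_neg]
  rw [siegelTerm, siegelFactor, jacobiTheta₂_term, ← Complex.exp_add, hτ', hτ, e, pz, Qval, QD]
  congr 1
  push_cast
  field_simp
  ring_nf
  simp only [I_sq]
  ring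

lemma siegelFactor_mul (hN : 0 < N) (hD : 0 < D) {x y u v : ℝ} (hy : y ≠ 0) (hv : v ≠ 0)
    (m b c : ℤ) :
    siegelFactor N D x y u v b c * cexp (-Real.pi * ((-I * (v / (N * D * y ^ 2)) *
      (b * x - N * c * x ^ 2) - u * c / D) + m / D) ^ 2 / (v / (N * D * y ^ 2))) =
    mixedTerm N D x y u v m b c := by
  have hN0 : (N : ℂ) ≠ 0 := by exact_mod_cast hN.ne'
  have hD0 : (D : ℂ) ≠ 0 := by exact_mod_cast hD.ne'
  have hy : (y : ℂ) ≠ 0 := by exact_mod_cast hy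
  have hv : (v : ℂ) ≠ 0 := by exact_mod_cast hv
  rw [siegelFactor, mixedTerm, ← Complex.exp_add]
  congr 1
  push_cast
  field_simp
  ring_nf
  simp only [I_sq]
  ring

/-- The factor of the mixed kernel which does not take part in the Poisson summation in the middle
variable. -/
def mixedFactor (N D : ℕ) (x y u v : ℝ) (m c : ℤ) : ℂ :=
  cexp (((-(Real.pi * N * y ^ 2 / (D * v)) * ((c + m * u) ^ 2 + (m * v) ^ 2) : ℝ) : ℂ) -
    2 * Real.pi * I * (N * c ^ 2 * x ^ 2 / ((u + v * I) * D)) - 2 * Real.pi * I *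
      (m * N * c * x ^ 2 / D))

lemma mixedTerm_inversion (hN : 0 < N) (hD : 0 < D) {x y u v : ℝ} (hv : 0 < v) (m b c : ℤ) :
    mixedTerm N D x y (-u / (u ^ 2 + v ^ 2)) (v / (u ^ 2 + v ^ 2)) m b c =
      mixedFactor N D x y u v m c * jacobiTheta₂_term b
        (x * (c + m * (u + v * I)) / (D * (u + v * I)))
        (I * (I / (2 * N * D * (u + v * I)))) := by
  have hN0 : (N : ℂ) ≠ 0 := by exact_mod_cast hN.ne'
  have hD0 : (D : ℂ) ≠ 0 := by exact_mod_cast hD.ne'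
  have hn : u ^ 2 + v ^ 2 ≠ 0 := by positivity
  have hτ : (u + v * I : ℂ) ≠ 0 := fun h => hv.ne' (by simpa using congrArg Complex.im h)
  have h1 : (((-u / (u ^ 2 + v ^ 2) : ℝ) : ℂ) + ((v / (u ^ 2 + v ^ 2) : ℝ) : ℂ) * I) =
      -(u + v * I : ℂ)⁻¹ := by
    have hn' : ((u ^ 2 + v ^ 2 : ℝ) : ℂ) ≠ 0 := by exact_mod_cast hn
    have : (u + v * I : ℂ) * (u - v * I) = ((u ^ 2 + v ^ 2 : ℝ) : ℂ) := by
      push_cast; linear_combination (-(v : ℂ) ^ 2) * I_sq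
    rw [← mul_right_inj' hτ, mul_neg, mul_inv_cancel₀ hτ, ← mul_left_inj' hn', ofReal_div,
      ofReal_div]
    field_simp
    push_cast at this ⊢
    linear_combination (-1 : ℂ) * this
  have h2 : -(Real.pi * N * y ^ 2 / (D * (v / (u ^ 2 + v ^ 2)))) *
      ((m - c * (-u / (u ^ 2 + v ^ 2))) ^ 2 + (c * (v / (u ^ 2 + v ^ 2))) ^ 2) =
      -(Real.pi * N * y ^ 2 / (D * v)) * ((c + m * u) ^ 2 + (m * v) ^ 2) := by
    have hD0 : (D : ℝ) ≠ 0 := by exact_mod_cast hD.ne'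
    field_simp
    ring
  rw [mixedTerm, h1, h2, mixedFactor, jacobiTheta₂_term, ← Complex.exp_add]
  congr 1
  generalize (u + v * I : ℂ) = z at hτ
  generalize ((-(Real.pi * N * y ^ 2 / (D * v)) *
    ((c + m * u) ^ 2 + (m * v) ^ 2) : ℝ) : ℂ) = w
  field_simp
  ring_nf
  rw [show I ^ 3 = -I by rw [pow_succ, I_sq]; ring]
  ring

lemma mixedFactor_mul (hN : 0 < N) (hD : 0 < D) {x y u v : ℝ} (hv : 0 < v) (m n c : ℤ) :
    mixedFactor N D x y u v m c * cexp (-Real.pi *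
      (x * (c + m * (u + v * I)) / (D * (u + v * I)) + n / ((2 * N * D : ℕ) : ℂ)) ^ 2 /
        (I / (2 * N * D * (u + v * I)))) = mixedTerm N D x y u v c n (-m) := by
  have hN0 : (N : ℂ) ≠ 0 := by exact_mod_cast hN.ne'
  have hD0 : (D : ℂ) ≠ 0 := by exact_mod_cast hD.ne'
  have hτ : (u + v * I : ℂ) ≠ 0 := fun h => hv.ne' (by simpa using congrArg Complex.im h)
  have h2 : (c - (-m : ℤ) * u) ^ 2 + ((-m : ℤ) * v) ^ 2 = (c + m * u) ^ 2 + (m * v) ^ 2 := by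
    push_cast; ring
  rw [mixedTerm, mixedFactor, h2, ← Complex.exp_add]
  congr 1
  generalize (u + v * I : ℂ) = z at hτ
  generalize ((-(Real.pi * N * y ^ 2 / (D * v)) *
    ((c + m * u) ^ 2 + (m * v) ^ 2) : ℝ) : ℂ) = w
  push_cast
  field_simp
  ring_nf
  simp only [I_sq]
  ring

lemma siegelTerm_norm (hN : 0 < N) (hD : 0 < D) (t τ : UpperHalfPlane) (a b c : ℤ) :
    ‖siegelTerm N D t τ a b c‖ = Real.exp (-(Real.pi * τ.im / (N * D * t.im ^ 2) *
      (a + -t.re * b + N * t.re ^ 2 * c) ^ 2 + Real.pi * τ.im / (2 * N * D) *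
        (b + -(2 * N * t.re) * c) ^ 2 + Real.pi * τ.im * N * t.im ^ 2 / D * (c : ℝ) ^ 2)) := by
  have hN0 : (N : ℝ) ≠ 0 := by exact_mod_cast hN.ne'
  have hD0 : (D : ℝ) ≠ 0 := by exact_mod_cast hD.ne'
  have hy : t.im ≠ 0 := t.im_pos.ne'
  rw [siegelTerm, e, Complex.norm_exp]
  congr 1
  rw [show 2 * (Real.pi : ℂ) * I = ((2 * Real.pi : ℝ) : ℂ) * I by push_cast; ring, mul_assoc,
    re_ofReal_mul, I_mul_re, add_im, im_ofReal_mul, im_ofReal_mul, conj_im, UpperHalfPlane.coe_im,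
    pz, Qval, QD]
  push_cast
  field_simp
  ring

lemma mixedTerm_norm (hN : 0 < N) (hD : 0 < D) {v : ℝ} (hv : v ≠ 0) (x y u : ℝ) (m b c : ℤ) :
    ‖mixedTerm N D x y u v m b c‖ = Real.exp (-(Real.pi * N * y ^ 2 / (D * v) *
      (m + 0 * b + -u * c) ^ 2 + Real.pi * v / (2 * N * D) *
        (b + -(2 * N * x) * c) ^ 2 + Real.pi * N * y ^ 2 * v / D * (c : ℝ) ^ 2)) := by
  have hN0 : (N : ℝ) ≠ 0 := by exact_mod_cast hN.ne'
  have hD0 : (D : ℝ) ≠ 0 := by exact_mod_cast hD.ne'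
  rw [mixedTerm, Complex.norm_exp]
  congr 1
  rw [show 2 * (Real.pi : ℂ) * I * ((u + v * I) * ((b - 2 * N * c * x) ^ 2 / (4 * N * D)) +
      m * (b * x - N * c * x ^ 2) / D) =
      ((-(2 * Real.pi * v * ((b - 2 * N * c * x) ^ 2 / (4 * N * D))) : ℝ) : ℂ) +
      ((2 * Real.pi * (u * ((b - 2 * N * c * x) ^ 2 / (4 * N * D)) +
        m * (b * x - N * c * x ^ 2) / D) : ℝ) : ℂ) * I by
    push_cast
    linear_combination 2 * Real.pi * v * ((b - 2 * N * c * x) ^ 2 / (4 * N * D) : ℂ) * I_sq,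
    add_re, add_re, ofReal_re, ofReal_re, re_ofReal_mul, I_re]
  field_simp
  ring

lemma summable_mul_siegelTerm (hN : 0 < N) (hD : 0 < D) (t τ : UpperHalfPlane)
    {w : ℤ → ℤ → ℤ → ℂ} {B : ℝ} (hw : ∀ a b c, ‖w a b c‖ ≤ B) :
    Summable fun v : ℤ × ℤ × ℤ =>
      w v.1 v.2.1 v.2.2 * siegelTerm N D t τ v.1 v.2.1 v.2.2 := by
  have hN0 : (0 : ℝ) < N := by exact_mod_cast hN
  have hD0 : (0 : ℝ) < D := by exact_mod_cast hD
  have := t.im_pos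
  have := τ.im_pos
  refine Summable.of_norm_bounded ((summable_exp_neg_triangular
    (α := Real.pi * τ.im / (N * D * t.im ^ 2)) (β := Real.pi * τ.im / (2 * N * D))
    (γ := Real.pi * τ.im * N * t.im ^ 2 / D) (by positivity) (by positivity) (by positivity)
    (-t.re) (N * t.re ^ 2) (-(2 * N * t.re))).mul_left B) fun v => ?_
  rw [norm_mul, siegelTerm_norm hN hD]
  gcongr
  exact hw _ _ _

lemma summable_mul_mixedTerm (hN : 0 < N) (hD : 0 < D) {y v : ℝ} (hy : 0 < y) (hv : 0 < v)
    (x u : ℝ) {w : ℤ → ℤ → ℤ → ℂ} {B : ℝ} (hw : ∀ m b c, ‖w m b c‖ ≤ B) :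
    Summable fun q : ℤ × ℤ × ℤ =>
      w q.1 q.2.1 q.2.2 * mixedTerm N D x y u v q.1 q.2.1 q.2.2 := by
  have hN0 : (0 : ℝ) < N := by exact_mod_cast hN
  have hD0 : (0 : ℝ) < D := by exact_mod_cast hD
  refine Summable.of_norm_bounded ((summable_exp_neg_triangular
    (α := Real.pi * N * y ^ 2 / (D * v)) (β := Real.pi * v / (2 * N * D))
    (γ := Real.pi * N * y ^ 2 * v / D) (by positivity) (by positivity) (by positivity)
    0 (-u) (-(2 * N * x))).mul_left B) fun q => ?_
  rw [norm_mul, mixedTerm_norm hN hD hv.ne']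
  gcongr
  exact hw _ _ _

end Kernel

section TripleSums

variable {f : ℤ × ℤ × ℤ → ℂ}

lemma tsum_triple_fst (hf : Summable f) :
    ∑' v, f v = ∑' w : ℤ × ℤ, ∑' a, f (a, w.1, w.2) := by
  have h := (Equiv.prodComm (ℤ × ℤ) ℤ).summable_iff.mpr hf
  rw [← (Equiv.prodComm (ℤ × ℤ) ℤ).tsum_eq]
  exact h.tsum_prod

/-- The rearrangement of a triple which isolates the middle entry. -/
def middleEquiv : (ℤ × ℤ) × ℤ ≃ ℤ × ℤ × ℤ where
  toFun p := (p.1.1, p.2, p.1.2)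
  invFun v := ((v.1, v.2.2), v.2.1)
  left_inv _ := rfl
  right_inv _ := rfl

lemma tsum_triple_middle (hf : Summable f) :
    ∑' v, f v = ∑' w : ℤ × ℤ, ∑' b, f (w.1, b, w.2) := by
  have h := middleEquiv.summable_iff.mpr hf
  rw [← middleEquiv.tsum_eq]
  exact h.tsum_prod

/-- The rotation `(m, n, c) ↦ (c, n, -m)`. -/
def rotateEquiv : ℤ × ℤ × ℤ ≃ ℤ × ℤ × ℤ where
  toFun v := (v.2.2, v.2.1, -v.1)
  invFun v := (-v.2.2, v.2.1, v.1)
  left_inv v := by simp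
  right_inv v := by simp

end TripleSums

section Transformation

variable {N : ℕ} {Δ r M : ℤ} {χ : ℤ → ℤ → ℤ → ℤ}

/-- The partial Fourier transform of the twisting function in the first variable. -/
def weightHat (N : ℕ) (Δ r : ℤ) (χ : ℤ → ℤ → ℤ → ℤ) (h m b c : ℤ) : ℂ :=
  ∑ a ∈ Finset.range Δ.natAbs, weight N Δ r χ h a b c * eDiv Δ.natAbs (-(a * m))

lemma natAbs_modEq_iff {a b : ℤ} : a ≡ b [ZMOD (Δ.natAbs : ℤ)] ↔ a ≡ b [ZMOD Δ] := by
  simp [Int.modEq_iff_dvd]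

lemma weight_periodic_fst (hχ : IsGenusChar N Δ χ) (hN : 0 < N)
    (hfd : IsFundamentalDiscriminant Δ) (hΔ : Δ = r ^ 2 - 4 * (N * M)) (h b c : ℤ) :
    Function.Periodic (fun a => weight N Δ r χ h a b c) (Δ.natAbs : ℤ) := fun a =>
  weight_congr hχ hN hfd hΔ (natAbs_modEq_iff.mp (by simp [Int.modEq_iff_dvd])) rfl rfl

lemma modEq_two_mul_natAbs {a b : ℤ} (h : a ≡ b [ZMOD ((2 * N * Δ.natAbs : ℕ) : ℤ)]) :
    a ≡ b [ZMOD (2 * N * Δ)] := by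
  rw [Int.modEq_iff_dvd] at h ⊢
  refine dvd_trans ?_ h
  rw [Nat.cast_mul, Nat.cast_mul]
  exact mul_dvd_mul_left _ (Int.dvd_natAbs.mpr dvd_rfl)

lemma exists_norm_weight_le (hχ : IsGenusChar N Δ χ) (hN : 0 < N)
    (hfd : IsFundamentalDiscriminant Δ) (hΔ : Δ = r ^ 2 - 4 * (N * M)) (h : ℤ) :
    ∃ B : ℝ, ∀ a b c, ‖weight N Δ r χ h a b c‖ ≤ B := by
  have hD : Δ.natAbs ≠ 0 := Int.natAbs_ne_zero.mpr (IsFundamentalDiscriminant.ne_zero hfd)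
  have : NeZero Δ.natAbs := ⟨hD⟩
  have : NeZero (2 * N * Δ.natAbs) := ⟨by positivity⟩
  obtain ⟨B, hB⟩ := (Set.finite_range fun p : ZMod Δ.natAbs × ZMod (2 * N * Δ.natAbs) ×
    ZMod Δ.natAbs => ‖weight N Δ r χ h (p.1.val : ℕ) (p.2.1.val : ℕ) (p.2.2.val : ℕ)‖).bddAbove
  refine ⟨B, fun a b c => ?_⟩
  have hval : ∀ (m : ℕ) [NeZero m] (n : ℤ), n ≡ (((n : ZMod m).val : ℕ) : ℤ) [ZMOD m] := by
    intro m _ n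
    rw [← ZMod.intCast_eq_intCast_iff]
    simp
  rw [weight_congr hχ hN hfd hΔ (natAbs_modEq_iff.mp (hval Δ.natAbs a))
    (modEq_two_mul_natAbs (hval (2 * N * Δ.natAbs) b)) (natAbs_modEq_iff.mp (hval Δ.natAbs c))]
  exact hB ⟨(a, b, c), rfl⟩

lemma norm_eDiv (L : ℕ) (n : ℤ) : ‖eDiv L n‖ = 1 := by
  rw [eDiv, e, show 2 * (Real.pi : ℂ) * I * (n / L) = ((2 * Real.pi * (n / L) : ℝ) : ℂ) * I by
    push_cast; ring]
  exact Complex.norm_exp_ofReal_mul_I _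

lemma exists_norm_weightHat_le (hχ : IsGenusChar N Δ χ) (hN : 0 < N)
    (hfd : IsFundamentalDiscriminant Δ) (hΔ : Δ = r ^ 2 - 4 * (N * M)) (h : ℤ) :
    ∃ B : ℝ, ∀ m b c, ‖weightHat N Δ r χ h m b c‖ ≤ B := by
  obtain ⟨B, hB⟩ := exists_norm_weight_le hχ hN hfd hΔ h
  refine ⟨∑ a ∈ Finset.range Δ.natAbs, B, fun m b c => ?_⟩
  refine (norm_sum_le _ _).trans (Finset.sum_le_sum fun a _ => ?_)
  rw [norm_mul, norm_eDiv, mul_one]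
  exact hB _ _ _

lemma weightHat_periodic_snd (hχ : IsGenusChar N Δ χ) (hN : 0 < N)
    (hfd : IsFundamentalDiscriminant Δ) (hΔ : Δ = r ^ 2 - 4 * (N * M)) (h m c : ℤ) :
    Function.Periodic (fun b => weightHat N Δ r χ h m b c) ((2 * N * Δ.natAbs : ℕ) : ℤ) :=
  fun b => Finset.sum_congr rfl fun a _ => by
    rw [weight_congr hχ hN hfd hΔ rfl
      (modEq_two_mul_natAbs (a := b + (2 * N * Δ.natAbs : ℕ)) (b := b)
        (by simp [Int.modEq_iff_dvd])) rfl]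

/-- The theta series obtained from the Siegel theta function by partial Poisson summation. -/
def mixedTheta (N : ℕ) (Δ r : ℤ) (χ : ℤ → ℤ → ℤ → ℤ) (t : UpperHalfPlane) (h : ℤ) (u v : ℝ) : ℂ :=
  ∑' w : ℤ × ℤ × ℤ, weightHat N Δ r χ h w.1 w.2.1 w.2.2 *
    mixedTerm N Δ.natAbs t.re t.im u v w.1 w.2.1 w.2.2

lemma thetaComp_eq_tsum (h : ZMod (2 * N)) (τ t : UpperHalfPlane) :
    thetaComp N Δ r χ h τ t = (Real.sqrt τ.im : ℂ) * ∑' v : ℤ × ℤ × ℤ,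
      weight N Δ r χ h.val v.1 v.2.1 v.2.2 *
        siegelTerm N Δ.natAbs t τ v.1 v.2.1 v.2.2 := by
  rw [thetaComp]
  congr 1
  refine tsum_congr fun v => ?_
  rw [weight, ite_mul, zero_mul]
  rfl

lemma thetaComp_eq_mixedTheta (hχ : IsGenusChar N Δ χ) (hN : 0 < N)
    (hfd : IsFundamentalDiscriminant Δ) (hΔ : Δ = r ^ 2 - 4 * (N * M)) (h : ZMod (2 * N))
    (τ t : UpperHalfPlane) :
    thetaComp N Δ r χ h τ t = (Real.sqrt (N * t.im ^ 2 / Δ.natAbs) : ℂ) *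
      mixedTheta N Δ r χ t h.val τ.re τ.im := by
  have hΔ0 : Δ.natAbs ≠ 0 := Int.natAbs_ne_zero.mpr (IsFundamentalDiscriminant.ne_zero hfd)
  have hD : 0 < Δ.natAbs := Nat.pos_of_ne_zero hΔ0
  have : NeZero Δ.natAbs := ⟨hΔ0⟩
  have hy := t.im_pos
  have hv := τ.im_pos
  have hσ : 0 < ((τ.im : ℂ) / (N * Δ.natAbs * (t.im : ℂ) ^ 2)).re := by
    rw [show (τ.im : ℂ) / (N * Δ.natAbs * (t.im : ℂ) ^ 2) =
      ((τ.im / (N * Δ.natAbs * t.im ^ 2) : ℝ) : ℂ) by push_cast; rfl, ofReal_re]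
    positivity
  have hroot : (Real.sqrt τ.im : ℂ) * (1 / (((Δ.natAbs : ℕ) : ℂ) ^ 2 * ((τ.im : ℂ) /
      (N * Δ.natAbs * (t.im : ℂ) ^ 2))) ^ (1 / 2 : ℂ)) =
      (Real.sqrt (N * t.im ^ 2 / Δ.natAbs) : ℂ) := by
    have hpos : 0 < N * t.im ^ 2 / Δ.natAbs := by positivity
    rw [show ((Δ.natAbs : ℕ) : ℂ) ^ 2 * ((τ.im : ℂ) / (N * Δ.natAbs * (t.im : ℂ) ^ 2)) =
        ((τ.im / (N * t.im ^ 2 / Δ.natAbs) : ℝ) : ℂ) by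
      have : (Δ.natAbs : ℂ) ≠ 0 := NeZero.ne _
      push_cast
      field_simp, show (1 / 2 : ℂ) = ((1 / 2 : ℝ) : ℂ) by push_cast; rfl,
      ← ofReal_cpow (by positivity), ← Real.sqrt_eq_rpow, Real.sqrt_div hv.le]
    have h1 : (Real.sqrt τ.im : ℂ) ≠ 0 := by
      exact_mod_cast (Real.sqrt_pos.mpr hv).ne'
    have h2 : (Real.sqrt (N * t.im ^ 2 / Δ.natAbs) : ℂ) ≠ 0 := by
      exact_mod_cast (Real.sqrt_pos.mpr hpos).ne'
    rw [ofReal_div]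
    field_simp
  obtain ⟨B, hB⟩ := exists_norm_weight_le hχ hN hfd hΔ h.val
  obtain ⟨B', hB'⟩ := exists_norm_weightHat_le hχ hN hfd hΔ h.val
  rw [thetaComp_eq_tsum, ← hroot, mixedTheta,
    tsum_triple_fst (summable_mul_siegelTerm hN hD t τ hB),
    tsum_triple_fst (summable_mul_mixedTerm hN hD hy hv t.re τ.re hB'), mul_assoc]
  congr 1
  rw [← tsum_mul_left]
  refine tsum_congr fun w => ?_
  have hP := tsum_periodic_mul_gaussian (weight_periodic_fst hχ hN hfd hΔ h.val w.1 w.2) hσ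
    (-I * (τ.im / (N * Δ.natAbs * t.im ^ 2)) * (w.1 * t.re - N * w.2 * t.re ^ 2) -
      τ.re * w.2 / Δ.natAbs)
  have hl : ∀ a : ℤ, weight N Δ r χ h.val a w.1 w.2 * siegelTerm N Δ.natAbs t τ a w.1 w.2 =
      siegelFactor N Δ.natAbs t.re t.im τ.re τ.im w.1 w.2 * (weight N Δ r χ h.val a w.1 w.2 *
        jacobiTheta₂_term a (-I * (τ.im / (N * Δ.natAbs * t.im ^ 2)) *
          (w.1 * t.re - N * w.2 * t.re ^ 2) - τ.re * w.2 / Δ.natAbs)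
          (I * (τ.im / (N * Δ.natAbs * t.im ^ 2)))) := fun a => by
    rw [siegelTerm_eq hN hD]; ring
  simp only [hl]
  rw [tsum_mul_left, hP, mul_left_comm]
  congr 1
  rw [← tsum_mul_left]
  refine tsum_congr fun m => ?_
  rw [← siegelFactor_mul hN hD hy.ne' hv.ne', weightHat]
  ring

lemma exists_inv_cpow_half {P : ℕ} (hP : 0 < P) :
    ∃ κ : ℂ, ∀ τ : UpperHalfPlane, 1 / ((P : ℂ) ^ 2 * (I / (P * τ))) ^ (1 / 2 : ℂ) =
      κ * (τ : ℂ) ^ (1 / 2 : ℂ) := by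
  refine ⟨(-I / P) ^ (1 / 2 : ℂ), fun τ => ?_⟩
  have hP0 : (P : ℂ) ≠ 0 := by exact_mod_cast hP.ne'
  have hI : -I / (P : ℂ) ≠ 0 := div_ne_zero (neg_ne_zero.mpr I_ne_zero) hP0
  have hτ : (τ : ℂ) ≠ 0 := τ.ne_zero
  have hinv : ((P : ℂ) ^ 2 * (I / (P * τ)))⁻¹ = -I / P * τ := by
    rw [← mul_right_inj' (show (P : ℂ) ^ 2 * (I / (P * τ)) ≠ 0 from mul_ne_zero
      (pow_ne_zero _ hP0) (div_ne_zero I_ne_zero (mul_ne_zero hP0 hτ))), mul_inv_cancel₀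
      (mul_ne_zero (pow_ne_zero _ hP0) (div_ne_zero I_ne_zero (mul_ne_zero hP0 hτ)))]
    field_simp
    simp
  have hargI : arg (-I / (P : ℂ)) = -(Real.pi / 2) := by
    rw [show -I / (P : ℂ) = (((P : ℝ)⁻¹ : ℝ) : ℂ) * -I by push_cast; field_simp,
      arg_real_mul _ (by positivity), arg_neg_I]
  have harg : arg (-I / (P : ℂ)) + arg τ ∈ Set.Ioc (-Real.pi) Real.pi := by
    have h1 : 0 ≤ arg (τ : ℂ) := arg_nonneg_iff.mpr τ.im_pos.le
    have h2 := arg_le_pi (τ : ℂ)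
    have := Real.pi_pos
    rw [hargI]
    constructor <;> linarith
  have hre : 0 < (((P : ℂ) ^ 2 * (I / (P * τ)))⁻¹).re := by
    rw [hinv, show -I / (P : ℂ) * τ = (((P : ℝ)⁻¹ : ℝ) : ℂ) * (-I * τ) by
      push_cast; field_simp, re_ofReal_mul]
    have := τ.im_pos
    simp only [neg_mul, neg_re, I_mul_re, neg_neg, UpperHalfPlane.coe_im]
    positivity
  have hpi : arg ((P : ℂ) ^ 2 * (I / (P * τ))) ≠ Real.pi := fun h => by
    have := inv_re_pos hre
    rw [inv_inv] at this
    linarith [(arg_eq_pi_iff.mp h).1]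
  rw [one_div, ← Complex.inv_cpow _ _ hpi, hinv, Complex.cpow_def_of_ne_zero (mul_ne_zero hI hτ),
    Complex.cpow_def_of_ne_zero hτ, Complex.cpow_def_of_ne_zero hI, Complex.log_mul hI hτ harg,
    ← Complex.exp_add, add_mul]

lemma re_modular_S_smul (τ : UpperHalfPlane) :
    (ModularGroup.S • τ).re = -τ.re / (τ.re ^ 2 + τ.im ^ 2) := by
  rw [UpperHalfPlane.modular_S_smul, ← UpperHalfPlane.coe_re, UpperHalfPlane.coe_mk, inv_re,
    normSq_neg, normSq_apply]
  simp [pow_two]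

lemma im_modular_S_smul (τ : UpperHalfPlane) :
    (ModularGroup.S • τ).im = τ.im / (τ.re ^ 2 + τ.im ^ 2) := by
  rw [UpperHalfPlane.modular_S_smul, ← UpperHalfPlane.coe_im, UpperHalfPlane.coe_mk, inv_im,
    normSq_neg, normSq_apply]
  simp [pow_two]

lemma exists_mixedTheta_inversion (hχ : IsGenusChar N Δ χ) (hN : 0 < N)
    (hfd : IsFundamentalDiscriminant Δ) (hΔ : Δ = r ^ 2 - 4 * (N * M)) :
    ∃ κ : ℂ, ∀ (h : ℤ) (τ t : UpperHalfPlane),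
      mixedTheta N Δ r χ t h (ModularGroup.S • τ).re (ModularGroup.S • τ).im =
        κ * (τ : ℂ) ^ (1 / 2 : ℂ) * ∑ j ∈ Finset.range (2 * N),
          eDiv (2 * N) (-(Δ.sign * h * j)) * mixedTheta N Δ r χ t j τ.re τ.im := by
  have hΔ0 : Δ.natAbs ≠ 0 := Int.natAbs_ne_zero.mpr (IsFundamentalDiscriminant.ne_zero hfd)
  have hD : 0 < Δ.natAbs := Nat.pos_of_ne_zero hΔ0
  have : NeZero Δ.natAbs := ⟨hΔ0⟩
  have hP : 0 < 2 * N * Δ.natAbs := by positivity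
  have : NeZero (2 * N * Δ.natAbs) := ⟨hP.ne'⟩
  obtain ⟨K, hK⟩ := exists_sum_weight_eq hχ hN hfd hΔ
  obtain ⟨κ, hκ⟩ := exists_inv_cpow_half hP
  refine ⟨κ * K, fun h τ t => ?_⟩
  have hy := t.im_pos
  have hv := τ.im_pos
  have hS := (ModularGroup.S • τ).im_pos
  obtain ⟨B, hB⟩ := exists_norm_weightHat_le hχ hN hfd hΔ h
  rw [mixedTheta, tsum_triple_middle (summable_mul_mixedTerm hN hD hy hS _ _ hB),
    re_modular_S_smul, im_modular_S_smul]
  have hτ : (τ : ℂ) = τ.re + τ.im * I := (Complex.re_add_im (τ : ℂ)).symm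
  have hσ : 0 < (I / (2 * N * Δ.natAbs * (τ.re + τ.im * I)) : ℂ).re := by
    rw [← hτ, ← inv_inv (I / _)]
    refine inv_re_pos ?_
    rw [inv_div, show 2 * (N : ℂ) * Δ.natAbs * τ / I =
      (((2 * N * Δ.natAbs : ℕ) : ℝ) : ℂ) * (-I * τ) by push_cast; field_simp; simp, re_ofReal_mul]
    simp only [neg_mul, neg_re, I_mul_re, neg_neg, UpperHalfPlane.coe_im]
    positivity
  have hinner : ∀ m c : ℤ, ∑' b : ℤ, weightHat N Δ r χ h m b c * mixedTerm N Δ.natAbs t.re t.im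
      (-τ.re / (τ.re ^ 2 + τ.im ^ 2)) (τ.im / (τ.re ^ 2 + τ.im ^ 2)) m b c =
      κ * K * (τ : ℂ) ^ (1 / 2 : ℂ) * ∑' n : ℤ, ∑ j ∈ Finset.range (2 * N),
        eDiv (2 * N) (-(Δ.sign * h * j)) * (weightHat N Δ r χ j c n (-m) *
          mixedTerm N Δ.natAbs t.re t.im τ.re τ.im c n (-m)) := by
    intro m c
    have hP := tsum_periodic_mul_gaussian (weightHat_periodic_snd hχ hN hfd hΔ h m c) hσ
      (t.re * (c + m * (τ.re + τ.im * I)) / (Δ.natAbs * (τ.re + τ.im * I)))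
    have hκ' := hκ τ
    rw [hτ] at hκ' ⊢
    simp only [mixedTerm_inversion hN hD hv, mul_left_comm (weightHat _ _ _ _ _ _ _ _)]
    rw [tsum_mul_left, hP, show (2 * N * Δ.natAbs : ℂ) = ((2 * N * Δ.natAbs : ℕ) : ℂ) by
      push_cast; rfl, hκ', mul_left_comm, ← tsum_mul_left, ← tsum_mul_left, ← tsum_mul_left]
    refine tsum_congr fun n => ?_
    have hK' := hK m n c h
    have hm := mixedFactor_mul hN hD (x := t.re) (y := t.im) (u := τ.re) hv m n c
    rw [show (2 * N * Δ.natAbs : ℂ) = ((2 * N * Δ.natAbs : ℕ) : ℂ) by push_cast; rfl] at hm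
    simp only [weightHat]
    simp only [hK', ← mul_assoc, ← Finset.sum_mul]
    rw [← hm]
    ring
  simp only [hinner]
  have hsum : ∀ j : ℕ, Summable fun w : ℤ × ℤ × ℤ => weightHat N Δ r χ j w.1 w.2.1 w.2.2 *
      mixedTerm N Δ.natAbs t.re t.im τ.re τ.im w.1 w.2.1 w.2.2 := fun j => by
    obtain ⟨B, hB⟩ := exists_norm_weightHat_le hχ hN hfd hΔ j
    exact summable_mul_mixedTerm hN hD hy hv _ _ hB
  have hsum' : ∀ j : ℕ, Summable fun v : ℤ × ℤ × ℤ => eDiv (2 * N) (-(Δ.sign * h * j)) *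
      (weightHat N Δ r χ j v.2.2 v.2.1 (-v.1) *
        mixedTerm N Δ.natAbs t.re t.im τ.re τ.im v.2.2 v.2.1 (-v.1)) :=
    fun j => (rotateEquiv.summable_iff.mpr (hsum j)).mul_left _
  rw [tsum_mul_left, ← tsum_triple_middle (f := fun v => ∑ j ∈ Finset.range (2 * N),
        eDiv (2 * N) (-(Δ.sign * h * j)) * (weightHat N Δ r χ j v.2.2 v.2.1 (-v.1) *
          mixedTerm N Δ.natAbs t.re t.im τ.re τ.im v.2.2 v.2.1 (-v.1)))
      (summable_sum fun j _ => hsum' j), Summable.tsum_finsetSum fun j _ => hsum' j]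
  congr 1
  refine Finset.sum_congr rfl fun j _ => ?_
  rw [tsum_mul_left, mixedTheta, ← rotateEquiv.tsum_eq fun w : ℤ × ℤ × ℤ =>
    weightHat N Δ r χ j w.1 w.2.1 w.2.2 * mixedTerm N Δ.natAbs t.re t.im τ.re τ.im w.1 w.2.1 w.2.2]
  rfl

lemma exists_thetaComp_inversion (hχ : IsGenusChar N Δ χ) (hN : 0 < N)
    (hfd : IsFundamentalDiscriminant Δ) (hΔ : Δ = r ^ 2 - 4 * (N * M)) :
    ∃ κ : ℂ, ∀ (h : ZMod (2 * N)) (τ t : UpperHalfPlane),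
      thetaComp N Δ r χ h (ModularGroup.S • τ) t =
        κ * (τ : ℂ) ^ (1 / 2 : ℂ) * ∑ j ∈ Finset.range (2 * N),
          eDiv (2 * N) (-(Δ.sign * h.val * j)) * thetaComp N Δ r χ (j : ZMod (2 * N)) τ t := by
  obtain ⟨κ, hκ⟩ := exists_mixedTheta_inversion hχ hN hfd hΔ
  refine ⟨κ, fun h τ t => ?_⟩
  rw [thetaComp_eq_mixedTheta hχ hN hfd hΔ, hκ, Finset.mul_sum, Finset.mul_sum, Finset.mul_sum]
  refine Finset.sum_congr rfl fun j hj => ?_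
  rw [thetaComp_eq_mixedTheta hχ hN hfd hΔ, ZMod.val_natCast_of_lt (Finset.mem_range.mp hj)]
  ring

lemma siegelTerm_vadd (hN : 0 < N) (hD : Δ ≠ 0) (t τ : UpperHalfPlane) {a b c h : ℤ}
    (hQ : QD N a b c ≡ Δ * h ^ 2 [ZMOD (4 * (N : ℤ) * Δ)]) :
    siegelTerm N Δ.natAbs t (ModularGroup.T • τ) a b c =
      eDiv (4 * N) (Δ.sign * h ^ 2) * siegelTerm N Δ.natAbs t τ a b c := by
  obtain ⟨k, hk⟩ := Int.modEq_iff_dvd.mp hQ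
  have hN0 : (N : ℂ) ≠ 0 := by exact_mod_cast hN.ne'
  have hD0 : (Δ.natAbs : ℂ) ≠ 0 := by exact_mod_cast Int.natAbs_ne_zero.mpr hD
  have hs : (Δ : ℂ) = Δ.sign * Δ.natAbs := by
    have := congrArg (Int.cast : ℤ → ℂ) (Int.sign_mul_natAbs Δ)
    rw [Int.cast_mul, Int.cast_natCast] at this
    exact this.symm
  have hk' : (QD N a b c : ℂ) = Δ * (h ^ 2 - 4 * N * k) := by
    have : QD N a b c = Δ * (h ^ 2 - 4 * N * k) := by linear_combination -hk
    exact_mod_cast this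
  have : NeZero (4 * N) := ⟨by positivity⟩
  have hc : Δ.sign * (h ^ 2 - 4 * N * k) ≡ Δ.sign * h ^ 2 [ZMOD ((4 * N : ℕ) : ℤ)] :=
    Int.modEq_iff_dvd.mpr ⟨Δ.sign * k, by push_cast; ring⟩
  rw [← eDiv_congr hc, siegelTerm, siegelTerm, eDiv, ← e_add]
  congr 1
  rw [UpperHalfPlane.modular_T_smul]
  simp only [UpperHalfPlane.coe_vadd, map_add, conj_ofReal, Qval]
  push_cast
  rw [hk', hs]
  field_simp
  ring

lemma thetaComp_T_smul (hN : 0 < N) (hD : Δ ≠ 0) (h : ZMod (2 * N)) (τ t : UpperHalfPlane) :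
    thetaComp N Δ r χ h (ModularGroup.T • τ) t =
      eDiv (4 * N) (Δ.sign * h.val ^ 2) * thetaComp N Δ r χ h τ t := by
  rw [thetaComp_eq_tsum, thetaComp_eq_tsum, mul_left_comm,
    show (ModularGroup.T • τ).im = τ.im by rw [UpperHalfPlane.modular_T_smul]; simp]
  congr 1
  rw [← tsum_mul_left]
  refine tsum_congr fun v => ?_
  rw [weight]
  split_ifs with hv
  · rw [siegelTerm_vadd hN hD t τ hv.2]
    ring
  · simp

end Transformation

end TwistedTheta

section Metaplectic

lemma Mp2.ext_of_eq {γ δ : Mp2} (hM : γ.M = δ.M) (hφ : ∀ τ, γ.φ τ = δ.φ τ) : γ = δ := by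
  cases γ; cases δ
  obtain rfl : _ = _ := hM
  obtain rfl : _ = _ := funext hφ
  rfl

lemma coe_smul_eq (g : Matrix.SpecialLinearGroup (Fin 2) ℤ) (τ : UpperHalfPlane) :
    ((g • τ : UpperHalfPlane) : ℂ) =
      ((g.1 0 0 : ℂ) * τ + (g.1 0 1 : ℂ)) / ((g.1 1 0 : ℂ) * τ + (g.1 1 1 : ℂ)) := by
  rw [UpperHalfPlane.coe_specialLinearGroup_apply]
  simp

lemma factor_ne_zero (g : Matrix.SpecialLinearGroup (Fin 2) ℤ) (τ : UpperHalfPlane) :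
    (g.1 1 0 : ℂ) * τ + (g.1 1 1 : ℂ) ≠ 0 := by
  have h := UpperHalfPlane.denom_ne_zero (g : GL (Fin 2) ℝ) τ
  simpa [UpperHalfPlane.denom] using h

lemma Mp2.φ_ne_zero (γ : Mp2) (τ : UpperHalfPlane) : γ.φ τ ≠ 0 := fun h =>
  factor_ne_zero γ.M τ (by rw [← γ.sq, h]; ring)

lemma mdifferentiable_modular_smul (g : Matrix.SpecialLinearGroup (Fin 2) ℤ) :
    MDifferentiable 𝓘(ℂ) 𝓘(ℂ) fun τ : UpperHalfPlane => g • τ := by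
  have h := UpperHalfPlane.mdifferentiable_smul (g := (g : GL (Fin 2) ℝ)) (by simp)
  exact h

/-- The product in the metaplectic group. -/
def Mp2.mul (γ δ : Mp2) : Mp2 where
  M := γ.M * δ.M
  φ τ := γ.φ (δ.M • τ) * δ.φ τ
  hol := (γ.hol.comp (mdifferentiable_modular_smul δ.M)).mul δ.hol
  sq τ := by
    have h := factor_ne_zero δ.M τ
    rw [mul_pow, γ.sq, δ.sq, coe_smul_eq, Matrix.SpecialLinearGroup.coe_mul, add_mul,
      mul_div_assoc', div_mul_cancel₀ _ h]
    simp only [Matrix.mul_apply, Fin.sum_univ_two]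
    push_cast
    ring

/-- The standard lift of the translation. -/
def Mp2.T : Mp2 where
  M := ModularGroup.T
  φ _ := 1
  hol := mdifferentiable_const
  sq τ := by simp [ModularGroup.T]

/-- The standard lift of the inversion. -/
def Mp2.S : Mp2 where
  M := ModularGroup.S
  φ τ := (τ : ℂ) ^ (1 / 2 : ℂ)
  hol := by
    rw [UpperHalfPlane.mdifferentiable_iff]
    refine DifferentiableOn.congr (f := fun z : ℂ => z ^ (1 / 2 : ℂ)) (fun z hz => ?_)
      fun z hz => ?_
    · exact (differentiableAt_id.cpow_const (Or.inr (ne_of_gt hz))).differentiableWithinAt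
    · simp [UpperHalfPlane.ofComplex_apply_of_im_pos hz]
  sq τ := by
    rw [← Complex.cpow_nat_mul]
    simp [ModularGroup.S]

lemma cpow_half_pos (τ : UpperHalfPlane) :
    0 < ((τ : ℂ) ^ (1 / 2 : ℂ)).re ∧ 0 < ((τ : ℂ) ^ (1 / 2 : ℂ)).im := by
  have h1 : 0 < arg (τ : ℂ) := by
    refine lt_of_le_of_ne (arg_nonneg_iff.mpr τ.im_pos.le) fun h => ?_
    have := (arg_eq_zero_iff.mp h.symm).2
    exact τ.im_pos.ne' this
  have h2 := arg_le_pi (τ : ℂ)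
  have h3 : arg (τ : ℂ) ≠ Real.pi := fun h => τ.im_pos.ne' (arg_eq_pi_iff.mp h).2
  have h4 := lt_of_le_of_ne h2 h3
  have him : (log (τ : ℂ) * (1 / 2)).im = arg (τ : ℂ) / 2 := by
    rw [show (1 / 2 : ℂ) = ((1 / 2 : ℝ) : ℂ) by push_cast; rfl, im_mul_ofReal, log_im]
    ring
  rw [Complex.cpow_def_of_ne_zero τ.ne_zero, exp_re, exp_im, him]
  exact ⟨mul_pos (Real.exp_pos _) (Real.cos_pos_of_mem_Ioo ⟨by linarith, by linarith⟩),
    mul_pos (Real.exp_pos _) (Real.sin_pos_of_pos_of_lt_pi (by linarith) (by linarith))⟩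

lemma cpow_half_mul {a b c : UpperHalfPlane} (h : (a : ℂ) * b = c) :
    (a : ℂ) ^ (1 / 2 : ℂ) * (b : ℂ) ^ (1 / 2 : ℂ) = (c : ℂ) ^ (1 / 2 : ℂ) := by
  have hsq : ∀ z : ℂ, (z ^ (1 / 2 : ℂ)) ^ 2 = z := fun z => by
    rw [← Complex.cpow_nat_mul]; simp
  have h2 : ((a : ℂ) ^ (1 / 2 : ℂ) * (b : ℂ) ^ (1 / 2 : ℂ)) ^ 2 = ((c : ℂ) ^ (1 / 2 : ℂ)) ^ 2 := by
    rw [mul_pow, hsq, hsq, hsq, h]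
  refine (sq_eq_sq_iff_eq_or_eq_neg.mp h2).resolve_right fun h3 => ?_
  have h4 := congrArg Complex.im h3
  rw [mul_im, neg_im] at h4
  obtain ⟨ha, ha'⟩ := cpow_half_pos a
  obtain ⟨hb, hb'⟩ := cpow_half_pos b
  have hc := (cpow_half_pos c).2
  have := mul_pos ha hb'
  have := mul_pos ha' hb
  linarith

/-- The relation `(ST)³ = S²` in the metaplectic group. -/
lemma Mp2.mul_cube_eq : (S.mul T).mul ((S.mul T).mul (S.mul T)) = S.mul S := by
  refine ext_of_eq ?_ fun τ => ?_
  · exact Subtype.ext (by decide)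
  · have h0 : ((ModularGroup.T • τ : UpperHalfPlane) : ℂ) = τ + 1 := by
      rw [UpperHalfPlane.modular_T_smul]; simp [add_comm]
    have hST : (((ModularGroup.S * ModularGroup.T) • τ : UpperHalfPlane) : ℂ) = -(τ + 1 : ℂ)⁻¹ := by
      rw [mul_smul, UpperHalfPlane.modular_S_smul, UpperHalfPlane.coe_mk, h0, inv_neg]
    have hne : (τ : ℂ) + 1 ≠ 0 := by rw [← h0]; exact UpperHalfPlane.ne_zero _
    have h1 : ((ModularGroup.T • (ModularGroup.S * ModularGroup.T) • τ : UpperHalfPlane) : ℂ) *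
        (ModularGroup.T • τ : UpperHalfPlane) = τ := by
      rw [UpperHalfPlane.modular_T_smul, UpperHalfPlane.coe_vadd, hST, h0, ofReal_one]
      field_simp
      ring
    have h2 : (ModularGroup.T • ((ModularGroup.S * ModularGroup.T) *
        (ModularGroup.S * ModularGroup.T)) • τ : UpperHalfPlane) = ModularGroup.S • τ := by
      refine UpperHalfPlane.ext ?_
      rw [mul_smul, mul_smul _ _ ((ModularGroup.S * ModularGroup.T) • τ),
        UpperHalfPlane.modular_S_smul, UpperHalfPlane.modular_S_smul,
        UpperHalfPlane.modular_T_smul (UpperHalfPlane.mk _ _), UpperHalfPlane.coe_vadd,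
        UpperHalfPlane.coe_mk, UpperHalfPlane.coe_mk,
        UpperHalfPlane.modular_T_smul ((ModularGroup.S * ModularGroup.T) • τ),
        UpperHalfPlane.coe_vadd, hST, ofReal_one]
      have := τ.ne_zero
      have h3 : (1 : ℂ) + -(τ + 1 : ℂ)⁻¹ = τ / (τ + 1) := by field_simp; ring
      rw [h3]
      field_simp
      ring
    simp only [mul, S, T, mul_one, h2]
    rw [cpow_half_mul h1]

variable {V : Type*} [AddCommGroup V] [Module ℂ V]

/-- `Θ` transforms under `γ` with the operator `ρ γ` and an additional factor `k`. -/
def TransformsUnder (ρ : Mp2 → V →ₗ[ℂ] V) (Θ : UpperHalfPlane → V) (γ : Mp2) (k : ℂ) : Prop :=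
  ∀ τ, Θ (γ.M • τ) = k • γ.φ τ • ρ γ (Θ τ)

variable {ρ : Mp2 → V →ₗ[ℂ] V} {Θ : UpperHalfPlane → V}

lemma TransformsUnder.mul (hρ : ∀ γ δ, ρ (γ.mul δ) = (ρ γ).comp (ρ δ)) {γ δ : Mp2} {k l : ℂ}
    (hγ : TransformsUnder ρ Θ γ k) (hδ : TransformsUnder ρ Θ δ l) :
    TransformsUnder ρ Θ (γ.mul δ) (k * l) := fun τ => by
  rw [show (γ.mul δ).M = γ.M * δ.M from rfl, mul_smul, hγ, hδ, hρ, LinearMap.comp_apply, map_smul,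
    map_smul, show (γ.mul δ).φ τ = γ.φ (δ.M • τ) * δ.φ τ from rfl]
  simp only [smul_smul]
  congr 1
  ring

lemma Mp2.S_pow_four_M : ((S.mul S).mul (S.mul S)).M = 1 :=
  Subtype.ext (by decide)

lemma Mp2.S_mul_S_M : (S.mul S).M.1 = !![-1, 0; 0, -1] := by decide

lemma Mp2.S_mul_S_smul (τ : UpperHalfPlane) : (S.mul S).M • τ = τ := by
  refine UpperHalfPlane.ext ?_
  rw [coe_smul_eq, S_mul_S_M]
  simp

lemma Mp2.S_pow_four_φ (τ : UpperHalfPlane) : ((S.mul S).mul (S.mul S)).φ τ = -1 := by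
  have h := (S.mul S).sq τ
  rw [show ((S.mul S).mul (S.mul S)).φ τ = (S.mul S).φ ((S.mul S).M • τ) * (S.mul S).φ τ from rfl,
    S_mul_S_smul, ← pow_two, h, S_mul_S_M]
  simp

/-- A lift of an element of `SL₂(ℤ)` is unique up to sign. -/
lemma Mp2.φ_eq_or_eq_neg {γ δ : Mp2} (h : γ.M = δ.M) :
    (∀ τ, γ.φ τ = δ.φ τ) ∨ ∀ τ, γ.φ τ = -δ.φ τ := by
  have := isPreconnected_univ.eq_or_eq_neg_of_sq_eq (f := γ.φ) (g := δ.φ)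
    γ.hol.continuous.continuousOn δ.hol.continuous.continuousOn
    (fun τ _ => by simp only [Pi.pow_apply]; rw [γ.sq, δ.sq, h]) fun _ => δ.φ_ne_zero _
  exact this.imp (fun h τ => h (Set.mem_univ τ)) fun h τ => h (Set.mem_univ τ)

lemma exists_transformsUnder (hρ : ∀ γ δ, ρ (γ.mul δ) = (ρ γ).comp (ρ δ))
    (hT : TransformsUnder ρ Θ Mp2.T 1) (hS : TransformsUnder ρ Θ Mp2.S 1)
    (g : Matrix.SpecialLinearGroup (Fin 2) ℤ) : ∃ γ : Mp2, γ.M = g ∧ TransformsUnder ρ Θ γ 1 := by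
  have hmul : ∀ {g g' : Matrix.SpecialLinearGroup (Fin 2) ℤ},
      (∃ γ : Mp2, γ.M = g ∧ TransformsUnder ρ Θ γ 1) →
      (∃ γ : Mp2, γ.M = g' ∧ TransformsUnder ρ Θ γ 1) →
      ∃ γ : Mp2, γ.M = g * g' ∧ TransformsUnder ρ Θ γ 1 := by
    rintro _ _ ⟨γ, rfl, hγ⟩ ⟨δ, rfl, hδ⟩
    exact ⟨γ.mul δ, rfl, by simpa using hγ.mul hρ hδ⟩
  have hS' : ∃ γ : Mp2, γ.M = ModularGroup.S ∧ TransformsUnder ρ Θ γ 1 := ⟨Mp2.S, rfl, hS⟩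
  have hT' : ∃ γ : Mp2, γ.M = ModularGroup.T ∧ TransformsUnder ρ Θ γ 1 := ⟨Mp2.T, rfl, hT⟩
  have hSS := hmul hS' hS'
  have hST := hmul hS' hT'
  have hmem : g ∈ Subgroup.closure {ModularGroup.S, ModularGroup.T} := by
    rw [SpecialLinearGroup.SL2Z_generators]
    exact Subgroup.mem_top g
  rw [← Subgroup.mem_toSubmonoid, Subgroup.closure_toSubmonoid] at hmem
  induction hmem using Submonoid.closure_induction with
  | one => exact ⟨_, Mp2.S_pow_four_M, by
      simpa using (hS.mul hρ hS).mul hρ (hS.mul hρ hS)⟩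
  | mul g g' _ _ hg hg' => exact hmul hg hg'
  | mem g hg =>
    rcases hg with (rfl | rfl) | hg
    · exact hS'
    · exact hT'
    · rw [Set.mem_inv] at hg
      rcases hg with hg | hg
      · obtain rfl : g = ModularGroup.S * ModularGroup.S * ModularGroup.S := by
          rw [← inv_inv g, hg]
          exact inv_eq_of_mul_eq_one_right (Subtype.ext (by decide))
        exact hmul hSS hS'
      · obtain rfl : g = ModularGroup.S * ModularGroup.T * (ModularGroup.S * ModularGroup.T) *
            (ModularGroup.S * (ModularGroup.S * ModularGroup.S)) := by
          rw [← inv_inv g, Set.mem_singleton_iff.mp hg]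
          exact inv_eq_of_mul_eq_one_right (Subtype.ext (by decide))
        exact hmul (hmul hST hST) (hmul hS' hSS)

/-- Transformation under all of `Mp₂(ℤ)` follows from the generators, up to a scalar for `S`. -/
lemma transforms_of_generators (hρ : ∀ γ δ, ρ (γ.mul δ) = (ρ γ).comp (ρ δ))
    (hT : TransformsUnder ρ Θ Mp2.T 1) {κ : ℂ} (hS : TransformsUnder ρ Θ Mp2.S κ)
    (γ : Mp2) (τ : UpperHalfPlane) : Θ (γ.M • τ) = γ.φ τ • ρ γ (Θ τ) := by
  have hST : TransformsUnder ρ Θ (Mp2.S.mul Mp2.T) κ := by simpa using hS.mul hρ hT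
  have hcube := hST.mul hρ (hST.mul hρ hST)
  have hsq := hS.mul hρ hS
  rw [Mp2.mul_cube_eq] at hcube
  by_cases hκ : κ = 1
  · subst hκ
    obtain ⟨δ, hM, hδ⟩ := exists_transformsUnder hρ hT hS γ.M
    rcases Mp2.φ_eq_or_eq_neg hM.symm with h | h
    · rw [Mp2.ext_of_eq hM.symm h]
      simpa using hδ τ
    · have hζ := ((hS.mul hρ hS).mul hρ (hS.mul hρ hS)).mul hρ hδ
      have heq : γ = ((Mp2.S.mul Mp2.S).mul (Mp2.S.mul Mp2.S)).mul δ := by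
        refine Mp2.ext_of_eq ?_ fun σ => ?_
        · change γ.M = ((Mp2.S.mul Mp2.S).mul (Mp2.S.mul Mp2.S)).M * δ.M
          rw [Mp2.S_pow_four_M, one_mul, hM]
        · change γ.φ σ = ((Mp2.S.mul Mp2.S).mul (Mp2.S.mul Mp2.S)).φ (δ.M • σ) * δ.φ σ
          rw [h, Mp2.S_pow_four_φ, neg_one_mul]
      rw [← heq] at hζ
      simpa using hζ τ
  · have hzero : ∀ σ, Θ σ = 0 := fun σ => by
      have h1 := hsq σ
      have h2 := hcube σ
      rw [h1, ← sub_eq_zero, ← sub_smul,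
        show κ * κ - κ * (κ * κ) = κ * κ * (1 - κ) by ring, mul_smul] at h2
      rw [Mp2.S_mul_S_smul] at h1
      rw [h1]
      rw [smul_comm] at h2
      exact (smul_eq_zero.mp h2).resolve_left (sub_ne_zero.mpr (Ne.symm hκ))
    rw [hzero, hzero, map_zero, smul_zero]

end Metaplectic

/-- Bruinier–Ono, Theorem 4.1: Let `Δ` be a fundamental discriminant and
`r ∈ ℤ` with `Δ ≡ r² (mod 4N)`.  The twisted Siegel theta function `Θ_{Δ,r}(τ, z)`
(whose components are `thetaComp N Δ r χ h τ t`, with `Gr(V)` identified with `ℍ`) is a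
non-holomorphic `ℂ[L'/L]`-valued modular form for `Mp₂(ℤ)` of weight `1/2` in `τ`,
transforming with the Weil representation `ρ_L` if `Δ > 0` and with `ρ̄_L` if `Δ < 0`:
for every `(M, φ) ∈ Mp₂(ℤ)` one has `Θ_{Δ,r}(Mτ, z) = φ(τ) ρ̃_L(M, φ) Θ_{Δ,r}(τ, z)`.
Here `ρ̃_L` (`= ρ_L` for `Δ > 0`, `= ρ̄_L` for `Δ < 0`) is encoded as any assignment
`ρ` of linear endomorphisms of `ℂ[L'/L] = (ℤ/2Nℤ → ℂ)` which is compatible with the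
metaplectic group law and takes the prescribed values of `ρ_L` (resp. `ρ̄_L`) on the
standard generators `T = ([[1,1],[0,1]], 1)` and `S = ([[0,-1],[1,0]], √τ)`. -/
theorem twisted_siegel_theta_transforms
    (N : ℕ) (hN : 0 < N) (Δ : ℤ) (hΔ : IsFundamentalDiscriminant Δ)
    (r : ℤ) (hr : Δ ≡ r ^ 2 [ZMOD (4 * (N : ℤ))])
    (χ : ℤ → ℤ → ℤ → ℤ) (hχ : IsGenusChar N Δ χ)
    (ρ : Mp2 → (ZMod (2 * N) → ℂ) →ₗ[ℂ] (ZMod (2 * N) → ℂ))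
    (hρmul : ∀ γ δ ζ : Mp2, ζ.M = γ.M * δ.M →
      (∀ τ : UpperHalfPlane, ζ.φ τ = γ.φ (δ.M • τ) * δ.φ τ) →
      ρ ζ = (ρ γ).comp (ρ δ))
    (hρT : ∀ γ : Mp2, γ.M = ModularGroup.T → (∀ τ, γ.φ τ = 1) →
      ∀ (v : ZMod (2 * N) → ℂ) (h : ZMod (2 * N)),
        ρ γ v h = e ((Δ.sign : ℂ) * (h.val : ℂ) ^ 2 / (4 * (N : ℂ))) * v h)
    (hρS : ∀ γ : Mp2, γ.M = ModularGroup.S →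
      (∀ τ : UpperHalfPlane, γ.φ τ = (τ : ℂ) ^ (1/2 : ℂ)) →
      ∀ (v : ZMod (2 * N) → ℂ) (h : ZMod (2 * N)),
        ρ γ v h = e (-(Δ.sign : ℂ) / 8) / (Real.sqrt (2 * N) : ℂ) *
          ∑ j ∈ Finset.range (2 * N),
            e (-(Δ.sign : ℂ) * (h.val : ℂ) * (j : ℂ) / (2 * (N : ℂ))) * v (j : ZMod (2 * N))) :
    ∀ (γ : Mp2) (τ t : UpperHalfPlane),
      (fun h => thetaComp N Δ r χ h (γ.M • τ) t) =
        γ.φ τ • ρ γ (fun h => thetaComp N Δ r χ h τ t) := by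
  intro γ τ t
  obtain ⟨M, hM⟩ := Int.modEq_iff_dvd.mp hr
  have hD : Δ = r ^ 2 - 4 * (N * M) := by linear_combination -hM
  have hρ : ∀ γ δ, ρ (γ.mul δ) = (ρ γ).comp (ρ δ) := fun γ δ =>
    hρmul γ δ (γ.mul δ) rfl fun _ => rfl
  obtain ⟨κ, hκ⟩ := TwistedTheta.exists_thetaComp_inversion (χ := χ) hχ hN hΔ hD
  set Θ : UpperHalfPlane → ZMod (2 * N) → ℂ := fun τ h => thetaComp N Δ r χ h τ t with hΘ
  have hT : TransformsUnder ρ Θ Mp2.T 1 := fun τ => by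
    funext h
    rw [one_smul, Pi.smul_apply, hρT Mp2.T rfl (fun _ => rfl)]
    change thetaComp N Δ r χ h (ModularGroup.T • τ) t = (1 : ℂ) • (_ * _)
    rw [one_smul, TwistedTheta.thetaComp_T_smul hN
      (TwistedTheta.IsFundamentalDiscriminant.ne_zero hΔ), TwistedTheta.eDiv]
    push_cast
    rfl
  have hc : e (-(Δ.sign : ℂ) / 8) / (Real.sqrt (2 * N) : ℂ) ≠ 0 :=
    div_ne_zero (TwistedTheta.e_ne_zero _)
      (ofReal_ne_zero.mpr (Real.sqrt_pos.mpr (by positivity)).ne')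
  have hS : TransformsUnder ρ Θ Mp2.S (κ / (e (-(Δ.sign : ℂ) / 8) / (Real.sqrt (2 * N) : ℂ))) :=
    fun τ => by
      funext h
      rw [Pi.smul_apply, Pi.smul_apply, hρS Mp2.S rfl (fun _ => rfl)]
      change thetaComp N Δ r χ h (ModularGroup.S • τ) t = _ • (τ : ℂ) ^ (1 / 2 : ℂ) • _
      rw [hκ h τ t, smul_eq_mul, smul_eq_mul, mul_left_comm (_ ^ _), ← mul_assoc (κ / _),
        div_mul_cancel₀ _ hc, mul_assoc]
      simp only [TwistedTheta.eDiv, hΘ]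
      push_cast
      simp only [neg_mul]
  exact transforms_of_generators hρ hT hS γ τ
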